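/- arXiv:2303.11025 — 2 statements merged into one kernel-verified Lean document; each statement's English description precedes it below -/
import Mathlib

section
/- For any acyclic pipe dreams P, P′ ∈ Π(ω), the following assertions are equivalent: (i) P′ is reachable from P by a (possibly empty) sequence of increasing flips passing only through acyclic pipe dreams of Π(ω); (ii) there exist linear extensions π of P and π′ of P′ with π ≤ π′ in the weak order; (iii) the minimal linear extensions of P and P′ are comparable: min L(P) ≤ min L(P′) (equivalently, max L(P) ≤ max L(P′)); (iv) there is no pair i < j with j ⪯_P i and i ⪯_{P′} j; (v) for all i < j, if j ⪯_P i then j ⪯_{P′} i; (vi) for all i < j, if i ⪯_{P′} j then i ⪯_P j. -/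
/-- A pipe dream of size `n` on the triangular shape, with boxes indexed by pairs
`(r, c)` of a row `r` and a column `c`, both `0`-indexed (rows increase southwards,
columns increase eastwards).  `cross r c = true` means that box `(r, c)` contains a
crossing tile; all other boxes contain elbow tiles.  Crossings are only allowed in
the full boxes of the triangular shape, i.e. those with `r + c + 2 ≤ n` (the boxes
with `r + c + 1 = n` are the half-boxes on the antidiagonal, which are forced
elbows).  The `n` pipes enter horizontally on the left side in rows `0, …, n-1` and
exit vertically on the top side in columns `0, …, n-1`; pipe `k` is the pipe
entering at row `k`.  An elbow tile connects the west edge of its box to the north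
edge (the pipe travelling through this elbow passes northwest of the tile) and the
south edge to the east edge (this pipe passes southeast of the tile); a crossing
tile connects west to east and south to north. -/
structure PipeDream (n : ℕ) where
  cross : ℕ → ℕ → Bool
  inShape : ∀ r c : ℕ, cross r c = true → r + c + 2 ≤ n

namespace PipeDream

variable {n : ℕ}

/-- `(P.pipes r c).1` is the label of the pipe entering box `(r, c)` from the west,
and `(P.pipes r c).2` is the label of the pipe entering box `(r, c)` from the south
(junk value `0` if there is no box below box `(r, c)` in the triangular shape). -/
def pipes (P : PipeDream n) : ℕ → ℕ → ℕ × ℕ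
  | r, c =>
    (if hc : c = 0 then r
      else if P.cross r (c - 1) then (pipes P r (c - 1)).1 else (pipes P r (c - 1)).2,
     if hr : r + c + 2 ≤ n then
        if P.cross (r + 1) c then (pipes P (r + 1) c).2 else (pipes P (r + 1) c).1
      else 0)
  termination_by r c => (n - r) + c
  decreasing_by all_goals omega

/-- The pipe entering box `(r, c)` from the west (travelling eastwards). -/
def west (P : PipeDream n) (r c : ℕ) : ℕ := (pipes P r c).1

/-- The pipe entering box `(r, c)` from the south (travelling northwards). -/
def south (P : PipeDream n) (r c : ℕ) : ℕ := (pipes P r c).2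

/-- The pipe exiting on the top side at column `c`. -/
def exitPipe (P : PipeDream n) (c : ℕ) : ℕ :=
  if P.cross 0 c then P.south 0 c else P.west 0 c

/-- `P` has exit permutation `ω`, i.e. the pipe exiting at column `c` is `ω c`;
equivalently, pipe `k` exits at column `ω⁻¹ k`. -/
def HasExitPerm (P : PipeDream n) (ω : Equiv.Perm (Fin n)) : Prop :=
  ∀ c : Fin n, P.exitPipe c.val = (ω c).val

/-- `P` is reduced: any two of its pipes cross at most once. -/
def Reduced (P : PipeDream n) : Prop :=
  ∀ r c r' c' : ℕ, P.cross r c = true → P.cross r' c' = true → (r, c) ≠ (r', c') →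
    ¬ ((P.west r c = P.west r' c' ∧ P.south r c = P.south r' c') ∨
        (P.west r c = P.south r' c' ∧ P.south r c = P.west r' c'))

/-- The arcs of the contact graph `P♯` of `P`: there is one arc for each elbow
contact of `P` (an elbow tile in a full box of the triangular shape), oriented from
the pipe passing northwest of the contact (the one travelling west-to-north) to the
pipe passing southeast of it (the one travelling south-to-east). -/
def Arc (P : PipeDream n) (i j : ℕ) : Prop :=
  ∃ r c : ℕ, r + c + 2 ≤ n ∧ P.cross r c = false ∧ P.west r c = i ∧ P.south r c = j

/-- `P` is acyclic: its contact graph has no directed cycle. -/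
def Acyclic (P : PipeDream n) : Prop := ∀ i : ℕ, ¬ Relation.TransGen P.Arc i i

/-- `i ⪯_P j` : there is a directed path (possibly empty) from `i` to `j` in the
contact graph of `P`. -/
def Path (P : PipeDream n) (i j : ℕ) : Prop := Relation.ReflTransGen P.Arc i j

/-- `π` is a linear extension of `P` : `π⁻¹ i < π⁻¹ j` for every arc `i → j` of the
contact graph of `P`. -/
def LinExt (P : PipeDream n) (π : Equiv.Perm (Fin n)) : Prop :=
  ∀ i j : Fin n, P.Arc i.val j.val → π⁻¹ i < π⁻¹ j

/-- There is a contact (an elbow tile in a full box) between pipes `i` and `j`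
at box `b`. -/
def ContactAt (P : PipeDream n) (i j : ℕ) (b : ℕ × ℕ) : Prop :=
  b.1 + b.2 + 2 ≤ n ∧ P.cross b.1 b.2 = false ∧
    ((P.west b.1 b.2 = i ∧ P.south b.1 b.2 = j) ∨
      (P.west b.1 b.2 = j ∧ P.south b.1 b.2 = i))

/-- `P'` is obtained from `P` by the flip exchanging the contact at box `b` with the
crossing at box `b'` (a contact and a crossing between the same two pipes). -/
def IsFlip (P P' : PipeDream n) (b b' : ℕ × ℕ) : Prop :=
  b ≠ b' ∧
  P.cross b.1 b.2 = false ∧ P.cross b'.1 b'.2 = true ∧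
  P'.cross b.1 b.2 = true ∧ P'.cross b'.1 b'.2 = false ∧
  (∀ r c : ℕ, (r, c) ≠ b → (r, c) ≠ b' → P.cross r c = P'.cross r c) ∧
  ((P.west b.1 b.2 = P.west b'.1 b'.2 ∧ P.south b.1 b.2 = P.south b'.1 b'.2) ∨
    (P.west b.1 b.2 = P.south b'.1 b'.2 ∧ P.south b.1 b.2 = P.west b'.1 b'.2))

/-- There is an increasing flip from `P` to `P'`: a flip exchanging a contact at a
box `b` weakly southwest of the box `b'` of the corresponding crossing. -/
def IncFlip (P P' : PipeDream n) : Prop :=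
  ∃ b b' : ℕ × ℕ, P.IsFlip P' b b' ∧ b'.1 ≤ b.1 ∧ b.2 ≤ b'.2

end PipeDream

/-- The weak order on permutations of `Fin n` : `π ≤ σ` if and only if
`Inv(π) ⊆ Inv(σ)`, where `Inv(π)` is the set of pairs `(i, j)` with `i < j` and
`π⁻¹ i > π⁻¹ j`. -/
def WeakLE {n : ℕ} (π σ : Equiv.Perm (Fin n)) : Prop :=
  ∀ i j : Fin n, i < j → π⁻¹ j < π⁻¹ i → σ⁻¹ j < σ⁻¹ i

/-- `P` is an acyclic reduced pipe dream of `Π(ω)`. -/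
def GoodPD {n : ℕ} (ω : Equiv.Perm (Fin n)) (P : PipeDream n) : Prop :=
  P.Reduced ∧ P.HasExitPerm ω ∧ P.Acyclic

/-- An arc of the increasing flip graph on the acyclic pipe dreams of `Π(ω)`. -/
def FlipStep {n : ℕ} (ω : Equiv.Perm (Fin n)) (P Q : PipeDream n) : Prop :=
  GoodPD ω P ∧ GoodPD ω Q ∧ PipeDream.IncFlip P Q


namespace PipeDream
variable {n : ℕ} {P : PipeDream n}

/-- The pipe leaving box `(r,c)` to the north. -/
def north (P : PipeDream n) (r c : ℕ) : ℕ := if P.cross r c then P.south r c else P.west r c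

theorem west_zero (P : PipeDream n) (r : ℕ) : P.west r 0 = r := by
  unfold west; rw [pipes]; simp

theorem west_succ (P : PipeDream n) (r c : ℕ) :
    P.west r (c+1) = if P.cross r c then P.west r c else P.south r c := by
  unfold west south; rw [pipes]; simp

theorem south_eq (P : PipeDream n) {r c : ℕ} (h : r + c + 2 ≤ n) :
    P.south r c = P.north (r+1) c := by
  unfold north west south; rw [pipes]; simp [h]

theorem west_succ_cross {r c : ℕ} (h : P.cross r c = true) : P.west r (c+1) = P.west r c := by
  rw [west_succ, if_pos h]
theorem west_succ_elbow {r c : ℕ} (h : P.cross r c = false) : P.west r (c+1) = P.south r c := by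
  rw [west_succ]; simp [h]
theorem north_cross {r c : ℕ} (h : P.cross r c = true) : P.north r c = P.south r c := by
  rw [north, if_pos h]
theorem north_elbow {r c : ℕ} (h : P.cross r c = false) : P.north r c = P.west r c := by
  rw [north]; simp [h]

theorem exitPipe_eq (P : PipeDream n) (c : ℕ) : P.exitPipe c = P.north 0 c := rfl

/-- Pipe `k` uses the west (`d = 0`) or south (`d = 1`) edge of box `(r,c)`. -/
def Edge (P : PipeDream n) (k r c d : ℕ) : Prop :=
  (d = 0 ∧ r + c + 1 ≤ n ∧ P.west r c = k) ∨ (d = 1 ∧ r + c + 2 ≤ n ∧ P.south r c = k)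

theorem Edge.back {k r c d : ℕ} (h : P.Edge k r c d) :
    (d = 0 ∧ c = 0 ∧ r = k ∧ k < n) ∨ ∃ r0 c0 d0, P.Edge k r0 c0 d0 ∧
      ((d = 0 ∧ r0 = r ∧ c = c0 + 1 ∧
          ((P.cross r0 c0 = true ∧ d0 = 0) ∨ (P.cross r0 c0 = false ∧ d0 = 1))) ∨
       (d = 1 ∧ r0 = r + 1 ∧ c0 = c ∧
          ((P.cross r0 c0 = true ∧ d0 = 1) ∨ (P.cross r0 c0 = false ∧ d0 = 0)))) := by
  rcases h with ⟨rfl, h1, h2⟩ | ⟨rfl, h1, h2⟩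
  · rcases c with _ | c
    · left; rw [west_zero] at h2; subst h2; refine ⟨rfl, rfl, rfl, by omega⟩
    · right
      by_cases hx : P.cross r c = true
      · rw [west_succ_cross hx] at h2
        exact ⟨r, c, 0, Or.inl ⟨rfl, by omega, h2⟩, Or.inl ⟨rfl, rfl, rfl, Or.inl ⟨hx, rfl⟩⟩⟩
      · simp only [Bool.not_eq_true] at hx
        rw [west_succ_elbow hx] at h2
        exact ⟨r, c, 1, Or.inr ⟨rfl, by omega, h2⟩, Or.inl ⟨rfl, rfl, rfl, Or.inr ⟨hx, rfl⟩⟩⟩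
  · right
    rw [south_eq P h1] at h2
    by_cases hx : P.cross (r+1) c = true
    · rw [north_cross hx] at h2
      have := P.inShape _ _ hx
      exact ⟨r+1, c, 1, Or.inr ⟨rfl, by omega, h2⟩, Or.inr ⟨rfl, rfl, rfl, Or.inl ⟨hx, rfl⟩⟩⟩
    · simp only [Bool.not_eq_true] at hx
      rw [north_elbow hx] at h2
      exact ⟨r+1, c, 0, Or.inl ⟨rfl, by omega, h2⟩, Or.inr ⟨rfl, rfl, rfl, Or.inr ⟨hx, rfl⟩⟩⟩

theorem Edge.valid {k r c d : ℕ} (h : P.Edge k r c d) : r + c + d + 1 ≤ n ∧ d ≤ 1 := by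
  rcases h with ⟨rfl, h1, h2⟩ | ⟨rfl, h1, h2⟩ <;> omega

theorem Edge.bound {k r c d : ℕ} (h : P.Edge k r c d) : r + d ≤ k ∧ k < n := by
  induction hm : n + c - r using Nat.strong_induction_on generalizing r c d with
  | _ m ih =>
    have hv := h.valid
    rcases h.back with ⟨h1, h2, h3, h4⟩ | ⟨r0, c0, d0, h1, h2⟩
    · omega
    · have hv1 := h1.valid
      have := ih (n + c0 - r0) (by omega) h1 rfl
      omega

theorem Edge.uniq {k r c d r' c' d' : ℕ} (h : P.Edge k r c d) (h' : P.Edge k r' c' d')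
    (ht : c + r' = c' + r) : r = r' ∧ c = c' ∧ d = d' := by
  induction hm : n + c - r using Nat.strong_induction_on generalizing r c d r' c' d' with
  | _ m ih =>
    have hv := h.valid
    have hv' := h'.valid
    rcases h.back with ⟨h1, h2, h3, h4⟩ | ⟨r0, c0, d0, h1, h2⟩
    · rcases h'.back with ⟨h1', h2', h3', h4'⟩ | ⟨r0', c0', d0', h1', h2'⟩
      · omega
      · have := h1'.bound; omega
    · rcases h'.back with ⟨h1', h2', h3', h4'⟩ | ⟨r0', c0', d0', h1', h2'⟩
      · have := h1.bound; omega
      · have hv1 := h1.valid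
        obtain ⟨rfl, rfl, rfl⟩ := ih (n + c0 - r0) (by omega) h1 h1' (by omega) rfl
        cases hx : P.cross r0 c0 <;> simp [hx] at h2 h2' <;> omega

theorem Edge.at_time {k r c d : ℕ} (h : P.Edge k r c d) (t : ℤ) (h1 : -(k:ℤ) ≤ t)
    (h2 : t ≤ (c:ℤ) - r) : ∃ r' c' d', P.Edge k r' c' d' ∧ (c':ℤ) - r' = t ∧ r ≤ r' ∧ c' ≤ c := by
  induction hm : n + c - r using Nat.strong_induction_on generalizing r c d with
  | _ m ih =>
    have hv := h.valid
    by_cases he : t = (c:ℤ) - r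
    · exact ⟨r, c, d, h, by omega, le_rfl, le_rfl⟩
    rcases h.back with ⟨g1, g2, g3, g4⟩ | ⟨r0, c0, d0, g1, g2⟩
    · omega
    · have hv1 := g1.valid
      obtain ⟨r', c', d', a1, a2, a3, a4⟩ := ih (n + c0 - r0) (by omega) g1 (by omega) rfl
      exact ⟨r', c', d', a1, a2, by omega, by omega⟩

theorem Edge.mono {k r c d r' c' d' : ℕ} (h : P.Edge k r c d) (h' : P.Edge k r' c' d')
    (ht : c + r' ≤ c' + r) : r' ≤ r ∧ c ≤ c' := by
  have hb := h.bound
  obtain ⟨r2, c2, d2, a1, a2, a3, a4⟩ := h'.at_time ((c:ℤ) - r) (by omega) (by omega)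
  have := h.uniq a1 (by omega)
  omega

/-- Going to the next edge. -/
theorem Edge.fwd {k r c d : ℕ} (h : P.Edge k r c d) :
    (((d = 0 ∧ P.cross r c = true) ∨ (d = 1 ∧ P.cross r c = false)) ∧ P.Edge k r (c+1) 0) ∨
    (((d = 0 ∧ P.cross r c = false) ∨ (d = 1 ∧ P.cross r c = true)) ∧ P.north r c = k ∧
      ∀ r0, r = r0 + 1 → P.Edge k r0 c 1) := by
  have key : ∀ r0, r = r0 + 1 → r + c + 1 ≤ n → P.north r c = k → P.Edge k r0 c 1 := by
    rintro r0 rfl h1 h2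
    exact Or.inr ⟨rfl, by omega, by rw [south_eq P (by omega)]; exact h2⟩
  have hv := h.valid
  rcases h with ⟨rfl, h1, h2⟩ | ⟨rfl, h1, h2⟩
  · cases hx : P.cross r c
    · right; have := north_elbow hx
      exact ⟨by simp, by rw [this, h2], fun r0 e => key r0 e (by omega) (by rw [this, h2])⟩
    · left; have := P.inShape _ _ hx
      exact ⟨by simp, Or.inl ⟨rfl, by omega, by rw [west_succ_cross hx, h2]⟩⟩
  · cases hx : P.cross r c
    · left
      exact ⟨by simp, Or.inl ⟨rfl, by omega, by rw [west_succ_elbow hx, h2]⟩⟩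
    · right; have := north_cross hx
      exact ⟨by simp, by rw [this, h2], fun r0 e => key r0 e (by omega) (by rw [this, h2])⟩

/-- At time `t`, pipe `u` is northwest of pipe `v`. -/
def Above (P : PipeDream n) (u v : ℕ) (t : ℤ) : Prop :=
  ∃ r c d r' c' d', P.Edge u r c d ∧ P.Edge v r' c' d' ∧ (c:ℤ) - r = t ∧ (c':ℤ) - r' = t ∧
    2 * r + d < 2 * r' + d'

theorem planarity {u v : ℕ} {t1 t2 : ℤ} (h1 : P.Above u v t1) (h2 : P.Above v u t2)
    (ht : t1 ≤ t2) : ∃ r c, P.cross r c = true ∧ P.west r c = u ∧ P.south r c = v ∧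
      t1 ≤ (c:ℤ) - r ∧ (c:ℤ) - r < t2 := by
  obtain ⟨m, hm⟩ := Int.eq_ofNat_of_zero_le (sub_nonneg.2 ht)
  induction m generalizing t2 with
  | zero =>
    obtain ⟨r, c, d, r', c', d', e1, e2, e3, e4, e5⟩ := h1
    obtain ⟨s, b, f, s', b', f', g1, g2, g3, g4, g5⟩ := h2
    have := e1.uniq g2 (by omega)
    have := e2.uniq g1 (by omega)
    omega
  | succ m ih =>
    obtain ⟨s, b, f, s', b', f', g1, g2, g3, g4, g5⟩ := h2
    have hb : -(v:ℤ) ≤ t1 ∧ -(u:ℤ) ≤ t1 := by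
      obtain ⟨r, c, d, r', c', d', e1, e2, e3, e4, e5⟩ := h1
      have := e1.bound; have := e2.bound; omega
    rcases g1.back with ⟨q1, q2, q3, q4⟩ | ⟨r0, c0, d0, a1, a2⟩
    · omega
    rcases g2.back with ⟨q1, q2, q3, q4⟩ | ⟨r0', c0', d0', a1', a2'⟩
    · omega
    have v1 := a1.valid
    have v1' := a1'.valid
    rcases lt_trichotomy (2 * r0 + d0) (2 * r0' + d0') with hlt | heq | hgt
    · obtain ⟨r, c, x1, x2, x3, x4, x5⟩ := ih (t2 := t2 - 1)
        ⟨r0, c0, d0, r0', c0', d0', a1, a1', by omega, by omega, hlt⟩ (by omega) (by omega)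
      exact ⟨r, c, x1, x2, x3, x4, by omega⟩
    · obtain ⟨rfl, rfl, rfl⟩ : r0 = r0' ∧ c0 = c0' ∧ d0 = d0' := by omega
      cases hx : P.cross r0 c0 <;> simp [hx] at a2 a2' <;> omega
    · rcases Nat.lt_or_ge r0' r0 with hr | hr
      · omega
      · obtain ⟨rfl, rfl, rfl, rfl⟩ : r0 = r0' ∧ c0 = c0' ∧ d0 = 1 ∧ d0' = 0 := by omega
        cases hx : P.cross r0 c0
        · simp [hx] at a2 a2'; omega
        · refine ⟨r0, c0, hx, ?_, ?_, by omega, by omega⟩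
          · rcases a1' with ⟨_, _, h⟩ | ⟨h, _⟩
            · exact h
            · omega
          · rcases a1 with ⟨h, _⟩ | ⟨_, _, h⟩
            · omega
            · exact h

/-- The exit column of pipe `k`. -/
def xc (ω : Equiv.Perm (Fin n)) (k : ℕ) : ℕ := if h : k < n then (ω⁻¹ ⟨k, h⟩).val else 0

variable {ω : Equiv.Perm (Fin n)}

theorem xc_lt {k : ℕ} (h : k < n) : xc ω k < n := by simp [xc, h]

theorem north_xc (hE : P.HasExitPerm ω) {k : ℕ} (h : k < n) : P.north 0 (xc ω k) = k := by
  rw [← exitPipe_eq]; have := hE (ω⁻¹ ⟨k, h⟩); simp [xc, h] at this ⊢; exact this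

theorem xc_north (hE : P.HasExitPerm ω) {c : ℕ} (h : c < n) : xc ω (P.north 0 c) = c := by
  rw [← exitPipe_eq]; have := hE ⟨c, h⟩; simp only at this; rw [this]; simp [xc]

theorem xc_inj {k l : ℕ} (hk : k < n) (hl : l < n) (h : xc ω k = xc ω l) : k = l := by
  simp [xc, hk, hl] at h
  have := ω⁻¹.injective (Fin.ext h)
  simpa using this

theorem exit_edge (hE : P.HasExitPerm ω) {k : ℕ} (h : k < n) :
    (P.Edge k 0 (xc ω k) 0 ∧ P.cross 0 (xc ω k) = false) ∨
    (P.Edge k 0 (xc ω k) 1 ∧ P.cross 0 (xc ω k) = true) := by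
  have h1 := north_xc hE h
  have h2 := xc_lt (ω := ω) h
  cases hx : P.cross 0 (xc ω k)
  · rw [north_elbow hx] at h1; left; exact ⟨Or.inl ⟨rfl, by omega, h1⟩, rfl⟩
  · rw [north_cross hx] at h1; right
    have := P.inShape _ _ hx
    exact ⟨Or.inr ⟨rfl, by omega, h1⟩, rfl⟩

theorem Edge.exit_ge (hE : P.HasExitPerm ω) {k r c d : ℕ} (h : P.Edge k r c d) : c ≤ xc ω k := by
  have hb := h.bound
  obtain ⟨d0, he, hd⟩ : ∃ d0, P.Edge k 0 (xc ω k) d0 ∧ ((d0 = 0 ∧ P.cross 0 (xc ω k) = false) ∨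
    (d0 = 1 ∧ P.cross 0 (xc ω k) = true)) := by
    rcases exit_edge hE hb.2 with h | h
    · exact ⟨0, h.1, Or.inl ⟨rfl, h.2⟩⟩
    · exact ⟨1, h.1, Or.inr ⟨rfl, h.2⟩⟩
  by_cases ht : c ≤ xc ω k + r
  · exact (h.mono he (by omega)).2
  · exfalso
    obtain ⟨r1, c1, d1, a1, a2, a3, a4⟩ := h.at_time ((xc ω k : ℤ) + 1) (by omega) (by omega)
    rcases a1.back with ⟨g1, g2, g3, g4⟩ | ⟨r2, c2, d2, g1, g2⟩
    · omega
    · obtain ⟨rfl, rfl, rfl⟩ := g1.uniq he (by omega)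
      cases hx : P.cross 0 (xc ω k) <;> simp [hx] at g2 hd <;> omega

/-- existence of an edge at each time between start and exit. -/
theorem exists_edge (hE : P.HasExitPerm ω) {k : ℕ} (h : k < n) (t : ℤ) (h1 : -(k:ℤ) ≤ t)
    (h2 : t ≤ xc ω k) : ∃ r c d, P.Edge k r c d ∧ (c:ℤ) - r = t := by
  rcases exit_edge hE h with ⟨e, -⟩ | ⟨e, -⟩ <;>
  · obtain ⟨r, c, d, a, b, -⟩ := e.at_time t h1 (by simpa using h2)
    exact ⟨r, c, d, a, b⟩

theorem above_or {u v : ℕ} {r c d r' c' d' : ℕ} (h : P.Edge u r c d) (h' : P.Edge v r' c' d')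
    (ht : c + r' = c' + r) (hne : u ≠ v) :
    P.Above u v ((c:ℤ) - r) ∨ P.Above v u ((c:ℤ) - r) := by
  have v1 := h.valid
  have v2 := h'.valid
  rcases lt_trichotomy (2 * r + d) (2 * r' + d') with hlt | heq | hgt
  · left; exact ⟨r, c, d, r', c', d', h, h', rfl, by omega, hlt⟩
  · exfalso
    obtain ⟨rfl, rfl, rfl⟩ : r = r' ∧ c = c' ∧ d = d' := by omega
    apply hne
    rcases h with ⟨h1, h2, h3⟩ | ⟨h1, h2, h3⟩ <;> rcases h' with ⟨g1, g2, g3⟩ | ⟨g1, g2, g3⟩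
    · rw [← h3, g3]
    · omega
    · omega
    · rw [← h3, g3]
  · right; exact ⟨r', c', d', r, c, d, h', h, by omega, by omega, hgt⟩

/-- at the starting time of the smaller label it is above. -/
theorem above_start {u v : ℕ} (hE : P.HasExitPerm ω) (huv : u < v)
    (hv : v < n) : P.Above u v (-(u:ℤ)) := by
  obtain ⟨r, c, d, e, ht⟩ := exists_edge hE hv (-(u:ℤ)) (by omega) (by omega)
  have e0 : P.Edge u u 0 0 := Or.inl ⟨rfl, by omega, P.west_zero u⟩
  have vv := e.valid
  have : ¬ (r = u) ∨ d = 1 := by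
    by_contra hcon
    push Not at hcon
    obtain ⟨rfl, hd⟩ := hcon
    rcases e with ⟨h1, h2, h3⟩ | ⟨h1, h2, h3⟩
    · have : c = 0 := by omega
      subst this; rw [west_zero] at h3; omega
    · omega
  exact ⟨u, 0, 0, r, c, d, e0, e, by simp, ht, by omega⟩
end PipeDream


namespace PipeDream
variable {n : ℕ} {P : PipeDream n} {ω : Equiv.Perm (Fin n)}

theorem edge_w {r c : ℕ} (h : r + c + 1 ≤ n) : P.Edge (P.west r c) r c 0 := Or.inl ⟨rfl, h, rfl⟩
theorem edge_s {r c : ℕ} (h : r + c + 2 ≤ n) : P.Edge (P.south r c) r c 1 := Or.inr ⟨rfl, h, rfl⟩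

theorem west_ne_south {r c : ℕ} (h : r + c + 2 ≤ n) : P.west r c ≠ P.south r c := by
  intro e
  have h1 := edge_w (P := P) (r := r) (c := c) (by omega)
  have h2 := edge_s (P := P) (r := r) (c := c) (by omega)
  rw [e] at h1
  have := h1.uniq h2 rfl
  omega

theorem above_box {r c : ℕ} (h : r + c + 2 ≤ n) :
    P.Above (P.west r c) (P.south r c) ((c:ℤ) - r) :=
  ⟨r, c, 0, r, c, 1, edge_w (by omega), edge_s h, rfl, rfl, by omega⟩

theorem exit_above (hE : P.HasExitPerm ω) {u v : ℕ} (hu : u < n) (hv : v < n)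
    (hX : xc ω u < xc ω v) : P.Above u v (xc ω u) ∨
      (P.cross 0 (xc ω u) = true ∧ P.west 0 (xc ω u) = v ∧ P.south 0 (xc ω u) = u) := by
  obtain ⟨r, c, d, e, ht⟩ := exists_edge hE hv (xc ω u) (by omega) (by omega)
  have hne : u ≠ v := by rintro rfl; omega
  have hv := e.valid
  rcases exit_edge hE hu with ⟨e0, hx⟩ | ⟨e0, hx⟩
  · have := above_or e0 e (by omega) hne
    left
    rcases this with h | h
    · simpa using h
    · exfalso
      obtain ⟨r1, c1, d1, r2, c2, d2, a1, a2, a3, a4, a5⟩ := h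
      have := a2.uniq e0 (by omega)
      omega
  · by_cases h0 : r = 0 ∧ d = 0
    · right
      obtain ⟨rfl, rfl⟩ := h0
      have hc : c = xc ω u := by omega
      rw [hc] at e
      refine ⟨hx, ?_, ?_⟩
      · rcases e with ⟨_, _, h⟩ | ⟨h, _⟩
        · exact h
        · omega
      · rcases e0 with ⟨h, _⟩ | ⟨_, _, h⟩
        · omega
        · exact h
    · left
      have := above_or e0 e (by omega) hne
      rcases this with h | h
      · simpa using h
      · exfalso
        obtain ⟨r1, c1, d1, r2, c2, d2, a1, a2, a3, a4, a5⟩ := h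
        have := a2.uniq e0 (by omega)
        have := a1.uniq e (by omega)
        omega

theorem cross_lt' (hR : P.Reduced) (hE : P.HasExitPerm ω) {r c : ℕ} (hx : P.cross r c = true) :
    P.west r c < P.south r c ∧ xc ω (P.south r c) < xc ω (P.west r c) := by
  have hs := P.inShape _ _ hx
  have hne := west_ne_south (P := P) hs
  have hno : ∀ r' c', P.cross r' c' = true → P.west r' c' = P.south r c →
      P.south r' c' = P.west r c → False := by
    intro r' c' h1 h2 h3
    refine hR r' c' r c h1 hx ?_ (Or.inr ⟨h2, h3⟩)
    intro e
    simp only [Prod.mk.injEq] at e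
    obtain ⟨rfl, rfl⟩ := e
    exact hne h2
  have hab := above_box (P := P) hs
  have e1 := edge_w (P := P) (r := r) (c := c) (by omega)
  have e2 := edge_s (P := P) (r := r) (c := c) (by omega)
  have b1 := e1.bound
  have b2 := e2.bound
  constructor
  · by_contra hlt
    have h1 := above_start hE (u := P.south r c) (v := P.west r c) (by omega) b1.2
    obtain ⟨r', c', x1, x2, x3, -⟩ := planarity h1 hab (by omega)
    exact hno r' c' x1 x2 x3
  · by_contra hlt
    have hX : xc ω (P.west r c) < xc ω (P.south r c) := by
      rcases lt_or_eq_of_le (not_lt.1 hlt) with h | h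
      · exact h
      · exact absurd (xc_inj b1.2 b2.2 h) hne
    have e3 : P.Edge (P.west r c) r (c+1) 0 := Or.inl ⟨rfl, by omega, west_succ_cross hx⟩
    have ex := e3.exit_ge hE
    rcases r with _ | r
    · have := xc_north hE (c := c) (by omega)
      rw [north_cross hx] at this
      omega
    · have e4 : P.Edge (P.south (r+1) c) r c 1 :=
        Or.inr ⟨rfl, by omega, by rw [south_eq P (by omega), north_cross hx]⟩
      have hab' : P.Above (P.south (r+1) c) (P.west (r+1) c) ((c:ℤ) - r) :=
        ⟨_, _, _, _, _, _, e4, e3, by omega, by push_cast; omega, by omega⟩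
      rcases exit_above hE b1.2 b2.2 hX with h | ⟨h1, h2, h3⟩
      · obtain ⟨r', c', x1, x2, x3, -⟩ := planarity hab' h (by omega)
        exact hno r' c' x1 x2 x3
      · exact hno _ _ h1 h2 h3

theorem cross_lt (hR : P.Reduced) (hE : P.HasExitPerm ω) {r c u v : ℕ} (hx : P.cross r c = true)
    (h1 : P.west r c = u) (h2 : P.south r c = v) : u < v ∧ xc ω v < xc ω u := by
  subst h1 h2; exact cross_lt' hR hE hx

theorem inv_cross (hE : P.HasExitPerm ω) {u v : ℕ} (huv : u < v) (hv : v < n)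
    (hX : xc ω v < xc ω u) : ∃ r c, P.cross r c = true ∧ P.west r c = u ∧ P.south r c = v := by
  have h1 := above_start hE huv hv
  rcases exit_above hE hv (by omega) hX with h | ⟨h1, h2, h3⟩
  · obtain ⟨r', c', x1, x2, x3, -⟩ := planarity h1 h (by omega)
    exact ⟨r', c', x1, x2, x3⟩
  · exact ⟨_, _, h1, h2, h3⟩

theorem Above.bounds {u v : ℕ} {t : ℤ} (h : P.Above u v t) :
    u < n ∧ v < n ∧ -(u:ℤ) ≤ t ∧ -(v:ℤ) ≤ t ∧ u ≠ v := by
  obtain ⟨r1, c1, d1, r2, c2, d2, a1, a2, a3, a4, a5⟩ := h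
  have := a1.bound
  have := a2.bound
  refine ⟨by omega, by omega, by omega, by omega, ?_⟩
  rintro rfl
  have := a1.uniq a2 (by omega)
  omega

theorem Above.exits (hE : P.HasExitPerm ω) {u v : ℕ} {t : ℤ} (h : P.Above u v t) :
    t ≤ xc ω u ∧ t ≤ xc ω v := by
  obtain ⟨r1, c1, d1, r2, c2, d2, a1, a2, a3, a4, a5⟩ := h
  have := a1.exit_ge hE
  have := a2.exit_ge hE
  omega

theorem Above.asymm {u v : ℕ} {t : ℤ} (h : P.Above u v t) (h' : P.Above v u t) : False := by
  obtain ⟨r, c, -, -, -, h1, h2⟩ := planarity h h' le_rfl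
  omega

theorem above_total (hE : P.HasExitPerm ω) {u v : ℕ} (hu : u < n) (hv : v < n) (hne : u ≠ v) {t : ℤ}
    (h1 : -(u:ℤ) ≤ t) (h2 : -(v:ℤ) ≤ t) (h3 : t ≤ xc ω u) (h4 : t ≤ xc ω v) :
    P.Above u v t ∨ P.Above v u t := by
  obtain ⟨r, c, d, e, ht⟩ := exists_edge hE hu t h1 h3
  obtain ⟨r', c', d', e', ht'⟩ := exists_edge hE hv t h2 h4
  have := above_or e e' (by omega) hne
  rwa [ht] at this

theorem persist (hR : P.Reduced) (hE : P.HasExitPerm ω) {u v : ℕ} {t t' : ℤ} (huv : u < v)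
    (h : P.Above v u t) (htt : t ≤ t') (h3 : t' ≤ xc ω u) (h4 : t' ≤ xc ω v) : P.Above v u t' := by
  obtain ⟨b1, b2, b3, b4, b5⟩ := h.bounds
  rcases above_total hE (P := P) b1 b2 b5 (t := t') (by omega) (by omega) h4 h3 with h' | h'
  · exact h'
  · obtain ⟨r, c, x1, x2, x3, -⟩ := planarity h h' htt
    have := cross_lt hR hE x1 x2 x3
    omega

theorem above_inv (hR : P.Reduced) (hE : P.HasExitPerm ω) {u v : ℕ} {t : ℤ} (huv : u < v)
    (h : P.Above v u t) : xc ω v < xc ω u := by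
  obtain ⟨b1, b2, b3, b4, b5⟩ := h.bounds
  by_contra hlt
  have hX : xc ω u < xc ω v := by
    rcases lt_or_eq_of_le (not_lt.1 hlt) with h | h
    · exact h
    · exact absurd (xc_inj b1 b2 h.symm) b5
  rcases exit_above hE b2 b1 hX with h' | ⟨x1, x2, x3⟩
  · obtain ⟨r, c, x1, x2, x3, -⟩ := planarity h h' (h.exits hE).2
    have := cross_lt hR hE x1 x2 x3
    omega
  · have := cross_lt hR hE x1 x2 x3
    omega

/-! Elbows and straight runs -/

def ElW (P : PipeDream n) (k r c : ℕ) : Prop := r + c + 1 ≤ n ∧ P.cross r c = false ∧ P.west r c = k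
def ElS (P : PipeDream n) (k r c : ℕ) : Prop := r + c + 2 ≤ n ∧ P.cross r c = false ∧ P.south r c = k
def El (P : PipeDream n) (k r c : ℕ) : Prop := P.ElW k r c ∨ P.ElS k r c

theorem hfwd {k r c0 : ℕ} (h : r + c0 + 1 ≤ n) (hk : P.west r c0 = k) :
    ∃ c3, c0 ≤ c3 ∧ P.ElW k r c3 ∧ (∀ c, c0 ≤ c → c < c3 → P.cross r c = true) ∧
      ∀ c, c0 ≤ c → c ≤ c3 → P.west r c = k := by
  induction hm : n - (r + c0) using Nat.strong_induction_on generalizing c0 with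
  | _ m ih =>
    cases hx : P.cross r c0
    · refine ⟨c0, le_rfl, ⟨h, hx, hk⟩, fun c a b => by omega, fun c a b => ?_⟩
      obtain rfl : c = c0 := by omega
      exact hk
    · have hs := P.inShape _ _ hx
      obtain ⟨c3, a1, a2, a3, a4⟩ := ih (n - (r + (c0+1))) (by omega) (c0 := c0 + 1) (by omega)
        (by rw [west_succ_cross hx, hk]) rfl
      refine ⟨c3, by omega, a2, fun c b1 b2 => ?_, fun c b1 b2 => ?_⟩
      · rcases Nat.eq_or_lt_of_le b1 with rfl | b1
        · exact hx
        · exact a3 c b1 b2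
      · rcases Nat.eq_or_lt_of_le b1 with rfl | b1
        · exact hk
        · exact a4 c b1 b2

theorem vback {k r c : ℕ} (h : r + c + 2 ≤ n) (hk : P.south r c = k) :
    ∃ r3, r < r3 ∧ P.ElW k r3 c ∧ (∀ r', r < r' → r' < r3 → P.cross r' c = true) ∧
      ∀ r', r ≤ r' → r' < r3 → P.south r' c = k := by
  induction hm : n - (r + c) using Nat.strong_induction_on generalizing r with
  | _ m ih =>
    have hk' := hk
    rw [south_eq P h] at hk'
    cases hx : P.cross (r+1) c
    · rw [north_elbow hx] at hk'
      refine ⟨r+1, by omega, ⟨by omega, hx, hk'⟩, fun c a b => by omega, fun r' a b => ?_⟩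
      obtain rfl : r' = r := by omega
      exact hk
    · have hs := P.inShape _ _ hx
      rw [north_cross hx] at hk'
      obtain ⟨c3, a1, a2, a3, a4⟩ := ih (n - (r + 1 + c)) (by omega) (r := r + 1) (by omega)
        hk' rfl
      refine ⟨c3, by omega, a2, fun c b1 b2 => ?_, fun c b1 b2 => ?_⟩
      · rcases Nat.eq_or_lt_of_le b1 with rfl | b1
        · exact hx
        · exact a3 c b1 b2
      · rcases Nat.eq_or_lt_of_le b1 with rfl | b1
        · exact hk
        · exact a4 c b1 b2

theorem hback {k r c c1 : ℕ} (h : r + c1 + 1 ≤ n) (hk : P.west r c1 = k) (hc : c ≤ c1) :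
    (∃ c2, c ≤ c2 ∧ c2 < c1 ∧ P.ElS k r c2) ∨
    ((∀ c', c ≤ c' → c' < c1 → P.cross r c' = true) ∧ ∀ c', c ≤ c' → c' ≤ c1 → P.west r c' = k) := by
  induction c1 with
  | zero =>
    right
    refine ⟨fun c a b => by omega, fun c a b => ?_⟩
    obtain rfl : c = 0 := by omega
    exact hk
  | succ c1 ih =>
    rcases Nat.eq_or_lt_of_le hc with rfl | hc
    · right
      refine ⟨fun c a b => by omega, fun c a b => ?_⟩
      obtain rfl : c = c1 + 1 := by omega
      exact hk
    · cases hx : P.cross r c1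
      · left
        rw [west_succ_elbow hx] at hk
        exact ⟨c1, by omega, by omega, by omega, hx, hk⟩
      · have hk' := hk
        rw [west_succ_cross hx] at hk'
        rcases ih (by omega) hk' (by omega) with ⟨c2, a1, a2, a3⟩ | ⟨a1, a2⟩
        · left; exact ⟨c2, a1, by omega, a3⟩
        · right
          refine ⟨fun c b1 b2 => ?_, fun c b1 b2 => ?_⟩
          · rcases Nat.eq_or_lt_of_le b2 with e | b2
            · obtain rfl : c = c1 := by omega
              exact hx
            · exact a1 c b1 (by omega)
          · rcases Nat.eq_or_lt_of_le b2 with rfl | b2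
            · exact hk
            · exact a2 c b1 (by omega)

theorem vfwd {k r r1 c : ℕ} (h : r1 + c + 1 ≤ n) (hk : P.north r1 c = k) (hc : r ≤ r1) :
    (∃ r2, r ≤ r2 ∧ r2 < r1 ∧ P.ElS k r2 c) ∨
    ((∀ r', r ≤ r' → r' < r1 → P.cross r' c = true ∧ P.south r' c = k) ∧ P.north r c = k) := by
  induction r1 with
  | zero =>
    right
    obtain rfl : r = 0 := by omega
    exact ⟨fun c a b => by omega, hk⟩
  | succ r1 ih =>
    rcases Nat.eq_or_lt_of_le hc with rfl | hc
    · right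
      exact ⟨fun c a b => by omega, hk⟩
    · have hk' : P.south r1 c = k := by rw [south_eq P (by omega)]; exact hk
      cases hx : P.cross r1 c
      · left
        exact ⟨r1, by omega, by omega, by omega, hx, hk'⟩
      · have hk2 := hk'
        rw [← north_cross hx] at hk2
        rcases ih (by omega) hk2 (by omega) with ⟨c2, a1, a2, a3⟩ | ⟨a1, a2⟩
        · left; exact ⟨c2, a1, by omega, a3⟩
        · right
          refine ⟨fun c b1 b2 => ?_, a2⟩
          rcases Nat.eq_or_lt_of_le b2 with e | b2
          · obtain rfl : c = r1 := by omega
            exact ⟨hx, hk'⟩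
          · exact a1 c b1 (by omega)

theorem Path.arc {i j : ℕ} (h : P.Arc i j) : P.Path i j := Relation.ReflTransGen.single h
theorem Path.trans {i j k : ℕ} (h : P.Path i j) (h' : P.Path j k) : P.Path i k :=
  Relation.ReflTransGen.trans h h'
theorem Path.refl {i : ℕ} : P.Path i i := Relation.ReflTransGen.refl

theorem ElW.north {k r c : ℕ} (h : P.ElW k r c) : P.north r c = k := by
  rw [north_elbow h.2.1]; exact h.2.2
theorem ElS.east {k r c : ℕ} (h : P.ElS k r c) : P.west r (c+1) = k := by
  rw [west_succ_elbow h.2.1]; exact h.2.2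
theorem ElW.edge {k r c : ℕ} (h : P.ElW k r c) : P.Edge k r c 0 := Or.inl ⟨rfl, h.1, h.2.2⟩
theorem ElS.edge {k r c : ℕ} (h : P.ElS k r c) : P.Edge k r c 1 := Or.inr ⟨rfl, h.1, h.2.2⟩

theorem ElS.arc {k r c : ℕ} (h : P.ElS k r c) : P.Arc (P.west r c) k ∧ P.ElW (P.west r c) r c :=
  ⟨⟨r, c, h.1, h.2.1, rfl, h.2.2⟩, ⟨by have := h.1; omega, h.2.1, rfl⟩⟩
theorem ElW.arc {k r c : ℕ} (h : P.ElW k r c) (hs : r + c + 2 ≤ n) :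
    P.Arc k (P.south r c) ∧ P.ElS (P.south r c) r c :=
  ⟨⟨r, c, hs, h.2.1, h.2.2, rfl⟩, ⟨hs, h.2.1, rfl⟩⟩

theorem lemQ1 (hR : P.Reduced) {i l r c r1 c1 : ℕ} (hi : P.ElW i r c) (hl : P.ElW l r1 c1)
    (hr : r ≤ r1) (hc : c ≤ c1) : P.Path i l := by
  induction hm : (r1 - r) + (c1 - c) using Nat.strong_induction_on generalizing i l r c r1 c1 with
  | _ m ih =>
    have hl1 := hl.1
    rcases hback hl.1 hl.2.2 hc with ⟨c2, a1, a2, a3⟩ | ⟨a1, a2⟩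
    · obtain ⟨b1, b2⟩ := a3.arc
      exact (ih _ (by omega) hi b2 hr a1 rfl).trans (.arc b1)
    rcases vfwd hl.1 hl.north hr with ⟨r2, b1, b2, b3⟩ | ⟨b1, b2⟩
    · obtain ⟨d1, d2⟩ := b3.arc
      exact (ih _ (by omega) hi d2 b1 hc rfl).trans (.arc d1)
    have hx := hi.2.1
    rcases Nat.eq_or_lt_of_le hr with rfl | hr
    · rcases Nat.eq_or_lt_of_le hc with rfl | hc
      · have := hi.2.2; have := hl.2.2
        obtain rfl : i = l := by omega
        exact .refl
      · have := a1 c le_rfl hc; simp [hx] at this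
    rcases Nat.eq_or_lt_of_le hc with rfl | hc
    · have := b1 r le_rfl hr; simp [hx] at this
    obtain ⟨d1, d2⟩ := hi.arc (by omega)
    obtain ⟨r3, e1, e2, e3, e4⟩ := vback (P := P) (r := r) (c := c) (by omega) rfl
    rcases le_or_gt r3 r1 with h3 | h3
    · exact (Path.arc d1).trans (ih _ (by omega) e2 hl h3 hc.le rfl)
    obtain ⟨c3, f1, f2, f3, f4⟩ := hfwd (P := P) (r := r) (c0 := c + 1) (by omega) d2.east
    rcases le_or_gt c3 c1 with h4 | h4
    · exact (Path.arc d1).trans (ih _ (by omega) f2 hl hr.le h4 rfl)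
    exfalso
    refine hR r1 c r c1 (e3 r1 hr h3) (f3 c1 (by omega) h4) ?_ (Or.inr ⟨?_, ?_⟩)
    · intro e; simp only [Prod.mk.injEq] at e; omega
    · rw [a2 c le_rfl hc.le, (b1 r le_rfl hr).2]
    · rw [e4 r1 hr.le h3, f4 c1 (by omega) h4.le]

theorem lemQ (hR : P.Reduced) {i l r c r1 c1 : ℕ} (hi : P.ElW i r c) (hl : P.El l r1 c1)
    (hr : r ≤ r1) (hc : c ≤ c1) : P.Path i l := by
  rcases hl with hl | hl
  · exact lemQ1 hR hi hl hr hc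
  · obtain ⟨b1, b2⟩ := hl.arc
    exact (lemQ1 hR hi b2 hr hc).trans (.arc b1)

theorem lemQ' (hR : P.Reduced) {i l r c r1 c1 : ℕ} (hi : P.ElS i r c) (hl : P.ElS l r1 c1)
    (hr : r ≤ r1) (hc : c ≤ c1) : P.Path i l := by
  induction hm : (r1 - r) + (c1 - c) using Nat.strong_induction_on generalizing l r1 c1 with
  | _ m ih =>
    have hl1 := hl.1
    have hi1 := hi.1
    by_cases heq : r = r1 ∧ c = c1
    · obtain ⟨rfl, rfl⟩ := heq
      have := hi.2.2; have := hl.2.2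
      obtain rfl : i = l := by omega
      exact .refl
    obtain ⟨r3, e1, e2, e3, e4⟩ := vback hi.1 hi.2.2
    rcases le_or_gt r3 r1 with h3 | h3
    · exact lemQ hR e2 (.inr hl) h3 hc
    obtain ⟨c3, f1, f2, f3, f4⟩ := hfwd (P := P) (r := r) (c0 := c + 1) (by omega) hi.east
    rcases le_or_gt c3 c1 with h4 | h4
    · exact lemQ hR f2 (.inr hl) hr h4
    obtain ⟨g1, g2⟩ := hl.arc
    rcases hback (P := P) (r := r1) (c1 := c1) (by omega) rfl hc with ⟨c2, a1, a2, a3⟩ | ⟨a1, a2⟩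
    · exact (ih _ (by omega) a3 hr a1 rfl).trans (.arc g1)
    rcases vfwd g2.1 g2.north hr with ⟨r2, b1, b2, b3⟩ | ⟨b1, b2⟩
    · exact (ih _ (by omega) b3 b1 hc rfl).trans (.arc g1)
    exfalso
    have hx := hi.2.1
    rcases Nat.eq_or_lt_of_le hr with rfl | hr
    · have := a1 c le_rfl (by omega); simp [hx] at this
    rcases Nat.eq_or_lt_of_le hc with rfl | hc
    · have := b1 r le_rfl hr; simp [hx] at this
    refine hR r1 c r c1 (e3 r1 hr h3) (f3 c1 (by omega) h4) ?_ (Or.inr ⟨?_, ?_⟩)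
    · intro e; simp only [Prod.mk.injEq] at e; omega
    · rw [a2 c le_rfl hc.le, (b1 r le_rfl hr).2]
    · rw [e4 r1 hr.le h3, f4 c1 (by omega) h4.le]

theorem lemT (hE : P.HasExitPerm ω) {b r c : ℕ} (hb : b < n) (hr : r ≤ b) (hX : c ≤ xc ω b) :
    (∃ r1 c1, P.El b r1 c1 ∧ r1 ≤ r ∧ c1 ≤ c) ∨ (∃ r1 c1, P.El b r1 c1 ∧ r ≤ r1 ∧ c ≤ c1) := by
  have key : ∀ m r1 c1, r1 = m → P.ElW b r1 c1 → r ≤ r1 →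
    (∃ r1 c1, P.El b r1 c1 ∧ r1 ≤ r ∧ c1 ≤ c) ∨ (∃ r1 c1, P.El b r1 c1 ∧ r ≤ r1 ∧ c ≤ c1) := by
    intro m
    induction m using Nat.strong_induction_on with
    | _ m ih =>
      rintro r1 c1 rfl h1 h2
      have hv := h1.1
      rcases le_or_gt c c1 with h3 | h3
      · right; exact ⟨r1, c1, .inl h1, h2, h3⟩
      rcases vfwd h1.1 h1.north (Nat.zero_le _) with ⟨r2, a1, a2, a3⟩ | ⟨a1, a2⟩
      · rcases le_or_gt r2 r with h4 | h4
        · left; exact ⟨r2, c1, .inr a3, h4, h3.le⟩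
        · have := a3.1
          obtain ⟨c3, f1, f2, f3, f4⟩ := hfwd (P := P) (r := r2) (c0 := c1 + 1) (by omega) a3.east
          exact ih r2 a2 r2 c3 rfl f2 h4.le
      · have := xc_north hE (c := c1) (by omega)
        rw [a2] at this; omega
  obtain ⟨c3, f1, f2, f3, f4⟩ := hfwd (P := P) (r := b) (c0 := 0) (by omega) (P.west_zero b)
  exact key b b c3 rfl f2 hr

theorem lemG (hR : P.Reduced) {i z r c0 c3 r2 c2 : ℕ} (hi : P.ElW i r c3)
    (h1 : ∀ c, c0 ≤ c → c < c3 → P.cross r c = true) (h2 : ∀ c, c0 ≤ c → c ≤ c3 → P.west r c = i)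
    (hno : ∀ r c, P.cross r c = true → P.west r c = i → P.south r c = z → False)
    (hz : P.ElW z r2 c2) (hr : r < r2) (hc : c0 ≤ c2) : P.Path i z := by
  induction hm : r2 using Nat.strong_induction_on generalizing r2 c2 with
  | _ m ih =>
    subst hm
    rcases le_or_gt c3 c2 with h3 | h3
    · exact lemQ1 hR hi hz hr.le h3
    have hv := hz.1
    rcases vfwd hz.1 hz.north hr.le with ⟨r4, a1, a2, a3⟩ | ⟨a1, a2⟩
    · rcases Nat.eq_or_lt_of_le a1 with rfl | a1
      · have := h1 c2 hc h3
        simp [a3.2.1] at this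
      · have := a3.1
        obtain ⟨c4, f1, f2, f3, f4⟩ := hfwd (P := P) (r := r4) (c0 := c2 + 1) (by omega) a3.east
        exact ih r4 a2 f2 a1 (by omega) rfl
    · exact (hno r c2 (h1 c2 hc h3) (h2 c2 hc h3.le) (a1 r le_rfl hr).2).elim

theorem lemF3 (hR : P.Reduced) (hE : P.HasExitPerm ω) {i j : ℕ} (hij : i < j) (hj : j < n)
    (hX : xc ω i < xc ω j) : P.Path i j := by
  obtain ⟨c3, f1, f2, f3, f4⟩ := hfwd (P := P) (r := i) (c0 := 0) (by omega) (P.west_zero i)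
  obtain ⟨c4, g1, g2, g3, g4⟩ := hfwd (P := P) (r := j) (c0 := 0) (by omega) (P.west_zero j)
  refine lemG hR f2 f3 f4 ?_ g2 hij (Nat.zero_le _)
  intro r c x1 x2 x3
  have := cross_lt hR hE x1 x2 x3
  omega

theorem woip_arc (hR : P.Reduced) (hE : P.HasExitPerm ω) {u v b : ℕ} (h : P.Arc u v)
    (hb : (u < b ∧ b < v) ∨ (v < b ∧ b < u)) : P.Path u b ∨ P.Path b v := by
  have h0 := h
  obtain ⟨r, c, h1, h2, h3, h4⟩ := h
  have e1 : P.ElW u r c := ⟨by omega, h2, h3⟩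
  have e2 : P.ElS v r c := ⟨by omega, h2, h4⟩
  have b1 := e1.edge.bound
  have b2 := e2.edge.bound
  have x1 := e1.edge.exit_ge hE
  have x2 := e2.edge.exit_ge hE
  rcases le_or_gt c (xc ω b) with hx | hx
  · rcases lemT hE (P := P) (b := b) (r := r) (c := c) (by omega) (by omega) hx with
      ⟨r1, c1, f, f1, f2⟩ | ⟨r1, c1, f, f1, f2⟩
    · right
      rcases f with f | f
      · exact lemQ hR f (.inr e2) f1 f2
      · exact lemQ' hR f e2 f1 f2
    · left
      exact lemQ hR e1 f f1 f2
  · right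
    rcases hb with hb | hb
    · exact lemF3 hR hE hb.2 b2.2 (by omega)
    · exact (lemF3 hR hE hb.2 b1.2 (by omega)).trans (.arc h0)

theorem woip (hR : P.Reduced) (hE : P.HasExitPerm ω) {u v b : ℕ} (h : P.Path u v)
    (hb : (u < b ∧ b < v) ∨ (v < b ∧ b < u)) : P.Path u b ∨ P.Path b v := by
  induction h using Relation.ReflTransGen.head_induction_on with
  | refl => omega
  | @head x y hxy hyv ih =>
    by_cases h1 : y = b
    · subst h1; left; exact .arc hxy
    by_cases h2 : (x < b ∧ b < y) ∨ (y < b ∧ b < x)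
    · rcases woip_arc hR hE hxy h2 with h | h
      · exact .inl h
      · exact .inr (h.trans hyv)
    · rcases ih (by omega) with h | h
      · exact .inl ((Path.arc hxy).trans h)
      · exact .inr h
end PipeDream


namespace PipeDream
variable {n : ℕ} {P Q : PipeDream n} {ω : Equiv.Perm (Fin n)}

/-- Data of a flip exchanging the contact `(r,c)` and the crossing `(r',c')` of pipes `i < j`. -/
structure FD (ω : Equiv.Perm (Fin n)) (P Q : PipeDream n) (r c r' c' i j : ℕ) : Prop where
  hR : P.Reduced
  hE : P.HasExitPerm ω
  hB : r + c + 2 ≤ n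
  xB : P.cross r c = false
  wB : P.west r c = i
  sB : P.south r c = j
  xB' : P.cross r' c' = true
  wB' : P.west r' c' = i
  sB' : P.south r' c' = j
  hij : i < j
  hX : xc ω j < xc ω i
  hr : r' < r
  hc : c < c'
  qB : Q.cross r c = true
  qB' : Q.cross r' c' = false
  qo : ∀ r0 c0, (r0, c0) ≠ (r, c) → (r0, c0) ≠ (r', c') → P.cross r0 c0 = Q.cross r0 c0

theorem contact_cross_strict (hE : P.HasExitPerm ω) {r c r' c' i j : ℕ} (hB : r + c + 2 ≤ n)
    (xB : P.cross r c = false) (wB : P.west r c = i) (sB : P.south r c = j)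
    (xB' : P.cross r' c' = true) (wB' : P.west r' c' = i) (sB' : P.south r' c' = j)
    (ht : c + r' < c' + r) : r' < r ∧ c < c' := by
  have hs := P.inShape _ _ xB'
  have ei : P.Edge i r c 0 := Or.inl ⟨rfl, by omega, wB⟩
  have ej : P.Edge j r c 1 := Or.inr ⟨rfl, by omega, sB⟩
  have ei' : P.Edge i r' c' 0 := Or.inl ⟨rfl, by omega, wB'⟩
  have ej' : P.Edge j r' c' 1 := Or.inr ⟨rfl, by omega, sB'⟩
  have x := ei'.exit_ge hE
  have m1 := ei.mono ei' (by omega)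
  constructor
  · rcases ei.fwd with ⟨h, -⟩ | ⟨-, h1, h2⟩
    · simp [xB] at h
    · rcases r with _ | r
      · have := xc_north hE (c := c) (by omega)
        rw [h1] at this
        omega
      · have := (h2 r rfl).mono ei' (by omega)
        omega
  · rcases ej.fwd with ⟨-, h⟩ | ⟨h, -⟩
    · have := h.mono ej' (by omega)
      omega
    · simp [xB] at h

theorem FD.of_incFlip (hR : P.Reduced) (hE : P.HasExitPerm ω) (h : IncFlip P Q) :
    ∃ r c r' c' i j, FD ω P Q r c r' c' i j := by
  obtain ⟨⟨r, c⟩, ⟨r', c'⟩, ⟨h1, h2, h3, h4, h5, h6, h7⟩, h8, h9⟩ := h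
  simp only at *
  have hs := Q.inShape _ _ h4
  have hs' := P.inShape _ _ h3
  have hlt := cross_lt hR hE h3 rfl rfl
  have htt : c + r' < c' + r := by
    by_contra hcon
    exact h1 (by simp only [Prod.mk.injEq]; omega)
  have hw : P.west r c = P.west r' c' ∧ P.south r c = P.south r' c' := by
    rcases h7 with h | ⟨e1, e2⟩
    · exact h
    · exfalso
      have a1 := above_box (P := P) hs
      have a2 := above_box (P := P) hs'
      rw [e1, e2] at a1
      obtain ⟨r0, c0, x1, x2, x3, -⟩ := planarity a1 a2 (by omega)
      have := cross_lt hR hE x1 x2 x3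
      omega
  have := contact_cross_strict hE hs h2 hw.1 hw.2 h3 rfl rfl htt
  exact ⟨r, c, r', c', _, _, hR, hE, hs, h2, hw.1, hw.2, h3, rfl, rfl, hlt.1, hlt.2, this.1, this.2,
    h4, h5, h6⟩

theorem Edge.lemA {k r c d r0 : ℕ} (h : P.Edge k r c d) (h0 : P.Edge k r0 c 0) : r ≤ r0 := by
  by_contra hlt
  have := h.bound
  rcases h0.back with ⟨g1, g2, g3, g4⟩ | ⟨r2, c2, d2, g1, g2⟩
  · omega
  · have := h.mono g1 (by omega)
    omega

theorem Edge.lemB {k r c d c0 : ℕ} (h : P.Edge k r c d) (h0 : P.Edge k r c0 1) : c0 ≤ c := by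
  by_contra hlt
  rcases h0.back with ⟨g1, g2, g3, g4⟩ | ⟨r2, c2, d2, g1, g2⟩
  · omega
  · have := h.mono g1 (by omega)
    omega

theorem Edge.lemC {k r c d r0 c0 d0 : ℕ} (h : P.Edge k r c d) (h0 : P.Edge k r0 c0 d0) :
    (r ≤ r0 ∧ c0 ≤ c) ∨ (r0 ≤ r ∧ c ≤ c0) := by
  rcases le_total (c + r0) (c0 + r) with h1 | h1
  · have := h.mono h0 h1; omega
  · have := h0.mono h h1; omega

namespace FD
variable {r c r' c' i j : ℕ}

theorem edges (F : FD ω P Q r c r' c' i j) : P.Edge i r c 0 ∧ P.Edge j r c 1 ∧ P.Edge i r' c' 0 ∧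
    P.Edge j r' c' 1 := by
  have hs := P.inShape _ _ F.xB'
  have := F.hB
  exact ⟨Or.inl ⟨rfl, by omega, F.wB⟩, Or.inr ⟨rfl, by omega, F.sB⟩, Or.inl ⟨rfl, by omega, F.wB'⟩,
    Or.inr ⟨rfl, by omega, F.sB'⟩⟩

def inR (r c r' c' r0 c0 : ℕ) : Prop :=
  r' ≤ r0 ∧ r0 ≤ r ∧ c ≤ c0 ∧ c0 ≤ c' ∧ ¬ (r0 = r ∧ c0 = c)

theorem f1 (F : FD ω P Q r c r' c' i j) {r0 : ℕ} (h1 : r0 < r) (hv : r0 + c + 1 ≤ n) :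
    P.west r0 c ≠ i ∧ P.west r0 c ≠ j := by
  obtain ⟨e1, e2, e3, e4⟩ := F.edges
  constructor
  · intro e
    have := e1.lemA (r0 := r0) (Or.inl ⟨rfl, hv, e⟩)
    omega
  · intro e
    have := e2.lemA (r0 := r0) (Or.inl ⟨rfl, hv, e⟩)
    omega

theorem f2 (F : FD ω P Q r c r' c' i j) {c0 : ℕ} (h1 : c < c0) (hv : r + c0 + 2 ≤ n) :
    P.south r c0 ≠ i ∧ P.south r c0 ≠ j := by
  obtain ⟨e1, e2, e3, e4⟩ := F.edges
  constructor
  · intro e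
    have := e1.lemB (c0 := c0) (Or.inr ⟨rfl, hv, e⟩)
    omega
  · intro e
    have := e2.lemB (c0 := c0) (Or.inr ⟨rfl, hv, e⟩)
    omega

theorem f3 (F : FD ω P Q r c r' c' i j) {r0 : ℕ} (h1 : r' < r0) (hv : r0 + c' + 2 ≤ n) :
    P.west r0 (c'+1) ≠ i ∧ P.west r0 (c'+1) ≠ j := by
  obtain ⟨e1, e2, e3, e4⟩ := F.edges
  constructor
  · intro e
    have := e3.lemC (r0 := r0) (c0 := c' + 1) (Or.inl ⟨rfl, by omega, e⟩)
    omega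
  · intro e
    have := e4.lemC (r0 := r0) (c0 := c' + 1) (Or.inl ⟨rfl, by omega, e⟩)
    omega

theorem f4 (F : FD ω P Q r c r' c' i j) {c0 : ℕ} (h1 : c0 < c') :
    P.north r' c0 ≠ i ∧ P.north r' c0 ≠ j := by
  obtain ⟨e1, e2, e3, e4⟩ := F.edges
  have hs := P.inShape _ _ F.xB'
  have key : ∀ k, P.Edge k r' c' 0 ∨ P.Edge k r' c' 1 → P.north r' c0 ≠ k := by
    intro k hk e
    obtain ⟨d, hk⟩ : ∃ d, P.Edge k r' c' d := by
      rcases hk with h | h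
      · exact ⟨_, h⟩
      · exact ⟨_, h⟩
    rcases r' with _ | r'
    · have := xc_north F.hE (c := c0) (by omega)
      have h2 := hk.exit_ge F.hE
      rw [e] at this
      omega
    · have := hk.lemC (r0 := r') (c0 := c0)
        (Or.inr ⟨rfl, by omega, by rw [south_eq P (by omega)]; exact e⟩)
      omega
  exact ⟨key i (.inl e3), key j (.inr e4)⟩

theorem sw_ne {x : ℕ} (h : x ≠ i ∧ x ≠ j) : Equiv.swap i j x = x :=
  Equiv.swap_apply_of_ne_of_ne h.1 h.2

theorem fl (F : FD ω P Q r c r' c' i j) (r0 c0 : ℕ) :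
    (r0 + c0 + 1 ≤ n → (inR r c r' c' r0 c0 → Q.west r0 c0 = Equiv.swap i j (P.west r0 c0)) ∧
      (¬ inR r c r' c' r0 c0 → Q.west r0 c0 = P.west r0 c0)) ∧
    (r0 + c0 + 2 ≤ n → (inR r c r' c' r0 c0 → Q.south r0 c0 = Equiv.swap i j (P.south r0 c0)) ∧
      (¬ inR r c r' c' r0 c0 → Q.south r0 c0 = P.south r0 c0)) := by
  induction hm : n - r0 + c0 using Nat.strong_induction_on generalizing r0 c0 with
  | _ m ih =>
  have hrc := F.hr
  have hcc := F.hc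
  have hB := F.hB
  constructor
  · intro hv
    rcases c0 with _ | c0
    · rw [west_zero, west_zero]
      refine ⟨fun h => ?_, fun _ => rfl⟩
      unfold inR at h
      obtain rfl : c = 0 := by omega
      have := F.f1 (r0 := r0) (by omega) (by omega)
      rw [west_zero] at this
      rw [sw_ne this]
    · obtain ⟨⟨w1, w2⟩, ⟨s1, s2⟩⟩ := (ih (n - r0 + c0) (by omega) r0 c0 rfl).imp
        (fun h => h (by omega)) (fun h => h (by omega))
      by_cases hb : r0 = r ∧ c0 = c
      · obtain ⟨rfl, rfl⟩ := hb
        have hn : ¬ inR r0 c0 r' c' r0 c0 := by unfold inR; omega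
        have hi : inR r0 c0 r' c' r0 (c0+1) := by unfold inR; omega
        refine ⟨fun _ => ?_, fun h => (h hi).elim⟩
        rw [west_succ_cross F.qB, west_succ_elbow F.xB, w2 hn, F.wB, F.sB, Equiv.swap_apply_right]
      by_cases hb' : r0 = r' ∧ c0 = c'
      · obtain ⟨rfl, rfl⟩ := hb'
        have hi : inR r c r0 c0 r0 c0 := by unfold inR; omega
        have hn : ¬ inR r c r0 c0 r0 (c0+1) := by unfold inR; omega
        refine ⟨fun h => (hn h).elim, fun _ => ?_⟩
        rw [west_succ_cross F.xB', west_succ_elbow F.qB', s1 hi, F.wB', F.sB',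
          Equiv.swap_apply_right]
      have ht := F.qo r0 c0 (by simpa using hb) (by simpa using hb')
      have hw : ∀ f : ℕ → ℕ, Q.west r0 c0 = f (P.west r0 c0) → Q.south r0 c0 = f (P.south r0 c0) →
          Q.west r0 (c0+1) = f (P.west r0 (c0+1)) := by
        intro f e1 e2
        rw [west_succ, west_succ, ← ht]
        split_ifs <;> assumption
      by_cases hi : inR r c r' c' r0 c0
      · have key := hw (Equiv.swap i j) (w1 hi) (s1 hi)
        refine ⟨fun _ => key, fun h => ?_⟩
        rw [key, sw_ne]
        unfold inR at hi h
        obtain rfl : c0 = c' := by omega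
        exact F.f3 (by omega) (by omega)
      · have key := hw id (w2 hi) (s2 hi)
        refine ⟨fun h => ?_, fun _ => key⟩
        rw [key, sw_ne, id]
        unfold inR at hi h
        obtain rfl : c0 + 1 = c := by omega
        exact F.f1 (by omega) (by omega)
  · intro hv
    obtain ⟨w, s⟩ := ih (n - (r0+1) + c0) (by omega) (r0+1) c0 rfl
    obtain ⟨w1, w2⟩ := w (by omega)
    rw [south_eq Q hv, south_eq P hv]
    by_cases hb : r0 + 1 = r ∧ c0 = c
    · obtain ⟨rfl, rfl⟩ := hb
      obtain ⟨s1, s2⟩ := s (by omega)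
      have hn : ¬ inR (r0+1) c0 r' c' (r0+1) c0 := by unfold inR; omega
      have hi : inR (r0+1) c0 r' c' r0 c0 := by unfold inR; omega
      refine ⟨fun _ => ?_, fun h => (h hi).elim⟩
      rw [north_cross F.qB, north_elbow F.xB, s2 hn, F.wB, F.sB, Equiv.swap_apply_left]
    by_cases hb' : r0 + 1 = r' ∧ c0 = c'
    · obtain ⟨rfl, rfl⟩ := hb'
      obtain ⟨s1, s2⟩ := s (P.inShape _ _ F.xB')
      have hi : inR r c (r0+1) c0 (r0+1) c0 := by unfold inR; omega
      have hn : ¬ inR r c (r0+1) c0 r0 c0 := by unfold inR; omega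
      refine ⟨fun h => (hn h).elim, fun _ => ?_⟩
      rw [north_cross F.xB', north_elbow F.qB', w1 hi, F.wB', F.sB',
          Equiv.swap_apply_left]
    have ht := F.qo (r0+1) c0 (by simpa using hb) (by simpa using hb')
    have hw : ∀ f : ℕ → ℕ, Q.west (r0+1) c0 = f (P.west (r0+1) c0) →
        (r0 + 1 + c0 + 2 ≤ n → Q.south (r0+1) c0 = f (P.south (r0+1) c0)) →
        Q.north (r0+1) c0 = f (P.north (r0+1) c0) := by
      intro f e1 e2
      unfold PipeDream.north
      rw [← ht]
      split_ifs with hx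
      · exact e2 (P.inShape _ _ hx)
      · exact e1
    by_cases hi : inR r c r' c' (r0+1) c0
    · have key := hw (Equiv.swap i j) (w1 hi) (fun h => (s h).1 hi)
      refine ⟨fun _ => key, fun h => ?_⟩
      rw [key, sw_ne]
      unfold inR at hi h
      obtain rfl : r0 + 1 = r' := by omega
      exact F.f4 (by omega)
    · have key := hw id (w2 hi) (fun h => (s h).2 hi)
      refine ⟨fun h => ?_, fun _ => key⟩
      rw [key, sw_ne, id]
      unfold inR at hi h
      obtain rfl : r0 = r := by omega
      rw [← south_eq P hv]
      exact F.f2 (by omega) (by omega)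

theorem flw (F : FD ω P Q r c r' c' i j) {r0 c0 : ℕ} (h : r0 + c0 + 1 ≤ n)
    (hi : inR r c r' c' r0 c0) : Q.west r0 c0 = Equiv.swap i j (P.west r0 c0) :=
  ((F.fl r0 c0).1 h).1 hi
theorem flw' (F : FD ω P Q r c r' c' i j) {r0 c0 : ℕ} (h : r0 + c0 + 1 ≤ n)
    (hi : ¬ inR r c r' c' r0 c0) : Q.west r0 c0 = P.west r0 c0 :=
  ((F.fl r0 c0).1 h).2 hi
theorem fls (F : FD ω P Q r c r' c' i j) {r0 c0 : ℕ} (h : r0 + c0 + 2 ≤ n)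
    (hi : inR r c r' c' r0 c0) : Q.south r0 c0 = Equiv.swap i j (P.south r0 c0) :=
  ((F.fl r0 c0).2 h).1 hi
theorem fls' (F : FD ω P Q r c r' c' i j) {r0 c0 : ℕ} (h : r0 + c0 + 2 ≤ n)
    (hi : ¬ inR r c r' c' r0 c0) : Q.south r0 c0 = P.south r0 c0 :=
  ((F.fl r0 c0).2 h).2 hi

theorem hEQ (F : FD ω P Q r c r' c' i j) : Q.HasExitPerm ω := by
  have hrc := F.hr
  have hcc := F.hc
  intro ⟨c0, hc0⟩
  rw [← F.hE ⟨c0, hc0⟩]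
  simp only
  rw [exitPipe_eq, exitPipe_eq]
  by_cases hb' : 0 = r' ∧ c0 = c'
  · obtain ⟨rfl, rfl⟩ := hb'
    rw [north_cross F.xB', north_elbow F.qB', F.flw (by omega) (by unfold inR; omega), F.wB', F.sB',
      Equiv.swap_apply_left]
  have ht := F.qo 0 c0 (by simp; omega) (by simpa using hb')
  have hw : ∀ f : ℕ → ℕ, Q.west 0 c0 = f (P.west 0 c0) →
      (0 + c0 + 2 ≤ n → Q.south 0 c0 = f (P.south 0 c0)) →
      Q.north 0 c0 = f (P.north 0 c0) := by
    intro f e1 e2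
    unfold PipeDream.north
    rw [← ht]
    split_ifs with hx
    · exact e2 (P.inShape _ _ hx)
    · exact e1
  by_cases hi : inR r c r' c' 0 c0
  · rw [hw (Equiv.swap i j) (F.flw (by omega) hi) (fun h => F.fls h hi), sw_ne]
    unfold inR at hi
    obtain rfl : r' = 0 := by omega
    exact F.f4 (by omega)
  · exact hw id (F.flw' (by omega) hi) (fun h => F.fls' h hi)

end FD
end PipeDream


namespace PipeDream
variable {n : ℕ} {P Q : PipeDream n} {ω : Equiv.Perm (Fin n)}

theorem edge_elW {z r1 c1 d : ℕ} (h : P.Edge z r1 c1 d) :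
    ∃ r2 c2, P.ElW z r2 c2 ∧ r1 ≤ r2 ∧ c1 ≤ c2 := by
  rcases h with ⟨_, h1, h2⟩ | ⟨_, h1, h2⟩
  · obtain ⟨c3, a1, a2, -⟩ := hfwd h1 h2
    exact ⟨_, _, a2, le_rfl, a1⟩
  · obtain ⟨r3, a1, a2, -⟩ := vback h1 h2
    exact ⟨_, _, a2, a1.le, le_rfl⟩

theorem lemL1 (hR : P.Reduced) (hE : P.HasExitPerm ω) {i z r' c' r1 c1 d : ℕ}
    (hv : r' + c' + 2 ≤ n) (hi : P.west r' (c'+1) = i) (hz : z < i) (he : P.Edge z r1 c1 d)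
    (h1 : r' < r1) (h2 : c' < c1) : P.Path i z := by
  obtain ⟨r2, c2, a1, a2, a3⟩ := edge_elW he
  obtain ⟨c3, f1, f2, f3, f4⟩ := hfwd (P := P) (r := r') (c0 := c' + 1) (by omega) hi
  refine lemG hR f2 f3 f4 ?_ a1 (by omega) (by omega)
  intro r c x1 x2 x3
  have := cross_lt hR hE x1 x2 x3
  omega

theorem lemL2 (hR : P.Reduced) (hE : P.HasExitPerm ω) {j z r c r1 c1 d : ℕ}
    (hv : r + c + 2 ≤ n) (hj : P.south r c = j) (hz : j < z) (he : P.Edge z r1 c1 d)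
    (h1 : r < r1) (h2 : c < c1) : P.Path j z := by
  obtain ⟨r2, c2, a1, a2, a3⟩ := edge_elW he
  obtain ⟨r9, f1, f2, f3, f4⟩ := vback hv hj
  have key : ∀ m r2 c2, c2 = m → P.ElW z r2 c2 → r < r2 → c < c2 → P.Path j z := by
    intro m
    induction m using Nat.strong_induction_on with
    | _ m ih =>
      rintro r2 c2 rfl g1 g2 g3
      rcases le_or_gt r9 r2 with h9 | h9
      · exact lemQ1 hR f2 g1 h9 g3.le
      have gv := g1.1
      rcases hback g1.1 g1.2.2 g3.le with ⟨c4, b1, b2, b3⟩ | ⟨b1, b2⟩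
      · rcases Nat.eq_or_lt_of_le b1 with rfl | b1
        · have := f3 r2 g2 h9
          simp [b3.2.1] at this
        · obtain ⟨r5, d1, d2, -⟩ := vback b3.1 b3.2.2
          exact ih c4 b2 r5 c4 rfl d2 (by omega) b1
      · have := cross_lt hR hE (b1 c le_rfl g3) (b2 c le_rfl g3.le) (f4 r2 g2.le h9)
        omega
  exact key c2 r2 c2 rfl a1 (by omega) (by omega)

theorem first_touch {α : Type*} {R : α → α → Prop} {S : α → Prop} {k y : α}
    (h : Relation.ReflTransGen R k y) (hy : S y) (hk : ¬ S k) :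
    ∃ z x, Relation.ReflTransGen (fun u v => R u v ∧ ¬ S u ∧ ¬ S v) k z ∧ ¬ S z ∧ R z x ∧ S x ∧
      Relation.ReflTransGen R x y := by
  induction h using Relation.ReflTransGen.head_induction_on with
  | refl => exact (hk hy).elim
  | @head a b hab hby ih =>
    by_cases hb : S b
    · exact ⟨a, b, .refl, hk, hab, hb, hby⟩
    · obtain ⟨z, x, h1, h2⟩ := ih hb
      exact ⟨z, x, .head ⟨hab, hk, hb⟩ h1, h2⟩

theorem last_touch {α : Type*} {R : α → α → Prop} {S : α → Prop} {k y : α}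
    (h : Relation.ReflTransGen R y k) (hy : S y) (hk : ¬ S k) :
    ∃ x z, Relation.ReflTransGen R y x ∧ S x ∧ R x z ∧ ¬ S z ∧
      Relation.ReflTransGen (fun u v => R u v ∧ ¬ S u ∧ ¬ S v) z k := by
  induction h with
  | refl => exact (hk hy).elim
  | @tail a b hya hab ih =>
    by_cases hb : S a
    · exact ⟨a, b, hya, hb, hab, hk, .refl⟩
    · obtain ⟨x, z, h1, h2, h3, h4, h5⟩ := ih hb
      exact ⟨x, z, h1, h2, h3, h4, .tail h5 ⟨hab, hb, hk⟩⟩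

theorem avoid_path {α : Type*} {R : α → α → Prop} {S : α → Prop} {k y : α}
    (h : Relation.ReflTransGen (fun u v => R u v ∧ ¬ S u ∧ ¬ S v) k y) :
    Relation.ReflTransGen R k y := Relation.ReflTransGen.mono (fun _ _ h => h.1) _ _ h

theorem Acyclic.cyc (h : P.Acyclic) {u v : ℕ} (h1 : P.Path u v) (h2 : P.Path v u) : u = v := by
  rcases Relation.reflTransGen_iff_eq_or_transGen.1 h1 with e | h1
  · exact e.symm
  · exact (h u (Relation.TransGen.trans_left h1 h2)).elim

theorem Acyclic.irr (h : P.Acyclic) {u v : ℕ} (h1 : P.Arc u v) (h2 : P.Path v u) : False :=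
  h u (Relation.TransGen.trans_left (.single h1) h2)

/-- A flip between good pipe dreams. -/
structure FG (ω : Equiv.Perm (Fin n)) (P Q : PipeDream n) (r c r' c' i j : ℕ) : Prop
  extends FD ω P Q r c r' c' i j where
  hRQ : Q.Reduced
  hA : P.Acyclic
  hAQ : Q.Acyclic

namespace FG
variable {r c r' c' i j : ℕ}
open FD (inR)

theorem arcP (F : FG ω P Q r c r' c' i j) : P.Arc i j := ⟨r, c, F.hB, F.xB, F.wB, F.sB⟩

theorem wQ (F : FG ω P Q r c r' c' i j) : Q.west r' c' = j ∧ Q.south r' c' = i := by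
  have := F.hr; have := F.hc; have := P.inShape _ _ F.xB'
  have hi : inR r c r' c' r' c' := by unfold inR; omega
  rw [F.flw (by omega) hi, F.fls (by omega) hi, F.wB', F.sB', Equiv.swap_apply_left,
    Equiv.swap_apply_right]
  exact ⟨rfl, rfl⟩

theorem arcQ (F : FG ω P Q r c r' c' i j) : Q.Arc j i :=
  ⟨r', c', P.inShape _ _ F.xB', F.qB', F.wQ.1, F.wQ.2⟩

theorem cross_same (F : FG ω P Q r c r' c' i j) {r0 c0 : ℕ} (h1 : ¬ (r0 = r ∧ c0 = c))
    (h2 : ¬ (r0 = r' ∧ c0 = c')) : P.cross r0 c0 = Q.cross r0 c0 :=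
  F.qo r0 c0 (by simpa using h1) (by simpa using h2)

/-- a `P`-contact is of one of three types -/
theorem contactP (F : FG ω P Q r c r' c' i j) {u v rD cD : ℕ} (hv : rD + cD + 2 ≤ n)
    (hx : P.cross rD cD = false) (hu : P.west rD cD = u) (hs : P.south rD cD = v) :
    (u = i ∧ v = j ∧ rD = r ∧ cD = c) ∨
    (inR r c r' c' rD cD ∧ Q.cross rD cD = false ∧ Q.west rD cD = Equiv.swap i j u ∧
      Q.south rD cD = Equiv.swap i j v) ∨
    (¬ inR r c r' c' rD cD ∧ ¬ (rD = r ∧ cD = c) ∧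
      Q.cross rD cD = false ∧ Q.west rD cD = u ∧ Q.south rD cD = v) := by
  by_cases h1 : rD = r ∧ cD = c
  · left; obtain ⟨rfl, rfl⟩ := h1
    have := F.wB; have := F.sB
    omega
  have h2 : ¬ (rD = r' ∧ cD = c') := by
    rintro ⟨rfl, rfl⟩; have := F.xB'; simp [hx] at this
  have hq := F.cross_same h1 h2
  right
  by_cases hi : inR r c r' c' rD cD
  · left; exact ⟨hi, by rw [← hq, hx], by rw [F.flw (by omega) hi, hu], by rw [F.fls hv hi, hs]⟩
  · right; exact ⟨hi, h1, by rw [← hq, hx], by rw [F.flw' (by omega) hi, hu], by rw [F.fls' hv hi, hs]⟩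

theorem contactQ (F : FG ω P Q r c r' c' i j) {u v rD cD : ℕ} (hv : rD + cD + 2 ≤ n)
    (hx : Q.cross rD cD = false) (hu : Q.west rD cD = u) (hs : Q.south rD cD = v) :
    (u = j ∧ v = i ∧ rD = r' ∧ cD = c') ∨
    (inR r c r' c' rD cD ∧ P.cross rD cD = false ∧ P.west rD cD = Equiv.swap i j u ∧
      P.south rD cD = Equiv.swap i j v) ∨
    (¬ inR r c r' c' rD cD ∧ ¬ (rD = r ∧ cD = c) ∧
      P.cross rD cD = false ∧ P.west rD cD = u ∧ P.south rD cD = v) := by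
  by_cases h1 : rD = r' ∧ cD = c'
  · left; obtain ⟨rfl, rfl⟩ := h1
    have := F.wQ
    omega
  have h2 : ¬ (rD = r ∧ cD = c) := by
    rintro ⟨rfl, rfl⟩; have := F.qB; simp [hx] at this
  have hq := F.cross_same h2 h1
  right
  by_cases hi : inR r c r' c' rD cD
  · left; exact ⟨hi, by rw [hq, hx], by rw [← hu, F.flw (by omega) hi, Equiv.swap_apply_self],
      by rw [← hs, F.fls hv hi, Equiv.swap_apply_self]⟩
  · right; exact ⟨hi, h2, by rw [hq, hx], by rw [← hu, F.flw' (by omega) hi],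
      by rw [← hs, F.fls' hv hi]⟩

theorem contact_ne (P : PipeDream n) {u v : ℕ} (h : P.Arc u v) : u ≠ v := by
  obtain ⟨r, c, h1, h2, h3, h4⟩ := h
  rw [← h3, ← h4]; exact west_ne_south h1

theorem swap_cases (i j u : ℕ) : (u = i ∧ Equiv.swap i j u = j) ∨ (u = j ∧ Equiv.swap i j u = i) ∨
    (u ≠ i ∧ u ≠ j ∧ Equiv.swap i j u = u) := by
  by_cases h1 : u = i
  · left; subst h1; simp
  by_cases h2 : u = j
  · right; left; subst h2; simp
  · right; right; exact ⟨h1, h2, FD.sw_ne ⟨h1, h2⟩⟩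

theorem lemC (F : FG ω P Q r c r' c' i j) {b a : ℕ} (h : P.Path b a) :
    Q.Path b a ∨ (Q.Path b i ∧ Q.Path j a) := by
  have hq : Q.Path j i := .arc F.arcQ
  have arcs : ∀ u v, P.Arc u v → Q.Path u v ∨ (Q.Path u i ∧ Q.Path j v) := by
    rintro u v ⟨rD, cD, h1, h2, h3, h4⟩
    rcases F.contactP h1 h2 h3 h4 with ⟨rfl, rfl, -⟩ | ⟨-, g1, g2, g3⟩ | ⟨-, -, g1, g2, g3⟩
    · exact .inr ⟨.refl, .refl⟩
    · have ha : Q.Path (Equiv.swap i j u) (Equiv.swap i j v) := .arc ⟨rD, cD, h1, g1, g2, g3⟩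
      rcases swap_cases i j u with ⟨eu, e⟩ | ⟨eu, e⟩ | ⟨-, -, e⟩ <;>
      rcases swap_cases i j v with ⟨ev, e'⟩ | ⟨ev, e'⟩ | ⟨-, -, e'⟩ <;> rw [e, e'] at ha <;>
        (try rw [eu]) <;> (try rw [ev])
      · exact .inl .refl
      · exact .inr ⟨.refl, .refl⟩
      · exact .inr ⟨.refl, ha⟩
      · exact .inl hq
      · exact .inl .refl
      · exact .inl (hq.trans ha)
      · exact .inl (ha.trans hq)
      · exact .inr ⟨ha, .refl⟩
      · exact .inl ha
    · exact .inl (.arc ⟨rD, cD, h1, g1, g2, g3⟩)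
  induction h with
  | refl => exact .inl .refl
  | @tail y z _ hyz ih =>
    rcases ih with h | ⟨h, h'⟩ <;> rcases arcs _ _ hyz with g | ⟨g, g'⟩
    · exact .inl (h.trans g)
    · exact .inr ⟨h.trans g, g'⟩
    · exact .inr ⟨h, h'.trans g⟩
    · exact .inr ⟨h, g'⟩

theorem lemC' (F : FG ω P Q r c r' c' i j) {b a : ℕ} (h : Q.Path b a) :
    P.Path b a ∨ (P.Path b j ∧ P.Path i a) := by
  have hq : P.Path i j := .arc F.arcP
  have arcs : ∀ u v, Q.Arc u v → P.Path u v ∨ (P.Path u j ∧ P.Path i v) := by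
    rintro u v ⟨rD, cD, h1, h2, h3, h4⟩
    rcases F.contactQ h1 h2 h3 h4 with ⟨rfl, rfl, -⟩ | ⟨-, g1, g2, g3⟩ | ⟨-, -, g1, g2, g3⟩
    · exact .inr ⟨.refl, .refl⟩
    · have ha : P.Path (Equiv.swap i j u) (Equiv.swap i j v) := .arc ⟨rD, cD, h1, g1, g2, g3⟩
      rcases swap_cases i j u with ⟨eu, e⟩ | ⟨eu, e⟩ | ⟨-, -, e⟩ <;>
      rcases swap_cases i j v with ⟨ev, e'⟩ | ⟨ev, e'⟩ | ⟨-, -, e'⟩ <;> rw [e, e'] at ha <;>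
        (try rw [eu]) <;> (try rw [ev])
      · exact .inl .refl
      · exact .inl hq
      · exact .inl (hq.trans ha)
      · exact .inr ⟨.refl, .refl⟩
      · exact .inl .refl
      · exact .inr ⟨.refl, ha⟩
      · exact .inr ⟨ha, .refl⟩
      · exact .inl (ha.trans hq)
      · exact .inl ha
    · exact .inl (.arc ⟨rD, cD, h1, g1, g2, g3⟩)
  induction h with
  | refl => exact .inl .refl
  | @tail y z _ hyz ih =>
    rcases ih with h | ⟨h, h'⟩ <;> rcases arcs _ _ hyz with g | ⟨g, g'⟩
    · exact .inl (h.trans g)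
    · exact .inr ⟨h.trans g, g'⟩
    · exact .inr ⟨h, h'.trans g⟩
    · exact .inr ⟨h, g'⟩

theorem third {u v z r0 c0 : ℕ} (hv : r0 + c0 + 2 ≤ n) (hu : P.west r0 c0 = u)
    (hs : P.south r0 c0 = v) (h : P.Above u z ((c0:ℤ) - r0)) (hz : z ≠ v) :
    P.Above v z ((c0:ℤ) - r0) ∧ ∃ r1 c1 d1, P.Edge z r1 c1 d1 ∧ r0 < r1 ∧ c0 < c1 := by
  obtain ⟨s1, b1, f1, s2, b2, f2, a1, a2, a3, a4, a5⟩ := h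
  have e1 : P.Edge u r0 c0 0 := Or.inl ⟨rfl, by omega, hu⟩
  have e2 : P.Edge v r0 c0 1 := Or.inr ⟨rfl, by omega, hs⟩
  have := a1.uniq e1 (by omega)
  have hd := a2.valid
  have hne : ¬ (s2 = r0 ∧ f2 = 1) := by
    rintro ⟨rfl, rfl⟩
    obtain rfl : b2 = c0 := by omega
    rcases a2 with ⟨h, _⟩ | ⟨_, _, h⟩
    · omega
    · exact hz (by rw [← h, hs])
  exact ⟨⟨r0, c0, 1, s2, b2, f2, e2, a2, rfl, a4, by omega⟩, s2, b2, f2, a2, by omega, by omega⟩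

theorem third' {u v z r0 c0 : ℕ} (hv : r0 + c0 + 2 ≤ n) (hu : P.west r0 c0 = u)
    (hs : P.south r0 c0 = v) (h : P.Above z v ((c0:ℤ) - r0)) (hz : z ≠ u) :
    P.Above z u ((c0:ℤ) - r0) := by
  obtain ⟨s1, b1, f1, s2, b2, f2, a1, a2, a3, a4, a5⟩ := h
  have e1 : P.Edge u r0 c0 0 := Or.inl ⟨rfl, by omega, hu⟩
  have e2 : P.Edge v r0 c0 1 := Or.inr ⟨rfl, by omega, hs⟩
  have := a2.uniq e2 (by omega)
  have hd := a1.valid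
  have hne : ¬ (s1 = r0 ∧ f1 = 0) := by
    rintro ⟨rfl, rfl⟩
    obtain rfl : b1 = c0 := by omega
    rcases a1 with ⟨_, _, h⟩ | ⟨h, _⟩
    · exact hz (by rw [← h, hu])
    · omega
  exact ⟨s1, b1, f1, r0, c0, 0, a1, e1, a3, rfl, by omega⟩

theorem lemK (F : FG ω P Q r c r' c' i j) {z : ℕ} {t : ℤ} (h1 : (c:ℤ) - r < t)
    (h2 : t < (c':ℤ) - r') (hi : P.Above i z t) (hj : P.Above z j t) :
    (z < i ∧ Q.Path i z) ∨ (j < z ∧ P.Path j z) := by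
  obtain ⟨e1, e2, e3, e4⟩ := F.edges
  have hs' := P.inShape _ _ F.xB'
  have hij := F.hij
  obtain ⟨bi, bz, b3, b4, b5⟩ := hi.bounds
  obtain ⟨-, bj, -, b6, b7⟩ := hj.bounds
  have hex := hi.exits F.hE
  have hex' := hj.exits F.hE
  have k1 := e1.bound
  have x3 := e3.exit_ge F.hE
  rcases lt_or_gt_of_ne b5 with hlt | hlt
  · -- `i < z`; alive at the time of the contact
    have hbel : P.Above j z ((c:ℤ) - r) ∧ ∃ r1 c1 d1, P.Edge z r1 c1 d1 ∧ r < r1 ∧ c < c1 := by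
      rcases above_total F.hE (P := P) bi bz b5 (t := (c:ℤ) - r) (by omega) (by omega) (by omega)
        (by omega) with h | h
      · exact third F.hB F.wB F.sB h b7
      · exact (hi.asymm (persist F.hR F.hE hlt h h1.le hex.1 hex.2)).elim
    rcases lt_or_gt_of_ne b7 with hzj | hzj
    · exact (hj.asymm (persist F.hR F.hE hzj hbel.1 h1.le hex.2 hex'.2)).elim
    · right
      obtain ⟨-, r1, c1, d1, g1, g2, g3⟩ := hbel
      exact ⟨hzj, lemL2 F.hR F.hE F.hB F.sB hzj g1 g2 g3⟩
  · left
    have hinv := above_inv F.hR F.hE hlt hi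
    have := persist F.hR F.hE hlt hi h2.le (by omega) (by omega)
    obtain ⟨-, r1, c1, d1, g1, g2, g3⟩ := third hs' F.wB' F.sB' this b7
    have hn : ¬ inR r c r' c' r1 c1 := by unfold inR; omega
    have g1' : Q.Edge z r1 c1 d1 := by
      rcases g1 with ⟨a, b, e⟩ | ⟨a, b, e⟩
      · exact Or.inl ⟨a, b, by rw [F.flw' b hn, e]⟩
      · exact Or.inr ⟨a, b, by rw [F.fls' b hn, e]⟩
    exact ⟨hlt, lemL1 F.hRQ F.hEQ hs' (by rw [west_succ_elbow F.qB', F.wQ.2]) hlt g1' g2 g3⟩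

theorem above_ij (F : FG ω P Q r c r' c' i j) {t : ℤ} (h1 : (c:ℤ) - r < t)
    (h2 : t < (c':ℤ) - r') : P.Above i j t := by
  obtain ⟨e1, e2, e3, e4⟩ := F.edges
  have x3 := e3.exit_ge F.hE
  have x4 := e4.exit_ge F.hE
  have k1 := e1.bound
  have k2 := e2.bound
  have hij := F.hij
  rcases above_total F.hE (P := P) k1.2 k2.2 (by omega) (t := t) (by omega) (by omega) (by omega)
        (by omega) with h | h
  · exact h
  · have a := persist F.hR F.hE hij h h2.le (by omega) (by omega)
    have := above_box (P := P) (P.inShape _ _ F.xB')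
    rw [F.wB', F.sB'] at this
    exact (this.asymm a).elim

theorem time_inR {rD cD : ℕ} (h : inR r c r' c' rD cD) (h' : ¬ (rD = r' ∧ cD = c')) :
    (c:ℤ) - r < (cD:ℤ) - rD ∧ (cD:ℤ) - rD < (c':ℤ) - r' := by
  unfold inR at h; omega

theorem lemK2 (F : FG ω P Q r c r' c' i j) {z rD cD : ℕ} (hv : rD + cD + 2 ≤ n)
    (hx : P.cross rD cD = false) (hu : P.west rD cD = z) (hs : P.south rD cD = j)
    (hD : inR r c r' c' rD cD) (hz : z ≠ i) : False := by
  have hne : ¬ (rD = r' ∧ cD = c') := by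
    rintro ⟨rfl, rfl⟩; have := F.xB'; simp [hx] at this
  obtain ⟨t1, t2⟩ := time_inR hD hne
  have hij := F.above_ij t1 t2
  have hiz := third' hv hu hs hij (Ne.symm hz)
  have hzj := above_box (P := P) hv
  rw [hu, hs] at hzj
  have hzj' : z ≠ j := hzj.bounds.2.2.2.2
  rcases F.lemK t1 t2 hiz hzj with ⟨h1, h2⟩ | ⟨h1, h2⟩
  · refine F.hAQ.irr (u := z) (v := i) ⟨rD, cD, hv, ?_, ?_, ?_⟩ h2
    · rw [← F.cross_same (by unfold inR at hD; omega) hne, hx]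
    · rw [F.flw (by omega) hD, hu, FD.sw_ne ⟨hz, hzj'⟩]
    · rw [F.fls (by omega) hD, hs, Equiv.swap_apply_right]
  · exact F.hA.irr ⟨rD, cD, hv, hx, hu, hs⟩ h2

theorem lemK1 (F : FG ω P Q r c r' c' i j) {z rD cD : ℕ} (hv : rD + cD + 2 ≤ n)
    (hx : P.cross rD cD = false) (hu : P.west rD cD = i) (hs : P.south rD cD = z)
    (hD : inR r c r' c' rD cD) (hz : z ≠ j) : (z < i ∧ Q.Path i z) ∨ (j < z ∧ P.Path j z) := by
  have hne : ¬ (rD = r' ∧ cD = c') := by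
    rintro ⟨rfl, rfl⟩; have := F.xB'; simp [hx] at this
  obtain ⟨t1, t2⟩ := time_inR hD hne
  have hij := F.above_ij t1 t2
  have hjz := (third hv hu hs hij (Ne.symm hz)).1
  have hiz := above_box (P := P) hv
  rw [hu, hs] at hiz
  exact F.lemK t1 t2 hiz hjz

/-- avoiding paths agree -/
theorem avoidPQ (F : FG ω P Q r c r' c' i j) {k y : ℕ}
    (h : Relation.ReflTransGen (fun u v => P.Arc u v ∧ ¬ (u = i ∨ u = j) ∧ ¬ (v = i ∨ v = j)) k y) :
    Q.Path k y := by
  refine Relation.ReflTransGen.mono ?_ _ _ h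
  rintro u v ⟨⟨rD, cD, h1, h2, h3, h4⟩, hu, hv⟩
  push Not at hu hv
  rcases F.contactP h1 h2 h3 h4 with ⟨rfl, rfl, -⟩ | ⟨-, g1, g2, g3⟩ | ⟨-, -, g1, g2, g3⟩
  · exact (hu.1 rfl).elim
  · exact ⟨rD, cD, h1, g1, by rw [g2, FD.sw_ne hu], by rw [g3, FD.sw_ne hv]⟩
  · exact ⟨rD, cD, h1, g1, g2, g3⟩

theorem avoidQP (F : FG ω P Q r c r' c' i j) {k y : ℕ}
    (h : Relation.ReflTransGen (fun u v => Q.Arc u v ∧ ¬ (u = i ∨ u = j) ∧ ¬ (v = i ∨ v = j)) k y) :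
    P.Path k y := by
  refine Relation.ReflTransGen.mono ?_ _ _ h
  rintro u v ⟨⟨rD, cD, h1, h2, h3, h4⟩, hu, hv⟩
  push Not at hu hv
  rcases F.contactQ h1 h2 h3 h4 with ⟨rfl, rfl, -⟩ | ⟨-, g1, g2, g3⟩ | ⟨-, -, g1, g2, g3⟩
  · exact (hu.2 rfl).elim
  · exact ⟨rD, cD, h1, g1, by rw [g2, FD.sw_ne hu], by rw [g3, FD.sw_ne hv]⟩
  · exact ⟨rD, cD, h1, g1, g2, g3⟩

/-- A `Q`-arc `z → i` is outside of the rectangle. -/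
theorem arcQ_i (F : FG ω P Q r c r' c' i j) {z rD cD : ℕ} (hz : z ≠ j)
    (h1 : rD + cD + 2 ≤ n) (h2 : Q.cross rD cD = false) (h3 : Q.west rD cD = z)
    (h4 : Q.south rD cD = i) : ¬ inR r c r' c' rD cD ∧ ¬ (rD = r ∧ cD = c) ∧
      P.cross rD cD = false ∧ P.west rD cD = z ∧ P.south rD cD = i := by
  have hzi : z ≠ i := contact_ne Q ⟨rD, cD, h1, h2, h3, h4⟩
  rcases F.contactQ h1 h2 h3 h4 with ⟨e, -⟩ | ⟨g0, g1, g2, g3⟩ | g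
  · exact (hz e).elim
  · rw [FD.sw_ne ⟨hzi, hz⟩] at g2
    rw [Equiv.swap_apply_left] at g3
    exact (F.lemK2 h1 g1 g2 g3 g0 hzi).elim
  · exact g

/-- A `P`-arc `z → j` is outside of the rectangle. -/
theorem arcP_j (F : FG ω P Q r c r' c' i j) {z rD cD : ℕ} (hz : z ≠ i)
    (h1 : rD + cD + 2 ≤ n) (h2 : P.cross rD cD = false) (h3 : P.west rD cD = z)
    (h4 : P.south rD cD = j) : ¬ inR r c r' c' rD cD ∧ ¬ (rD = r ∧ cD = c) ∧
      Q.cross rD cD = false ∧ Q.west rD cD = z ∧ Q.south rD cD = j := by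
  rcases F.contactP h1 h2 h3 h4 with ⟨e, -⟩ | ⟨g0, g1, g2, g3⟩ | g
  · exact (hz e).elim
  · exact (F.lemK2 h1 h2 h3 h4 g0 hz).elim
  · exact g

theorem naQ (F : FG ω P Q r c r' c' i j) {k : ℕ} (h1 : Q.Path j k) (h2 : Q.Path k i) :
    k = i ∨ k = j := by
  by_contra hk
  obtain ⟨z, x, a1, a2, a3, a4, a5⟩ := first_touch (S := fun x => x = i ∨ x = j) h2 (.inl rfl) hk
  obtain ⟨x', z', b1, b2, b3, b4, b5⟩ := last_touch (S := fun x => x = i ∨ x = j) h1 (.inr rfl) hk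
  have hx : x = i := by
    rcases a4 with e | rfl
    · exact e
    · exact (hk (.inr (F.hAQ.cyc ((avoid_path a1).trans (.single a3)) h1))).elim
  have hx' : x' = j := by
    rcases b2 with rfl | e
    · exact (hk (.inl (F.hAQ.cyc h2 (.head b3 (avoid_path b5))))).elim
    · exact e
  subst hx hx'
  push Not at a2 b4
  obtain ⟨rD, cD, d1, d2, d3, d4⟩ := a3
  obtain ⟨-, -, g1, g2, g3⟩ := F.arcQ_i a2.2 d1 d2 d3 d4
  have p1 : P.Path x z' := by
    obtain ⟨rD, cD, h1, h2, h3, h4⟩ := b3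
    rcases F.contactQ h1 h2 h3 h4 with ⟨e, e', -⟩ | ⟨g0, g1, g2, g3⟩ | ⟨-, -, g1, g2, g3⟩
    · exact (b4.1 e').elim
    · rw [FD.sw_ne b4] at g3
      rw [Equiv.swap_apply_right] at g2
      exact .arc ⟨rD, cD, h1, g1, g2, g3⟩
    · exact (Path.arc F.arcP).trans (.arc ⟨rD, cD, h1, g1, g2, g3⟩)
  exact F.hA.irr ⟨rD, cD, d1, g1, g2, g3⟩ (p1.trans ((F.avoidQP b5).trans (F.avoidQP a1)))

theorem naP (F : FG ω P Q r c r' c' i j) {k : ℕ} (h1 : P.Path i k) (h2 : P.Path k j) :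
    k = i ∨ k = j := by
  by_contra hk
  obtain ⟨z, x, a1, a2, a3, a4, a5⟩ := first_touch (S := fun x => x = i ∨ x = j) h2 (.inr rfl) hk
  obtain ⟨x', z', b1, b2, b3, b4, b5⟩ := last_touch (S := fun x => x = i ∨ x = j) h1 (.inl rfl) hk
  have hx : x = j := by
    rcases a4 with rfl | e
    · exact (hk (.inl (F.hA.cyc ((avoid_path a1).trans (.single a3)) h1))).elim
    · exact e
  have hx' : x' = i := by
    rcases b2 with e | rfl
    · exact e
    · exact (hk (.inr (F.hA.cyc h2 (.head b3 (avoid_path b5))))).elim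
  subst hx hx'
  push Not at a2 b4
  obtain ⟨rD, cD, d1, d2, d3, d4⟩ := a3
  obtain ⟨-, -, g1, g2, g3⟩ := F.arcP_j a2.1 d1 d2 d3 d4
  have p1 : Q.Path x z' := by
    obtain ⟨rD, cD, h1, h2, h3, h4⟩ := b3
    rcases F.contactP h1 h2 h3 h4 with ⟨e, e', -⟩ | ⟨g0, g1, g2, g3⟩ | ⟨-, -, g1, g2, g3⟩
    · exact (b4.2 e').elim
    · rw [FD.sw_ne b4] at g3
      rw [Equiv.swap_apply_left] at g2
      exact .arc ⟨rD, cD, h1, g1, g2, g3⟩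
    · exact (Path.arc F.arcQ).trans (.arc ⟨rD, cD, h1, g1, g2, g3⟩)
  exact F.hAQ.irr ⟨rD, cD, d1, g1, g2, g3⟩ (p1.trans ((F.avoidPQ b5).trans (F.avoidPQ a1)))

theorem el_transfer (F : FG ω P Q r c r' c' i j) {x r0 c0 : ℕ}
    (h : ¬ (r' ≤ r0 ∧ r0 ≤ r ∧ c ≤ c0 ∧ c0 ≤ c')) : P.El x r0 c0 ↔ Q.El x r0 c0 := by
  have := F.hr; have := F.hc
  have hi : ¬ inR r c r' c' r0 c0 := by unfold inR; omega
  have hq := F.cross_same (r0 := r0) (c0 := c0) (by omega) (by omega)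
  unfold El ElW ElS
  rw [hq]
  constructor
  · rintro (⟨a, b, e⟩ | ⟨a, b, e⟩)
    · exact .inl ⟨a, b, by rw [F.flw' a hi, e]⟩
    · exact .inr ⟨a, b, by rw [F.fls' a hi, e]⟩
  · rintro (⟨a, b, e⟩ | ⟨a, b, e⟩)
    · exact .inl ⟨a, b, by rw [← F.flw' a hi, e]⟩
    · exact .inr ⟨a, b, by rw [← F.fls' a hi, e]⟩

theorem lemZ (F : FG ω P Q r c r' c' i j) {m k rD cD d : ℕ} (hD : ¬ inR r c r' c' rD cD)
    (hD' : ¬ (rD = r ∧ cD = c)) (hk : k = i ∨ k = j) (he : P.Edge k rD cD d) (hm : m < n)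
    (h1 : rD ≤ m) (h2 : cD ≤ xc ω m) :
    ((∃ r1 c1, P.El m r1 c1 ∧ r1 ≤ rD ∧ c1 ≤ cD) ∧ (∃ r1 c1, Q.El m r1 c1 ∧ r1 ≤ rD ∧ c1 ≤ cD)) ∨
    ((∃ r1 c1, P.El m r1 c1 ∧ rD ≤ r1 ∧ cD ≤ c1) ∧ (∃ r1 c1, Q.El m r1 c1 ∧ rD ≤ r1 ∧ cD ≤ c1)) := by
  have hpos : (r ≤ rD ∧ cD ≤ c) ∨ (rD ≤ r' ∧ c' ≤ cD) := by
    obtain ⟨e1, e2, e3, e4⟩ := F.edges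
    unfold inR at hD
    rcases hk with rfl | rfl
    · have := he.lemC e1
      have := he.lemC e3
      omega
    · have := he.lemC e2
      have := he.lemC e4
      omega
  have hrr := F.hr
  have hcc := F.hc
  have key : ∀ r1 c1 r2 c2, r1 ≤ rD → c1 ≤ cD → rD ≤ r2 → cD ≤ c2 →
      (∀ x, P.El x r1 c1 ↔ Q.El x r1 c1) ∨ (∀ x, P.El x r2 c2 ↔ Q.El x r2 c2) := by
    intro r1 c1 r2 c2 a1 a2 a3 a4
    by_contra hcon
    push Not at hcon
    obtain ⟨⟨x, hx⟩, ⟨y, hy⟩⟩ := hcon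
    have q1 : (r' ≤ r1 ∧ r1 ≤ r ∧ c ≤ c1 ∧ c1 ≤ c') := by
      by_contra h
      have := F.el_transfer (x := x) h
      tauto
    have q2 : (r' ≤ r2 ∧ r2 ≤ r ∧ c ≤ c2 ∧ c2 ≤ c') := by
      by_contra h
      have := F.el_transfer (x := y) h
      tauto
    unfold inR at hD
    omega
  rcases lemT F.hE hm h1 h2 with ⟨r1, c1, a, a1, a2⟩ | ⟨r1, c1, a, a1, a2⟩ <;>
  rcases lemT F.hEQ hm h1 h2 with ⟨r2, c2, b, b1, b2⟩ | ⟨r2, c2, b, b1, b2⟩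
  · exact .inl ⟨⟨_, _, a, a1, a2⟩, ⟨_, _, b, b1, b2⟩⟩
  · rcases key r1 c1 r2 c2 a1 a2 b1 b2 with h | h
    · exact .inl ⟨⟨_, _, a, a1, a2⟩, ⟨_, _, (h m).1 a, a1, a2⟩⟩
    · exact .inr ⟨⟨_, _, (h m).2 b, b1, b2⟩, ⟨_, _, b, b1, b2⟩⟩
  · rcases key r2 c2 r1 c1 b1 b2 a1 a2 with h | h
    · exact .inl ⟨⟨_, _, (h m).2 b, b1, b2⟩, ⟨_, _, b, b1, b2⟩⟩
    · exact .inr ⟨⟨_, _, a, a1, a2⟩, ⟨_, _, (h m).1 a, a1, a2⟩⟩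
  · exact .inr ⟨⟨_, _, a, a1, a2⟩, ⟨_, _, b, b1, b2⟩⟩

end FG

/-- elbows northwest of a south elbow. -/
theorem lemQnw (hR : P.Reduced) {i l r c r1 c1 : ℕ} (hi : P.El i r c) (hl : P.ElS l r1 c1)
    (hr : r ≤ r1) (hc : c ≤ c1) : P.Path i l := by
  rcases hi with h | h
  · exact lemQ hR h (.inr hl) hr hc
  · exact lemQ' hR h hl hr hc

namespace FG
variable {r c r' c' i j : ℕ}

theorem labels (F : FG ω P Q r c r' c' i j) : i < n ∧ j < n := by
  obtain ⟨e1, e2, e3, e4⟩ := F.edges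
  exact ⟨e1.bound.2, e2.bound.2⟩

theorem lemG1 (F : FG ω P Q r c r' c' i j) {a : ℕ} (ha : a < i) (h : Q.Path j a) : Q.Path i a := by
  have hij := F.hij
  have hX := F.hX
  obtain ⟨x, z, b1, b2, b3, b4, b5⟩ := last_touch (S := fun x => x = i ∨ x = j) h (.inr rfl)
    (by omega)
  have hza := avoid_path b5
  rcases b2 with rfl | rfl
  · exact .head b3 hza
  push Not at b4
  by_cases hgoal : Q.Path i a
  · exact hgoal
  have hzi : z < i := by
    by_contra hcon
    rcases woip F.hRQ F.hEQ hza (b := i) (.inr ⟨ha, by omega⟩) with h' | h'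
    · rcases F.naQ (.arc b3) h' with e | e
      · exact b4.1 e
      · exact b4.2 e
    · exact hgoal h'
  obtain ⟨rD, cD, h1, h2, h3, h4⟩ := b3
  have hS : Q.ElS z rD cD := ⟨h1, h2, h4⟩
  rcases F.contactQ h1 h2 h3 h4 with ⟨e, e', -⟩ | ⟨g0, g1, g2, g3⟩ | ⟨g0, g0', g1, g2, g3⟩
  · exact (b4.1 e').elim
  · rw [FD.sw_ne b4] at g3
    rw [Equiv.swap_apply_right] at g2
    rcases F.lemK1 h1 g1 g2 g3 g0 b4.2 with h | h
    · exact h.2.trans hza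
    · omega
  · have eD : P.ElW x rD cD := ⟨by omega, g1, g2⟩
    have xx := eD.edge.exit_ge F.hE
    have bb := hS.edge.bound
    rcases F.lemZ g0 g0' (.inr rfl) eD.edge (m := i) F.labels.1 (by omega) (by omega) with
      ⟨-, ⟨r1, c1, q, q1, q2⟩⟩ | ⟨⟨r1, c1, q, q1, q2⟩, -⟩
    · exact (lemQnw F.hRQ q hS q1 q2).trans hza
    · exact (F.hA.irr F.arcP (lemQ F.hR eD q q1 q2)).elim

theorem lemG2 (F : FG ω P Q r c r' c' i j) {b : ℕ} (hb : j < b) (h : Q.Path b i) : Q.Path b j := by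
  have hij := F.hij
  have hX := F.hX
  obtain ⟨z, x, a1, a2, a3, a4, a5⟩ := first_touch (S := fun x => x = i ∨ x = j) h (.inl rfl)
    (by omega)
  have hbz := avoid_path a1
  rcases a4 with rfl | rfl
  swap
  · exact hbz.tail a3
  push Not at a2
  by_cases hgoal : Q.Path b j
  · exact hgoal
  have hzi : j < z := by
    by_contra hcon
    rcases woip F.hRQ F.hEQ hbz (b := j) (.inr ⟨by omega, hb⟩) with h' | h'
    · exact hgoal h'
    · rcases F.naQ h' (.arc a3) with e | e
      · exact a2.1 e
      · exact a2.2 e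
  have hXz : xc ω z < xc ω j := by
    by_contra hcon
    have hzn : z < n := by
      obtain ⟨rD, cD, h1, h2, h3, h4⟩ := a3
      rw [← h3]; exact (edge_w (P := Q) (by omega)).bound.2
    have hne : xc ω z ≠ xc ω j := fun e => a2.2 (xc_inj hzn F.labels.2 e)
    rcases F.naQ (lemF3 F.hRQ F.hEQ hzi hzn (by omega)) (.arc a3) with e | e
    · exact a2.1 e
    · exact a2.2 e
  obtain ⟨rD, cD, h1, h2, h3, h4⟩ := a3
  have hW : Q.ElW z rD cD := ⟨by omega, h2, h3⟩
  obtain ⟨g0, g0', g1, g2, g3⟩ := F.arcQ_i a2.2 h1 h2 h3 h4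
  have eD : P.ElS x rD cD := ⟨by omega, g1, g3⟩
  have xx := hW.edge.exit_ge F.hEQ
  have bb := eD.edge.bound
  rcases F.lemZ g0 g0' (.inl rfl) eD.edge (m := j) F.labels.2 (by omega) (by omega) with
      ⟨⟨r1, c1, q, q1, q2⟩, -⟩ | ⟨-, ⟨r1, c1, q, q1, q2⟩⟩
  · exact (F.hA.irr F.arcP (lemQnw F.hR q eD q1 q2)).elim
  · exact hbz.trans (lemQ F.hRQ hW q q1 q2)

theorem lemG1' (F : FG ω P Q r c r' c' i j) {a : ℕ} (ha : a < i) (h : P.Path a j) : P.Path a i := by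
  have hij := F.hij
  have hX := F.hX
  obtain ⟨z, x, a1, a2, a3, a4, a5⟩ := first_touch (S := fun x => x = i ∨ x = j) h (.inr rfl)
    (by omega)
  have haz := avoid_path a1
  rcases a4 with rfl | rfl
  · exact haz.tail a3
  push Not at a2
  by_cases hgoal : P.Path a i
  · exact hgoal
  have hzi : z < i := by
    by_contra hcon
    rcases woip F.hR F.hE haz (b := i) (.inl ⟨ha, by omega⟩) with h' | h'
    · exact hgoal h'
    · rcases F.naP h' (.arc a3) with e | e
      · exact a2.1 e
      · exact a2.2 e
  obtain ⟨rD, cD, h1, h2, h3, h4⟩ := a3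
  have hW : P.ElW z rD cD := ⟨by omega, h2, h3⟩
  have hS : P.ElS x rD cD := ⟨by omega, h2, h4⟩
  obtain ⟨g0, g0', g1, g2, g3⟩ := F.arcP_j a2.1 h1 h2 h3 h4
  have eD : Q.ElS x rD cD := ⟨by omega, g1, g3⟩
  have xx := hS.edge.exit_ge F.hE
  have bb := hW.edge.bound
  rcases F.lemZ g0 g0' (.inr rfl) hS.edge (m := i) F.labels.1 (by omega) (by omega) with
      ⟨-, ⟨r1, c1, q, q1, q2⟩⟩ | ⟨⟨r1, c1, q, q1, q2⟩, -⟩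
  · exact (F.hAQ.irr F.arcQ (lemQnw F.hRQ q eD q1 q2)).elim
  · exact haz.trans (lemQ F.hR hW q q1 q2)

theorem lemG2' (F : FG ω P Q r c r' c' i j) {b : ℕ} (hb : j < b) (h : P.Path i b) : P.Path j b := by
  have hij := F.hij
  have hX := F.hX
  obtain ⟨x, z, b1, b2, b3, b4, b5⟩ := last_touch (S := fun x => x = i ∨ x = j) h (.inl rfl)
    (by omega)
  have hza := avoid_path b5
  rcases b2 with rfl | rfl
  swap
  · exact .head b3 hza
  push Not at b4
  by_cases hgoal : P.Path j b
  · exact hgoal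
  have hzi : j < z := by
    by_contra hcon
    rcases woip F.hR F.hE hza (b := j) (.inl ⟨by omega, hb⟩) with h' | h'
    · rcases F.naP (.arc b3) h' with e | e
      · exact b4.1 e
      · exact b4.2 e
    · exact hgoal h'
  obtain ⟨rD, cD, h1, h2, h3, h4⟩ := b3
  have hS : P.ElS z rD cD := ⟨h1, h2, h4⟩
  have hW : P.ElW x rD cD := ⟨by omega, h2, h3⟩
  have bz := hS.edge.bound
  rcases F.contactP h1 h2 h3 h4 with ⟨e, e', -⟩ | ⟨g0, g1, g2, g3⟩ | ⟨g0, g0', g1, g2, g3⟩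
  · exact (b4.2 e').elim
  · rcases F.lemK1 h1 h2 h3 h4 g0 b4.2 with h | h
    · omega
    · exact h.2.trans hza
  · have eD : Q.ElW x rD cD := ⟨by omega, g1, g2⟩
    have xx := hS.edge.exit_ge F.hE
    have bb := hW.edge.bound
    have hXz : xc ω z < xc ω j := by
      by_contra hcon
      have hne : xc ω z ≠ xc ω j := fun e => b4.2 (xc_inj bz.2 F.labels.2 e)
      exact hgoal ((lemF3 F.hR F.hE hzi bz.2 (by omega)).trans hza)
    rcases F.lemZ g0 g0' (.inl rfl) hW.edge (m := j) F.labels.2 (by omega) (by omega) with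
      ⟨⟨r1, c1, q, q1, q2⟩, -⟩ | ⟨-, ⟨r1, c1, q, q1, q2⟩⟩
    · exact (lemQnw F.hR q hS q1 q2).trans hza
    · exact (F.hAQ.irr F.arcQ (lemQ F.hRQ eD q q1 q2)).elim

theorem flip_v (F : FG ω P Q r c r' c' i j) {a b : ℕ} (hab : a < b) (h : P.Path b a) :
    Q.Path b a := by
  rcases F.lemC h with h' | ⟨h1, h2⟩
  · exact h'
  rcases lt_trichotomy b j with hb | rfl | hb
  · rcases woip F.hRQ F.hEQ h2 (b := b) (.inr ⟨hab, hb⟩) with h3 | h3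
    · rcases F.naQ h3 h1 with rfl | rfl
      · exact F.lemG1 hab h2
      · exact h2
    · exact h3
  · exact h2
  · exact (F.lemG2 hb h1).trans h2

theorem flip_vi (F : FG ω P Q r c r' c' i j) {a b : ℕ} (hab : a < b) (h : Q.Path a b) :
    P.Path a b := by
  rcases F.lemC' h with h' | ⟨h1, h2⟩
  · exact h'
  rcases lt_trichotomy b j with hb | rfl | hb
  · rcases woip F.hR F.hE h1 (b := b) (.inl ⟨hab, hb⟩) with h3 | h3
    · exact h3
    · rcases F.naP h2 h3 with rfl | rfl
      · exact F.lemG1' hab h1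
      · exact h1
  · exact h1
  · exact h1.trans (F.lemG2' hb h2)
end FG

theorem flipStep_FG (h : FlipStep ω P Q) : ∃ r c r' c' i j, FG ω P Q r c r' c' i j := by
  obtain ⟨⟨h1, h2, h3⟩, ⟨h4, h5, h6⟩, h7⟩ := h
  obtain ⟨r, c, r', c', i, j, F⟩ := FD.of_incFlip h1 h2 h7
  exact ⟨r, c, r', c', i, j, F, h4, h3, h6⟩

theorem reach_v (h : Relation.ReflTransGen (FlipStep ω) P Q) {a b : ℕ} (hab : a < b)
    (hp : P.Path b a) : Q.Path b a := by
  induction h with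
  | refl => exact hp
  | tail _ hs ih => obtain ⟨r, c, r', c', i, j, F⟩ := flipStep_FG hs; exact F.flip_v hab ih

theorem reach_vi (h : Relation.ReflTransGen (FlipStep ω) P Q) {a b : ℕ} (hab : a < b)
    (hp : Q.Path a b) : P.Path a b := by
  induction h with
  | refl => exact hp
  | tail _ hs ih => obtain ⟨r, c, r', c', i, j, F⟩ := flipStep_FG hs; exact ih (F.flip_vi hab hp)
end PipeDream


namespace PipeDream
variable {n : ℕ} {P Q : PipeDream n} {ω π τ : Equiv.Perm (Fin n)}

theorem Arc.lt {u v : ℕ} (h : P.Arc u v) : u < n ∧ v < n ∧ u ≠ v := by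
  obtain ⟨r, c, h1, h2, h3, h4⟩ := h
  have e1 := (edge_w (P := P) (r := r) (c := c) (by omega)).bound
  have e2 := (edge_s (P := P) (r := r) (c := c) (by omega)).bound
  have := west_ne_south (P := P) h1
  rw [h3, h4] at this
  rw [h3] at e1
  rw [h4] at e2
  exact ⟨e1.2, e2.2, this⟩

theorem linExt_iff : P.LinExt π ↔ ∀ u v, P.Arc u v → xc π u < xc π v := by
  constructor
  · intro h u v ha
    have hl := ha.lt
    have := h ⟨u, hl.1⟩ ⟨v, hl.2.1⟩ ha
    simpa [xc, hl.1, hl.2.1] using this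
  · intro h i j ha
    have := h _ _ ha
    simpa [xc] using this

theorem weakLE_iff : WeakLE π τ ↔ ∀ u v, u < v → v < n → xc π v < xc π u → xc τ v < xc τ u := by
  constructor
  · intro h u v huv hv h1
    have hu : u < n := by omega
    have := h ⟨u, hu⟩ ⟨v, hv⟩ huv (by simpa [xc, hu, hv] using h1)
    simpa [xc, hu, hv] using this
  · intro h i j hij h1
    have := h i.val j.val hij j.2 (by simpa [xc] using h1)
    simpa [xc] using this

theorem linExt_path (h : P.LinExt π) {u v : ℕ} (hp : P.Path u v) : u = v ∨ xc π u < xc π v := by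
  rw [linExt_iff] at h
  induction hp with
  | refl => exact .inl rfl
  | tail _ h1 ih =>
    right
    have := h _ _ h1
    rcases ih with rfl | ih
    · exact this
    · omega

theorem linExt_acyclic (h : P.LinExt π) : P.Acyclic := by
  intro i hi
  obtain ⟨k, h1, h2⟩ := Relation.TransGen.head'_iff.1 hi
  have a := linExt_iff.1 h _ _ h1
  rcases linExt_path h h2 with rfl | b <;> omega

/-- `π` with the values `i` and `j` exchanged -/
def sw (π : Equiv.Perm (Fin n)) (i j : Fin n) : Equiv.Perm (Fin n) := Equiv.swap i j * π

theorem xc_sw {i j k : ℕ} (hi : i < n) (hj : j < n) (hk : k < n) :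
    xc (sw π ⟨i, hi⟩ ⟨j, hj⟩) k = xc π (Equiv.swap i j k) := by
  unfold sw xc
  rcases FG.swap_cases i j k with ⟨h, e⟩ | ⟨h, e⟩ | ⟨h, h', e⟩
  · rw [e]; subst h; simp [hk, hj]
  · rw [e]; subst h; simp [hk, hi]
  · rw [e]; simp only [hk, dif_pos, mul_inv_rev, Equiv.swap_inv, Equiv.Perm.mul_apply]
    rw [Equiv.swap_apply_of_ne_of_ne] <;> simpa using by assumption

/-- Contacts happen before crossings. -/
theorem contact_before (hR : P.Reduced) (hE : P.HasExitPerm ω) {r c r' c' i j : ℕ}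
    (hB : r + c + 2 ≤ n)
    (xB : P.cross r c = false) (wB : P.west r c = i) (sB : P.south r c = j)
    (xB' : P.cross r' c' = true) (wB' : P.west r' c' = i) (sB' : P.south r' c' = j) :
    c + r' < c' + r := by
  have hs := P.inShape _ _ xB'
  have hlt := cross_lt hR hE xB' wB' sB'
  have ei : P.Edge i r c 0 := Or.inl ⟨rfl, by omega, wB⟩
  have ej : P.Edge j r c 1 := Or.inr ⟨rfl, by omega, sB⟩
  have ei' : P.Edge i r' c' 0 := Or.inl ⟨rfl, by omega, wB'⟩
  have ej' : P.Edge j r' c' 1 := Or.inr ⟨rfl, by omega, sB'⟩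
  by_contra hcon
  rcases lt_or_eq_of_le (not_lt.1 hcon) with ht | ht
  · have ei2 : P.Edge i r' (c'+1) 0 := Or.inl ⟨rfl, by omega, by rw [west_succ_cross xB', wB']⟩
    have hn : P.north r' c' = j := by rw [north_cross xB', sB']
    rcases r' with _ | r'
    · have := xc_north hE (c := c') (by omega)
      rw [hn] at this
      have := ej.exit_ge hE
      omega
    · have ej2 : P.Edge j r' c' 1 := Or.inr ⟨rfl, by omega, by rw [south_eq P (by omega), hn]⟩
      have ha : P.Above j i ((c':ℤ) - r') :=
        ⟨r', c', 1, r'+1, c'+1, 0, ej2, ei2, rfl, by push_cast; ring, by omega⟩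
      have hb := above_box (P := P) hB
      rw [wB, sB] at hb
      obtain ⟨r0, c0, x1, x2, x3, -⟩ := planarity ha hb (by omega)
      have := cross_lt hR hE x1 x2 x3
      omega
  · have := ei.uniq ei' (by omega)
    obtain ⟨rfl, rfl, -⟩ := this
    simp [xB] at xB'

def crossSet (P : PipeDream n) : Finset (ℕ × ℕ) :=
  (Finset.range n ×ˢ Finset.range n).filter (fun b => P.cross b.1 b.2 = true)

theorem mem_crossSet {b : ℕ × ℕ} : b ∈ P.crossSet ↔ P.cross b.1 b.2 = true := by
  unfold crossSet
  simp only [Finset.mem_filter, Finset.mem_product, Finset.mem_range, and_iff_right_iff_imp]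
  intro h
  have := P.inShape _ _ h
  omega

def invSet (ω : Equiv.Perm (Fin n)) : Finset (ℕ × ℕ) :=
  (Finset.range n ×ˢ Finset.range n).filter (fun b => b.1 < b.2 ∧ xc ω b.2 < xc ω b.1)

theorem mem_invSet {b : ℕ × ℕ} : b ∈ invSet ω ↔ b.1 < b.2 ∧ b.2 < n ∧ xc ω b.2 < xc ω b.1 := by
  unfold invSet
  simp only [Finset.mem_filter, Finset.mem_product, Finset.mem_range]
  constructor <;> intro h <;> (refine ⟨?_, ?_, ?_⟩ <;> omega)

def lab (P : PipeDream n) (b : ℕ × ℕ) : ℕ × ℕ := (P.west b.1 b.2, P.south b.1 b.2)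

theorem inv_sub (hE : P.HasExitPerm ω) : invSet ω ⊆ P.crossSet.image P.lab := by
  intro b hb
  rw [mem_invSet] at hb
  obtain ⟨r, c, h1, h2, h3⟩ := inv_cross hE hb.1 hb.2.1 hb.2.2
  exact Finset.mem_image.2 ⟨(r, c), mem_crossSet.2 h1, Prod.ext h2 h3⟩

theorem card_cross (hR : P.Reduced) (hE : P.HasExitPerm ω) :
    P.crossSet.card = (invSet ω).card := by
  have h1 : P.crossSet.image P.lab = invSet ω := by
    apply Finset.Subset.antisymm _ (inv_sub hE)
    intro b hb
    obtain ⟨⟨r, c⟩, h1, rfl⟩ := Finset.mem_image.1 hb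
    rw [mem_crossSet] at h1
    have hs := P.inShape _ _ h1
    have := cross_lt hR hE h1 rfl rfl
    have e := (edge_s (P := P) hs).bound
    exact mem_invSet.2 ⟨this.1, e.2, this.2⟩
  rw [← h1, Finset.card_image_of_injOn]
  rintro ⟨r, c⟩ h1 ⟨r', c'⟩ h2 h3
  rw [Finset.mem_coe, mem_crossSet] at h1 h2
  by_contra hne
  simp only [lab, Prod.mk.injEq] at h3
  exact hR r c r' c' h1 h2 hne (.inl h3)

theorem reduced_of_card (hE : P.HasExitPerm ω) (hc : P.crossSet.card = (invSet ω).card) :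
    P.Reduced := by
  have h0 := inv_sub hE
  have h1 : (P.crossSet.image P.lab).card ≤ P.crossSet.card := Finset.card_image_le
  have h2 := Finset.eq_of_subset_of_card_le h0 (by omega)
  have h3 : Set.InjOn P.lab P.crossSet := Finset.injOn_of_card_image_eq (by
    rw [← h2]; exact hc.symm)
  have key : ∀ r c, P.cross r c = true → P.west r c < P.south r c := by
    intro r c hx
    have : P.lab (r, c) ∈ invSet ω := by
      rw [h2]; exact Finset.mem_image.2 ⟨(r, c), mem_crossSet.2 hx, rfl⟩
    exact (mem_invSet.1 this).1
  intro r c r' c' hx hx' hne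
  rintro (h | h)
  · exact hne (h3 (mem_crossSet.2 hx) (mem_crossSet.2 hx') (Prod.ext h.1 h.2))
  · have := key _ _ hx
    have := key _ _ hx'
    omega

namespace FD
variable {r c r' c' i j : ℕ}

theorem hRQ (F : FD ω P Q r c r' c' i j) : Q.Reduced := by
  apply reduced_of_card F.hEQ
  rw [← card_cross F.hR F.hE]
  have hr := F.hr
  have h : Q.crossSet = insert (r, c) (P.crossSet.erase (r', c')) := by
    ext ⟨r0, c0⟩
    rw [Finset.mem_insert, Finset.mem_erase, mem_crossSet, mem_crossSet]
    by_cases h1 : (r0, c0) = (r, c)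
    · simp only [Prod.mk.injEq] at h1
      obtain ⟨rfl, rfl⟩ := h1
      simp [F.qB]
    by_cases h2 : (r0, c0) = (r', c')
    · have h3 := h1
      simp only [Prod.mk.injEq] at h2
      obtain ⟨rfl, rfl⟩ := h2
      simp only [F.qB', h3, ne_eq, not_true]
      simp
    · have := F.qo r0 c0 h1 h2
      simp only [this, h1, h2, ne_eq]
      simp
  have hm : (r', c') ∈ P.crossSet := mem_crossSet.2 F.xB'
  have hn : (r, c) ∉ P.crossSet.erase (r', c') := by
    intro h
    have := mem_crossSet.1 (Finset.mem_erase.1 h).2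
    simp [F.xB] at this
  rw [h, Finset.card_insert_of_notMem hn, Finset.card_erase_add_one hm]

theorem contactQ' (F : FD ω P Q r c r' c' i j) {u v rD cD : ℕ} (hv : rD + cD + 2 ≤ n)
    (hx : Q.cross rD cD = false) (hu : Q.west rD cD = u) (hs : Q.south rD cD = v) :
    (u = j ∧ v = i ∧ rD = r' ∧ cD = c') ∨
    (inR r c r' c' rD cD ∧ P.cross rD cD = false ∧ P.west rD cD = Equiv.swap i j u ∧
      P.south rD cD = Equiv.swap i j v) ∨
    (¬ inR r c r' c' rD cD ∧ ¬ (rD = r ∧ cD = c) ∧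
      P.cross rD cD = false ∧ P.west rD cD = u ∧ P.south rD cD = v) := by
  have := F.hr
  have := F.hc
  by_cases h1 : rD = r' ∧ cD = c'
  · obtain ⟨rfl, rfl⟩ := h1
    left
    have hi : inR r c rD cD rD cD := by unfold inR; omega
    rw [F.flw (by omega) hi, F.wB', Equiv.swap_apply_left] at hu
    rw [F.fls (by omega) hi, F.sB', Equiv.swap_apply_right] at hs
    exact ⟨hu.symm, hs.symm, rfl, rfl⟩
  · have h2 : ¬ (rD = r ∧ cD = c) := by
      rintro ⟨rfl, rfl⟩
      simp [F.qB] at hx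
    have hx' := F.qo rD cD (by simpa using h2) (by simpa using h1)
    right
    by_cases hi : inR r c r' c' rD cD
    · left
      rw [F.flw (by omega) hi] at hu
      rw [F.fls (by omega) hi] at hs
      refine ⟨hi, hx'.trans hx, ?_, ?_⟩
      · rw [← hu, Equiv.swap_apply_self]
      · rw [← hs, Equiv.swap_apply_self]
    · right
      rw [F.flw' (by omega) hi] at hu
      rw [F.fls' (by omega) hi] at hs
      exact ⟨hi, h2, hx'.trans hx, hu, hs⟩

theorem incFlip (F : FD ω P Q r c r' c' i j) : IncFlip P Q := by
  have := F.hr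
  have := F.hc
  refine ⟨(r, c), (r', c'), ⟨?_, F.xB, F.xB', F.qB, F.qB', F.qo, .inl ⟨?_, ?_⟩⟩, ?_, ?_⟩
  · simp only [ne_eq, Prod.mk.injEq]; omega
  · simp only [F.wB, F.wB']
  · simp only [F.sB, F.sB']
  · simp only; omega
  · simp only; omega
end FD

/-- adjacent swap of positions preserves the order of all other pairs -/
theorem adj_swap {i j u v : ℕ} (hi : i < n) (hj : j < n) (hu : u < n) (hv : v < n)
    (adj : xc π j = xc π i + 1) (h : xc π u < xc π v) (hne : ¬ (u = i ∧ v = j)) :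
    xc π (Equiv.swap i j u) < xc π (Equiv.swap i j v) := by
  have g1 : ∀ w, w < n → w ≠ j → xc π w ≠ xc π j := fun w hw hn e => hn (xc_inj hw hj e)
  have g2 : ∀ w, w < n → w ≠ i → xc π w ≠ xc π i := fun w hw hn e => hn (xc_inj hw hi e)
  have hV := FG.swap_cases i j v
  rcases FG.swap_cases i j u with ⟨rfl, e⟩ | ⟨rfl, e⟩ | ⟨a, b, e⟩ <;>
  rcases hV with ⟨rfl, e'⟩ | ⟨rfl, e'⟩ | ⟨a', b', e'⟩ <;>
  rw [e] <;> try rw [e']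
  · omega
  · exact (hne ⟨rfl, rfl⟩).elim
  · have := g1 v hv b'; omega
  · omega
  · omega
  · have := g1 v hv b'; omega
  · have := g2 u hu a; omega
  · have := g2 u hu a; omega
  · exact h

/-- Moving up in the weak order by an adjacent transposition. -/
theorem flip_up (hP : GoodPD ω P) (hL : P.LinExt π) {i j : ℕ} (hi : i < n) (hj : j < n)
    (hij : i < j) (adj : xc π j = xc π i + 1) (hX : xc ω j < xc ω i) :
    P.LinExt (sw π ⟨i, hi⟩ ⟨j, hj⟩) ∨
    ∃ Q r c r' c', FD ω P Q r c r' c' i j ∧ GoodPD ω Q ∧ Q.LinExt (sw π ⟨i, hi⟩ ⟨j, hj⟩) := by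
  obtain ⟨hR, hE, hA⟩ := hP
  have hL' := linExt_iff.1 hL
  by_cases ha : P.Arc i j
  · right
    classical
    obtain ⟨m, ⟨r, c, hB, xB, wB, sB, hm⟩, hmin⟩ : ∃ m, (∃ r c, r + c + 2 ≤ n ∧ P.cross r c = false ∧
        P.west r c = i ∧ P.south r c = j ∧ m + r = c + n) ∧
        ∀ m', m' < m → ¬ (∃ r c, r + c + 2 ≤ n ∧ P.cross r c = false ∧
        P.west r c = i ∧ P.south r c = j ∧ m' + r = c + n) := by
      have hex : ∃ m, (∃ r c, r + c + 2 ≤ n ∧ P.cross r c = false ∧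
        P.west r c = i ∧ P.south r c = j ∧ m + r = c + n) := by
        obtain ⟨r, c, h1, h2, h3, h4⟩ := ha
        exact ⟨c + n - r, r, c, h1, h2, h3, h4, by omega⟩
      exact ⟨Nat.find hex, Nat.find_spec hex, fun m' h => Nat.find_min hex h⟩
    obtain ⟨r', c', xB', wB', sB'⟩ := inv_cross hE hij hj hX
    have hs' := P.inShape _ _ xB'
    have ht := contact_before hR hE hB xB wB sB xB' wB' sB'
    obtain ⟨hr, hc⟩ := contact_cross_strict hE hB xB wB sB xB' wB' sB' ht
    let Q : PipeDream n := 
      { cross := fun r0 c0 => if r0 = r ∧ c0 = c then true else if r0 = r' ∧ c0 = c' then false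
          else P.cross r0 c0
        inShape := by
          intro r0 c0 h
          split_ifs at h with h1 h2
          · omega
          · exact P.inShape _ _ h }
    have F : FD ω P Q r c r' c' i j := by
      refine ⟨hR, hE, hB, xB, wB, sB, xB', wB', sB', hij, hX, hr, hc, ?_, ?_, ?_⟩
      · simp [Q]
      · have : ¬ (r' = r ∧ c' = c) := by omega
        simp [Q, this]
      · intro r0 c0 h1 h2
        simp only [ne_eq, Prod.mk.injEq] at h1 h2
        simp [Q, h1, h2]
    have hLQ : Q.LinExt (sw π ⟨i, hi⟩ ⟨j, hj⟩) := by
      rw [linExt_iff]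
      rintro u v ⟨rD, cD, hD, xD, wD, sD⟩
      have hl := Arc.lt (P := Q) ⟨rD, cD, hD, xD, wD, sD⟩
      rw [xc_sw hi hj hl.1, xc_sw hi hj hl.2.1]
      rcases F.contactQ' hD xD wD sD with ⟨rfl, rfl, -⟩ | ⟨h1, h2, h3, h4⟩ | ⟨h1, h2, h3, h4, h5⟩
      · rw [Equiv.swap_apply_left, Equiv.swap_apply_right]; omega
      · exact hL' _ _ ⟨rD, cD, hD, h2, h3, h4⟩
      · apply adj_swap hi hj hl.1 hl.2.1 adj (hL' _ _ ⟨rD, cD, hD, h3, h4, h5⟩)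
        rintro ⟨rfl, rfl⟩
        have hb := contact_before hR hE hD h3 h4 h5 xB' wB' sB'
        have hmm : ¬ (cD + n - rD < m) := fun h => hmin _ h ⟨rD, cD, hD, h3, h4, h5, by omega⟩
        obtain ⟨e1, -, e3, -⟩ := F.edges
        have eD : P.Edge u rD cD 0 := Or.inl ⟨rfl, by omega, h4⟩
        have m1 := e1.mono eD (by omega)
        have m2 := eD.mono e3 (by omega)
        unfold FD.inR at h1
        omega
    exact ⟨Q, r, c, r', c', F, ⟨F.hRQ, F.hEQ, linExt_acyclic hLQ⟩, hLQ⟩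
  · left
    rw [linExt_iff]
    intro u v huv
    have hl := huv.lt
    rw [xc_sw hi hj hl.1, xc_sw hi hj hl.2.1]
    apply adj_swap hi hj hl.1 hl.2.1 adj (hL' _ _ huv)
    rintro ⟨rfl, rfl⟩
    exact ha huv

end PipeDream


namespace PipeDream
variable {n : ℕ} {P Q : PipeDream n} {ω π τ : Equiv.Perm (Fin n)}

theorem linExt_le_omega (hP : GoodPD ω P) (hL : P.LinExt π) {u v : ℕ} (huv : u < v) (hv : v < n)
    (h : xc π v < xc π u) : xc ω v < xc ω u := by
  by_contra hcon
  rcases lt_or_eq_of_le (not_lt.1 hcon) with hx | hx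
  · have := linExt_path hL (lemF3 hP.1 hP.2.1 huv hv hx)
    omega
  · have := xc_inj (by omega) hv hx
    omega

theorem xc_apply (p : Fin n) : xc π (π p).val = p.val := by
  simp [xc]

theorem weak_step (h : WeakLE π τ) (hne : π ≠ τ) : ∃ i j, i < j ∧ j < n ∧ xc π j = xc π i + 1 ∧
    xc τ j < xc τ i := by
  by_contra hcon
  push Not at hcon
  rw [weakLE_iff] at h
  apply hne
  have h1 : ∀ p q : Fin n, q.val = p.val + 1 → xc τ (π p).val < xc τ (π q).val := by
    intro p q hpq
    have hp := xc_apply (π := π) p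
    have hq := xc_apply (π := π) q
    rcases lt_trichotomy (π p).val (π q).val with hlt | heq | hgt
    · have h2 := hcon _ _ hlt (π q).2 (by omega)
      rcases lt_or_eq_of_le h2 with h3 | h3
      · exact h3
      · have := xc_inj (π p).2 (π q).2 h3; omega
    · rw [heq] at hp; omega
    · exact h _ _ hgt (π p).2 (by omega)
  have h2 : ∀ d : ℕ, ∀ p q : Fin n, q.val = p.val + 1 + d → xc τ (π p).val < xc τ (π q).val := by
    intro d
    induction d with
    | zero => intro p q hpq; exact h1 p q hpq
    | succ d ih =>
      intro p q hpq
      have hq := q.2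
      have a := ih p ⟨p.val + 1 + d, by omega⟩ rfl
      have b := h1 ⟨p.val + 1 + d, by omega⟩ q (by simp only; omega)
      omega
  have h3 : StrictMono (fun p => τ⁻¹ (π p)) := by
    intro p q hpq
    have := h2 (q.val - p.val - 1) p q (by have : p.val < q.val := hpq; omega)
    simpa [xc] using this
  have h4 : ∀ p, τ⁻¹ (π p) = p := by
    intro p
    exact le_antisymm h3.apply_le h3.le_apply
  ext p
  have := h4 p
  rw [Equiv.Perm.inv_eq_iff_eq] at this
  rw [this]

theorem sw_le {i j : ℕ} (hi : i < n) (hj : j < n) (adj : xc π j = xc π i + 1)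
    (h : WeakLE π τ) (hx : xc τ j < xc τ i) : WeakLE (sw π ⟨i, hi⟩ ⟨j, hj⟩) τ := by
  rw [weakLE_iff] at h ⊢
  intro u v huv hv h1
  rw [xc_sw hi hj hv, xc_sw hi hj (show u < n by omega)] at h1
  have sl : ∀ x, x < n → Equiv.swap i j x < n := by
    intro x hx
    rcases FG.swap_cases i j x with ⟨_, e⟩ | ⟨_, e⟩ | ⟨_, _, e⟩ <;> omega
  by_cases hc : Equiv.swap i j v = i ∧ Equiv.swap i j u = j
  · rw [Equiv.swap_apply_eq_iff, Equiv.swap_apply_eq_iff, Equiv.swap_apply_left,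
      Equiv.swap_apply_right] at hc
    obtain ⟨rfl, rfl⟩ := hc
    exact hx
  · have := adj_swap hi hj (sl v hv) (sl u (by omega)) adj h1 hc
    rw [Equiv.swap_apply_self, Equiv.swap_apply_self] at this
    exact h _ _ huv hv this

theorem sw_measure {i j : ℕ} (hi : i < n) (hj : j < n) (hij : i < j) (adj : xc π j = xc π i + 1)
    (hx : xc τ j < xc τ i) : (invSet τ \ invSet (sw π ⟨i, hi⟩ ⟨j, hj⟩)).card <
      (invSet τ \ invSet π).card := by
  apply Finset.card_lt_card
  rw [Finset.ssubset_iff_of_subset]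
  · refine ⟨(i, j), ?_, ?_⟩
    · rw [Finset.mem_sdiff, mem_invSet, mem_invSet]
      simp only
      omega
    · rw [Finset.mem_sdiff, mem_invSet, mem_invSet]
      simp only
      rw [xc_sw hi hj hi, xc_sw hi hj hj, Equiv.swap_apply_left, Equiv.swap_apply_right]
      omega
  · rintro ⟨u, v⟩ h
    rw [Finset.mem_sdiff] at h ⊢
    refine ⟨h.1, fun hc => h.2 ?_⟩
    rw [mem_invSet] at hc ⊢
    simp only at hc ⊢
    refine ⟨hc.1, hc.2.1, ?_⟩
    rw [xc_sw hi hj hc.2.1, xc_sw hi hj (show u < n by omega)]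
    refine adj_swap hi hj hc.2.1 (by omega) adj hc.2.2 ?_
    rintro ⟨rfl, rfl⟩
    omega

theorem FD.labB {r c r' c' i j : ℕ} (F : FD ω P Q r c r' c' i j) :
    Q.west r c = i ∧ Q.south r c = j := by
  have := F.hB
  have hn : ¬ inR r c r' c' r c := by unfold inR; omega
  rw [F.flw' (by omega) hn, F.fls' (by omega) hn]
  exact ⟨F.wB, F.sB⟩

theorem FD.labB' {r c r' c' i j : ℕ} (F : FD ω P Q r c r' c' i j) :
    Q.west r' c' = j ∧ Q.south r' c' = i := by
  have := F.hr; have := F.hc; have := P.inShape _ _ F.xB'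
  have hi : inR r c r' c' r' c' := by unfold inR; omega
  rw [F.flw (by omega) hi, F.fls (by omega) hi, F.wB', F.sB', Equiv.swap_apply_left,
    Equiv.swap_apply_right]
  exact ⟨rfl, rfl⟩

theorem FD.arcQ' {r c r' c' i j : ℕ} (F : FD ω P Q r c r' c' i j) : Q.Arc j i :=
  ⟨r', c', P.inShape _ _ F.xB', F.qB', F.labB'.1, F.labB'.2⟩

theorem FD.late {r c r' c' i j r1 c1 : ℕ} (F : FD ω P Q r c r' c' i j) (hv : r1 + c1 + 2 ≤ n)
    (hx : Q.cross r1 c1 = false) (hw : Q.west r1 c1 = j) (hs : Q.south r1 c1 = i)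
    (ht : c' + r1 < c1 + r') : P.Arc j i := by
  rcases F.contactQ' hv hx hw hs with ⟨-, -, rfl, rfl⟩ | ⟨h1, -⟩ | ⟨h1, h2, h3, h4, h5⟩
  · omega
  · unfold inR at h1; omega
  · exact ⟨r1, c1, hv, h3, h4, h5⟩

theorem ext_cross (h : ∀ r c, P.cross r c = Q.cross r c) : P = Q := by
  cases P; cases Q
  simp only [PipeDream.mk.injEq]
  funext r c
  exact h r c

theorem uniq_base (hP : GoodPD ω P) (hQ : GoodPD ω Q) (hL : P.LinExt ω) (hL' : Q.LinExt ω) :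
    P = Q := by
  have key : ∀ {R : PipeDream n}, GoodPD ω R → R.LinExt ω → ∀ r c, r + c + 2 ≤ n →
      (R.cross r c = true ↔ xc ω (R.south r c) < xc ω (R.west r c)) := by
    intro R hR hL r c hv
    constructor
    · intro hx; exact (cross_lt hR.1 hR.2.1 hx rfl rfl).2
    · intro hx
      by_contra hc
      rw [Bool.not_eq_true] at hc
      have := linExt_iff.1 hL _ _ ⟨r, c, hv, hc, rfl, rfl⟩
      omega
  have cr : ∀ r c, (r + c + 2 ≤ n → P.west r c = Q.west r c ∧ P.south r c = Q.south r c) →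
      P.cross r c = Q.cross r c := by
    intro r c h
    by_cases hv : r + c + 2 ≤ n
    · rw [Bool.eq_iff_iff, key hP hL _ _ hv, key hQ hL' _ _ hv, (h hv).1, (h hv).2]
    · have h1 : P.cross r c = false := by
        by_contra hc
        exact hv (P.inShape _ _ (by simpa using hc))
      have h2 : Q.cross r c = false := by
        by_contra hc
        exact hv (Q.inShape _ _ (by simpa using hc))
      rw [h1, h2]
  have lab : ∀ m r c, n - r + c = m → r + c + 1 ≤ n → P.west r c = Q.west r c ∧
      (r + c + 2 ≤ n → P.south r c = Q.south r c) := by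
    intro m
    induction m using Nat.strong_induction_on with
    | _ m ih =>
      intro r c hm hv
      constructor
      · rcases c with _ | c
        · rw [west_zero, west_zero]
        · obtain ⟨a, b⟩ := ih (n - r + c) (by omega) r c rfl (by omega)
          have e := cr r c (fun h => ⟨a, b h⟩)
          rw [west_succ, west_succ, e, a, b (by omega)]
      · intro h
        obtain ⟨a, b⟩ := ih (n - (r+1) + c) (by omega) (r+1) c rfl (by omega)
        have e := cr (r+1) c (fun h => ⟨a, b h⟩)
        rw [south_eq P h, south_eq Q h]
        unfold PipeDream.north
        rw [e]
        split_ifs with hx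
        · exact b (Q.inShape _ _ hx)
        · exact a
  apply ext_cross
  intro r c
  apply cr
  intro h
  have := lab _ r c rfl (by omega)
  exact ⟨this.1, this.2 h⟩

theorem linExt_weak (hP : GoodPD ω P) (hL : P.LinExt π) : WeakLE π ω := by
  rw [weakLE_iff]
  intro u v huv hv h
  exact linExt_le_omega hP hL huv hv h

theorem uniq_linExt (hP : GoodPD ω P) (hQ : GoodPD ω Q) (hL : P.LinExt π) (hL' : Q.LinExt π) :
    P = Q := by
  induction hm : (invSet ω \ invSet π).card using Nat.strong_induction_on generalizing P Q π with
  | _ m ih =>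
  by_cases hne : π = ω
  · subst hne; exact uniq_base hP hQ hL hL'
  obtain ⟨i, j, hij, hj, adj, hX⟩ := weak_step (linExt_weak hP hL) hne
  have hi : i < n := by omega
  have hm' := sw_measure hi hj hij adj hX
  have noarc : ∀ {R : PipeDream n}, R.LinExt π → R.Arc j i → False := by
    intro R hR ha
    have := linExt_iff.1 hR _ _ ha
    omega
  rcases flip_up hP hL hi hj hij adj hX with h1 | ⟨R, r, c, r', c', F, hR, h1⟩ <;>
  rcases flip_up hQ hL' hi hj hij adj hX with h2 | ⟨R1, s, b, s', b', F1, hR1, h2⟩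
  · exact ih _ (by omega) hP hQ h1 h2 rfl
  · have e := ih _ (by omega) hP hR1 h1 h2 rfl
    subst e
    exact (noarc hL F1.arcQ').elim
  · have e := ih _ (by omega) hQ hR h2 h1 rfl
    subst e
    exact (noarc hL' F.arcQ').elim
  · have e := ih _ (by omega) hR hR1 h1 h2 rfl
    subst e
    have eB : (r, c) = (s, b) := by
      by_contra hcon
      exact hR.1 r c s b F.qB F1.qB hcon (.inl ⟨by rw [F.labB.1, F1.labB.1],
        by rw [F.labB.2, F1.labB.2]⟩)
    have v1 := P.inShape _ _ F.xB'
    have v2 := Q.inShape _ _ F1.xB'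
    have eB' : r' = s' ∧ c' = b' := by
      rcases lt_trichotomy (c' + s') (b' + r') with h | h | h
      · exact (noarc hL (F.late v2 F1.qB' F1.labB'.1 F1.labB'.2 h)).elim
      · have e1 : R.Edge j r' c' 0 := Or.inl ⟨rfl, by omega, F.labB'.1⟩
        have e2 : R.Edge j s' b' 0 := Or.inl ⟨rfl, by omega, F1.labB'.1⟩
        have := e1.uniq e2 h
        exact ⟨this.1, this.2.1⟩
      · exact (noarc hL' (F1.late v1 F.qB' F.labB'.1 F.labB'.2 h)).elim
    simp only [Prod.mk.injEq] at eB
    obtain ⟨rfl, rfl⟩ := eB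
    obtain ⟨rfl, rfl⟩ := eB'
    apply ext_cross
    intro r0 c0
    by_cases g1 : (r0, c0) = (r, c)
    · simp only [Prod.mk.injEq] at g1
      obtain ⟨rfl, rfl⟩ := g1
      rw [F.xB, F1.xB]
    by_cases g2 : (r0, c0) = (r', c')
    · simp only [Prod.mk.injEq] at g2
      obtain ⟨rfl, rfl⟩ := g2
      rw [F.xB', F1.xB']
    rw [F.qo _ _ g1 g2, F1.qo _ _ g1 g2]

theorem reach_of_weak (hP : GoodPD ω P) (hQ : GoodPD ω Q) (hL : P.LinExt π) (hL' : Q.LinExt τ)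
    (hw : WeakLE π τ) : Relation.ReflTransGen (FlipStep ω) P Q := by
  induction hm : (invSet τ \ invSet π).card using Nat.strong_induction_on generalizing P π with
  | _ m ih =>
  by_cases hne : π = τ
  · subst hne
    rw [uniq_linExt hP hQ hL hL']
  obtain ⟨i, j, hij, hj, adj, hx⟩ := weak_step hw hne
  have hi : i < n := by omega
  have hm' := sw_measure hi hj hij adj hx
  have hw' := sw_le hi hj adj hw hx
  have hX := linExt_le_omega hQ hL' hij hj hx
  rcases flip_up hP hL hi hj hij adj hX with h1 | ⟨R, r, c, r', c', F, hR, h1⟩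
  · exact ih _ (by omega) hP h1 hw' rfl
  · exact Relation.ReflTransGen.head ⟨hP, hR, F.incFlip⟩ (ih _ (by omega) hR h1 hw' rfl)

theorem exists_perm (R : Fin n → Fin n → Prop) (irr : ∀ x, ¬ R x x)
    (tr : ∀ x y z, R x y → R y z → R x z) (tot : ∀ x y, x ≠ y → R x y ∨ R y x) :
    ∃ σ : Equiv.Perm (Fin n), ∀ x y, R x y ↔ σ⁻¹ x < σ⁻¹ y := by
  classical
  let f : Fin n → Fin n := fun x => ⟨(Finset.univ.filter (fun y => R y x)).card, by
    have h1 : (Finset.univ.filter (fun y => R y x)) ⊂ Finset.univ := by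
      rw [Finset.ssubset_iff_of_subset (Finset.subset_univ _)]
      exact ⟨x, Finset.mem_univ _, by simp [irr]⟩
    simpa using Finset.card_lt_card h1⟩
  have hf : ∀ x y, R x y → f x < f y := by
    intro x y h
    change (Finset.univ.filter (fun z => R z x)).card < (Finset.univ.filter (fun z => R z y)).card
    apply Finset.card_lt_card
    rw [Finset.ssubset_iff_of_subset]
    · exact ⟨x, by simp [h], by simp [irr]⟩
    · intro z hz
      simp only [Finset.mem_filter, Finset.mem_univ, true_and] at hz ⊢
      exact tr _ _ _ hz h
  have hinj : Function.Injective f := by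
    intro x y h
    by_contra hne
    rcases tot x y hne with h1 | h1
    · exact absurd (hf _ _ h1) (by rw [h]; exact lt_irrefl _)
    · exact absurd (hf _ _ h1) (by rw [h]; exact lt_irrefl _)
  let e : Equiv.Perm (Fin n) := Equiv.ofBijective f (Finite.injective_iff_bijective.1 hinj)
  refine ⟨e⁻¹, fun x y => ?_⟩
  rw [inv_inv]
  constructor
  · exact hf x y
  · intro h
    have h' : f x < f y := h
    by_contra hc
    by_cases hxy : x = y
    · subst hxy; exact lt_irrefl _ h'
    · rcases tot x y hxy with h1 | h1
      · exact hc h1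
      · exact lt_asymm h' (hf _ _ h1)

theorem exists_min (hP : GoodPD ω P) : ∃ σ : Equiv.Perm (Fin n), P.LinExt σ ∧
    (∀ i j : Fin n, i < j → (σ⁻¹ j < σ⁻¹ i ↔ P.Path j.val i.val)) := by
  obtain ⟨hR, hE, hA⟩ := hP
  obtain ⟨σ, hσ⟩ := exists_perm (n := n) (fun x y => (x.val < y.val ∧ ¬ P.Path y x) ∨
    (y.val < x.val ∧ P.Path x y)) (by intro x; simp) (by
      intro x y z h1 h2
      have t : ∀ {a b c : ℕ}, P.Path a b → P.Path b c → P.Path a c := fun h h' => h.trans h'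
      have w : ∀ {u v : ℕ} (b : ℕ), P.Path u v → (u < b ∧ b < v) ∨ (v < b ∧ b < u) →
        P.Path u b ∨ P.Path b v := fun b h hb => woip hR hE h hb
      rcases h1 with ⟨a1, a2⟩ | ⟨a1, a2⟩ <;> rcases h2 with ⟨b1, b2⟩ | ⟨b1, b2⟩
      · left
        refine ⟨by omega, fun h => ?_⟩
        rcases w y.val h (by omega) with h | h
        · exact b2 h
        · exact a2 h
      · rcases lt_trichotomy x.val z.val with h | h | h
        · exact .inl ⟨h, fun hh => a2 (t b2 hh)⟩
        · rw [← h] at b2; exact (a2 b2).elim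
        · rcases w x.val b2 (by omega) with hh | hh
          · exact (a2 hh).elim
          · exact .inr ⟨h, hh⟩
      · rcases lt_trichotomy x.val z.val with h | h | h
        · exact .inl ⟨h, fun hh => b2 (t hh a2)⟩
        · rw [← h] at b2; exact (b2 a2).elim
        · rcases w z.val a2 (by omega) with hh | hh
          · exact .inr ⟨h, hh⟩
          · exact (b2 hh).elim
      · exact .inr ⟨by omega, t a2 b2⟩) (by
      intro x y hne
      have hne' : x.val ≠ y.val := fun h => hne (Fin.ext h)
      rcases lt_or_gt_of_ne hne' with h | h
      · by_cases hp : P.Path y x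
        · exact .inr (.inr ⟨h, hp⟩)
        · exact .inl (.inl ⟨h, hp⟩)
      · by_cases hp : P.Path x y
        · exact .inl (.inr ⟨h, hp⟩)
        · exact .inr (.inl ⟨h, hp⟩))
  refine ⟨σ, ?_, ?_⟩
  · intro i j ha
    rw [← hσ]
    rcases lt_or_gt_of_ne ha.lt.2.2 with h | h
    · exact .inl ⟨h, fun hp => hA.irr ha hp⟩
    · exact .inr ⟨h, .arc ha⟩
  · intro i j hij
    have hij' : i.val < j.val := hij
    rw [← hσ]
    constructor
    · rintro (h | h)
      · omega
      · exact h.2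
    · intro h; exact .inr ⟨hij', h⟩

theorem exists_max (hP : GoodPD ω P) : ∃ σ : Equiv.Perm (Fin n), P.LinExt σ ∧
    (∀ i j : Fin n, i < j → (σ⁻¹ j < σ⁻¹ i ↔ ¬ P.Path i.val j.val)) := by
  obtain ⟨hR, hE, hA⟩ := hP
  obtain ⟨σ, hσ⟩ := exists_perm (n := n) (fun x y => (x.val < y.val ∧ P.Path x y) ∨
    (y.val < x.val ∧ ¬ P.Path y x)) (by intro x; simp) (by
      intro x y z h1 h2
      have t : ∀ {a b c : ℕ}, P.Path a b → P.Path b c → P.Path a c := fun h h' => h.trans h'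
      have w : ∀ {u v : ℕ} (b : ℕ), P.Path u v → (u < b ∧ b < v) ∨ (v < b ∧ b < u) →
        P.Path u b ∨ P.Path b v := fun b h hb => woip hR hE h hb
      rcases h1 with ⟨a1, a2⟩ | ⟨a1, a2⟩ <;> rcases h2 with ⟨b1, b2⟩ | ⟨b1, b2⟩
      · exact .inl ⟨by omega, t a2 b2⟩
      · rcases lt_trichotomy x.val z.val with h | h | h
        · rcases w z.val a2 (by omega) with hh | hh
          · exact .inl ⟨h, hh⟩
          · exact (b2 hh).elim
        · rw [← h] at b2; exact (b2 a2).elim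
        · exact .inr ⟨h, fun hh => b2 (t hh a2)⟩
      · rcases lt_trichotomy x.val z.val with h | h | h
        · rcases w x.val b2 (by omega) with hh | hh
          · exact (a2 hh).elim
          · exact .inl ⟨h, hh⟩
        · rw [← h] at b2; exact (a2 b2).elim
        · exact .inr ⟨h, fun hh => a2 (t b2 hh)⟩
      · right
        refine ⟨by omega, fun h => ?_⟩
        rcases w y.val h (by omega) with h | h
        · exact b2 h
        · exact a2 h) (by
      intro x y hne
      have hne' : x.val ≠ y.val := fun h => hne (Fin.ext h)
      rcases lt_or_gt_of_ne hne' with h | h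
      · by_cases hp : P.Path x y
        · exact .inl (.inl ⟨h, hp⟩)
        · exact .inr (.inr ⟨h, hp⟩)
      · by_cases hp : P.Path y x
        · exact .inr (.inl ⟨h, hp⟩)
        · exact .inl (.inr ⟨h, hp⟩))
  refine ⟨σ, ?_, ?_⟩
  · intro i j ha
    rw [← hσ]
    rcases lt_or_gt_of_ne ha.lt.2.2 with h | h
    · exact .inl ⟨h, .arc ha⟩
    · exact .inr ⟨h, fun hp => hA.irr ha hp⟩
  · intro i j hij
    have hij' : i.val < j.val := hij
    rw [← hσ]
    constructor
    · rintro (h | h)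
      · omega
      · exact h.2
    · intro h; exact .inr ⟨hij', h⟩

theorem linExt_path_fin (h : P.LinExt π) {i j : Fin n} (hne : i ≠ j) (hp : P.Path i.val j.val) :
    π⁻¹ i < π⁻¹ j := by
  rcases linExt_path h hp with e | e
  · exact (hne (Fin.ext e)).elim
  · simpa [xc] using e

end PipeDream


/-- For any acyclic pipe dreams `P, P' ∈ Π(ω)`, the following
assertions are equivalent:
(i) `P'` is reachable from `P` by a (possibly empty) sequence of increasing flips
passing only through acyclic pipe dreams of `Π(ω)`;
(ii) there are linear extensions `π` of `P` and `π'` of `P'` with `π ≤ π'`;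
(iii) the minimal linear extensions `m` of `P` and `m'` of `P'` satisfy `m ≤ m'`;
(iv) there is no pair `i < j` with `j ⪯_P i` and `i ⪯_{P'} j`;
(v) for all `i < j`, if `j ⪯_P i` then `j ⪯_{P'} i`;
(vi) for all `i < j`, if `i ⪯_{P'} j` then `i ⪯_P j`. -/
theorem incFlip_reachability_tfae (n : ℕ) (ω : Equiv.Perm (Fin n))
    (P P' : PipeDream n) (hP : GoodPD ω P) (hP' : GoodPD ω P') :
    List.TFAE
      [ Relation.ReflTransGen (FlipStep ω) P P',
        ∃ π π' : Equiv.Perm (Fin n), P.LinExt π ∧ P'.LinExt π' ∧ WeakLE π π',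
        ∀ m m' : Equiv.Perm (Fin n),
          (P.LinExt m ∧ ∀ π, P.LinExt π → WeakLE m π) →
          (P'.LinExt m' ∧ ∀ π, P'.LinExt π → WeakLE m' π) →
          WeakLE m m',
        ¬ ∃ i j : Fin n, i < j ∧ P.Path j.val i.val ∧ P'.Path i.val j.val,
        ∀ i j : Fin n, i < j → P.Path j.val i.val → P'.Path j.val i.val,
        ∀ i j : Fin n, i < j → P'.Path i.val j.val → P.Path i.val j.val ] := by
  have minmin : ∀ {R : PipeDream n}, ∀ {σ : Equiv.Perm (Fin n)},
      (∀ i j : Fin n, i < j → (σ⁻¹ j < σ⁻¹ i ↔ R.Path j.val i.val)) →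
      ∀ π, R.LinExt π → WeakLE σ π := by
    intro R σ hσ π hπ i j hij h
    exact PipeDream.linExt_path_fin hπ hij.ne' ((hσ i j hij).1 h)
  obtain ⟨p, hp1, hp2⟩ := PipeDream.exists_min hP
  obtain ⟨q, hq1, hq2⟩ := PipeDream.exists_min hP'
  obtain ⟨t, ht1, ht2⟩ := PipeDream.exists_max hP'
  tfae_have 1 → 5 := fun h i j hij hp => PipeDream.reach_v h hij hp
  tfae_have 1 → 6 := fun h i j hij hp => PipeDream.reach_vi h hij hp
  tfae_have 5 → 4 := by
    rintro h ⟨i, j, hij, h1, h2⟩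
    exact hij.ne (Fin.ext (hP'.2.2.cyc h2 (h i j hij h1)))
  tfae_have 6 → 4 := by
    rintro h ⟨i, j, hij, h1, h2⟩
    exact hij.ne (Fin.ext (hP.2.2.cyc (h i j hij h2) h1))
  tfae_have 4 → 2 := by
    intro h
    refine ⟨p, t, hp1, ht1, fun i j hij h1 => ?_⟩
    rw [ht2 i j hij]
    intro h2
    exact h ⟨i, j, hij, (hp2 i j hij).1 h1, h2⟩
  tfae_have 2 → 1 := by
    rintro ⟨π, π', h1, h2, h3⟩
    exact PipeDream.reach_of_weak hP hP' h1 h2 h3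
  tfae_have 5 → 3 := by
    rintro h m m' ⟨-, h2⟩ ⟨h3, -⟩ i j hij h1
    have := (hp2 i j hij).1 (h2 p hp1 i j hij h1)
    exact PipeDream.linExt_path_fin h3 hij.ne' (h i j hij this)
  tfae_have 3 → 2 := by
    intro h
    exact ⟨p, q, hp1, hq1, h p q ⟨hp1, minmin hp2⟩ ⟨hq1, minmin hq2⟩⟩
  tfae_finish
end

section
/- Let SC(Q,ω) be a non-empty subword complex for a finite Coxeter system (W,S) with root system Φ. Then: (1) for every facet I of SC(Q,ω), the set L(I) of linear extensions of I is order convex in the weak order on W; (2) the union L(Q,ω) of the sets L(I) over all facets I is a lower set of the weak order; (3) the interval [e,ω] is contained in L(Q,ω); and (4) for any two distinct facets I₁ ≠ I₂ of SC(Q,ω), L(I₁) ∩ L(I₂) = ∅. -/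
/-! We formalize the setting of subword complexes of finite Coxeter systems.

The Coxeter system `(W, S)` is formalized by a Mathlib `CoxeterSystem M W` (whose
simple reflections are indexed by a type `B`).  The root system `Φ` of `(W, S)` is
formalized by a linear action `act : W →* V ≃ₗ[ℝ] V` of `W` on a real vector space
`V` (the geometric representation), simple roots `α : B → V`, and a set
`Pos ⊆ V` of positive roots; the defining properties of this data are the standard
ones, stated as hypotheses of the theorem: every simple root is positive, the image
`w (α b)` of a simple root is a positive root exactly when `ℓ(w sᵦ) = ℓ(w) + 1`,
every root (i.e. every `w (α b)`) is positive or negative, and no positive root is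
negative. -/

namespace SubwordStatement

variable {B W : Type*} [Group W] {M : CoxeterMatrix B}
variable {V : Type*} [AddCommGroup V] [Module ℝ V]

/-- The set `w(Φ⁺)` of images of the positive roots under `w`. -/
def posImage (act : W →* (V ≃ₗ[ℝ] V)) (Pos : Set V) (w : W) : Set V :=
  (fun v => act w v) '' Pos

/-- The inversion set `Inv(w) = Φ⁺ ∩ w(Φ⁻)`. -/
def invSet (act : W →* (V ≃ₗ[ℝ] V)) (Pos : Set V) (w : W) : Set V :=
  Pos ∩ ((fun v => act w v) '' {v : V | -v ∈ Pos})

/-- The (right) weak order on `W` : `σ ≤ ω` iff `Inv(σ) ⊆ Inv(ω)`. -/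
def wle (act : W →* (V ≃ₗ[ℝ] V)) (Pos : Set V) (σ ω : W) : Prop :=
  invSet act Pos σ ⊆ invSet act Pos ω

/-- The strict weak order on `W`. -/
def wlt (act : W →* (V ≃ₗ[ℝ] V)) (Pos : Set V) (σ ω : W) : Prop :=
  wle act Pos σ ω ∧ σ ≠ ω

variable (cs : CoxeterSystem M W)

/-- The product of the letters of the word `Q` at the positions in `J`, taken in
increasing order of positions: the element of `W` represented by the subword
`Q_J` of `Q`. -/
def subwordProd {m : ℕ} (Q : Fin m → B) (J : Finset (Fin m)) : W :=
  cs.wordProd ((J.sort (· ≤ ·)).map Q)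

/-- `I` is a facet of the subword complex `SC(Q, ω)` : the complement subword
`Q_{[m] ∖ I}` is a reduced expression of `ω` (it has product `ω` and length
`ℓ(ω)`). -/
def IsFacet {m : ℕ} (Q : Fin m → B) (ω : W) (I : Finset (Fin m)) : Prop :=
  subwordProd cs Q Iᶜ = ω ∧ Iᶜ.card = cs.length ω

/-- The root function of a facet `I` : `r(I, k) = (∏ Q_{[k-1] ∖ I}) (α_{q_k})`. -/
def rootF (act : W →* (V ≃ₗ[ℝ] V)) (α : B → V) {m : ℕ} (Q : Fin m → B)
    (I : Finset (Fin m)) (k : Fin m) : V :=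
  act (subwordProd cs Q (Finset.univ.filter (fun p => p < k ∧ p ∉ I))) (α (Q k))

/-- The root configuration `R(I) = {r(I, i) : i ∈ I}` of a facet `I`. -/
def rootConf (act : W →* (V ≃ₗ[ℝ] V)) (α : B → V) {m : ℕ} (Q : Fin m → B)
    (I : Finset (Fin m)) : Set V :=
  (fun k => rootF cs act α Q I k) '' (I : Set (Fin m))

/-- `π ∈ W` is a linear extension of the facet `I` : `R(I) ⊆ π(Φ⁺)`. -/
def IsLinExt (act : W →* (V ≃ₗ[ℝ] V)) (α : B → V) (Pos : Set V) {m : ℕ}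
    (Q : Fin m → B) (I : Finset (Fin m)) (π : W) : Prop :=
  rootConf cs act α Q I ⊆ posImage act Pos π

/-- The cone generated by a subset `A` of `V` : all nonnegative linear combinations
of finitely many elements of `A`. -/
def coneOf (A : Set V) : Set V :=
  {v : V | ∃ (s : Finset V) (c : V → ℝ), ↑s ⊆ A ∧ (∀ x ∈ s, 0 ≤ c x) ∧
    v = ∑ x ∈ s, c x • x}

/-- The facet `I` is acyclic : the cone generated by its root configuration `R(I)`
is pointed (it contains no line). -/
def IsAcyclicFacet (act : W →* (V ≃ₗ[ℝ] V)) (α : B → V) {m : ℕ}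
    (Q : Fin m → B) (I : Finset (Fin m)) : Prop :=
  ∀ v ∈ coneOf (rootConf cs act α Q I),
    -v ∈ coneOf (rootConf cs act α Q I) → v = (0 : V)

/-- The word `Q` is sorting : it contains a reduced expression of the longest
element `w∘` of `W` as a subword (a subword whose letters multiply to an element of
maximal length, without repetition of reflections, i.e. reduced). -/
def IsSorting {m : ℕ} (Q : Fin m → B) : Prop :=
  ∃ J : Finset (Fin m),
    cs.length (subwordProd cs Q J) = J.card ∧
    ∀ u : W, cs.length u ≤ cs.length (subwordProd cs Q J)

end SubwordStatement

namespace SubwordStatement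

section Cocycle

variable {B W : Type*} [Group W] {M : CoxeterMatrix B}

open Classical in
/-- The generator of the reflection cocycle representation. -/
noncomputable def etaGen (s : W) : Function.End (W × ZMod 2) :=
  fun p => (s * p.1 * s⁻¹, p.2 + if p.1 = s then 1 else 0)

open Classical in
theorem etaGen_pow (a b : W) (ha : a * a = 1) (hb : b * b = 1) (n : ℕ) (p : W × ZMod 2) :
    ((etaGen a * etaGen b) ^ n) p = ((a * b) ^ n * p.1 * ((a * b) ^ n)⁻¹,
      p.2 + ∑ l ∈ Finset.range (2 * n), if p.1 = ((a * b) ^ l)⁻¹ * b then 1 else 0) := by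
  have ha' : a⁻¹ = a := inv_eq_of_mul_eq_one_right ha
  have hb' : b⁻¹ = b := inv_eq_of_mul_eq_one_right hb
  have hbc : ∀ k : ℕ, b * (a * b) ^ k = ((a * b) ^ k)⁻¹ * b := by
    intro k
    induction k with
    | zero => simp
    | succ k ih =>
      rw [pow_succ, ← mul_assoc, ih, mul_inv_rev, mul_inv_rev, ha', hb']
      have : (a * b) ^ k * (a * b) = (a * b) * (a * b)^k := by rw [← pow_succ, pow_succ']
      have h2 : ((a * b) ^ k)⁻¹ * (b * a) = (b * a) * ((a * b)^k)⁻¹ := by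
        have := congrArg (·⁻¹) this
        simpa [mul_inv_rev, ha', hb', mul_assoc] using this.symm
      calc ((a * b) ^ k)⁻¹ * b * (a * b) = ((a * b) ^ k)⁻¹ * (b * a) * b := by group
        _ = _ := by rw [h2]
  induction n with
  | zero => simp; rfl
  | succ n ih =>
    rw [pow_succ']
    change etaGen a (etaGen b (((etaGen a * etaGen b) ^ n) p)) = _
    rw [ih]
    simp only [etaGen]
    rw [show 2 * (n + 1) = 2 * n + 1 + 1 by ring, Finset.sum_range_succ, Finset.sum_range_succ]
    have e1 : ((a * b) ^ n * p.1 * ((a * b) ^ n)⁻¹ = b) ↔ p.1 = ((a * b) ^ (2 * n))⁻¹ * b := by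
      rw [mul_inv_eq_iff_eq_mul, hbc, ← eq_inv_mul_iff_mul_eq, two_mul, pow_add, mul_inv_rev,
        mul_assoc]
    have e2 : (b * ((a * b) ^ n * p.1 * ((a * b) ^ n)⁻¹) * b⁻¹ = a) ↔
        p.1 = ((a * b) ^ (2 * n + 1))⁻¹ * b := by
      have key : ((a * b) ^ (2 * n + 1))⁻¹ * b
          = ((a * b) ^ n)⁻¹ * (b⁻¹ * a * b) * (a * b) ^ n := by
        rw [show 2 * n + 1 = (n + 1) + n by ring, pow_add, pow_succ (a * b) n]
        calc ((a * b) ^ n * (a * b) * (a * b) ^ n)⁻¹ * b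
            = ((a * b) ^ n)⁻¹ * (b⁻¹ * a⁻¹) * (((a * b) ^ n)⁻¹ * b) := by
              simp only [mul_inv_rev, mul_assoc]
          _ = ((a * b) ^ n)⁻¹ * (b⁻¹ * a) * (b * (a * b) ^ n) := by rw [hbc, ha']
          _ = _ := by simp only [mul_assoc]
      rw [key]
      constructor
      · intro h
        generalize (a * b) ^ n = C at h ⊢
        rw [← h]; simp only [mul_assoc, inv_mul_cancel_left, inv_mul_cancel, mul_one]
      · intro h
        rw [h]; simp only [mul_assoc, mul_inv_cancel_left, mul_inv_cancel, mul_one]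
    simp only [e1, e2]
    refine Prod.ext ?_ ?_
    · simp only [pow_succ', mul_inv_rev, mul_assoc]
    · simp only [add_assoc]

theorem etaGen_liftable (cs : CoxeterSystem M W) :
    M.IsLiftable (fun i => etaGen (cs.simple i)) := by
  classical
  intro i j
  funext p
  change ((etaGen (cs.simple i) * etaGen (cs.simple j)) ^ M i j) p = p
  rw [etaGen_pow _ _ (cs.simple_mul_simple_self i) (cs.simple_mul_simple_self j)]
  rw [cs.simple_mul_simple_pow, two_mul, Finset.sum_range_add]
  simp only [pow_add, cs.simple_mul_simple_pow, one_mul, mul_one, inv_one, CharTwo.add_self_eq_zero,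
    add_zero]

/-- The reflection cocycle representation. -/
noncomputable def etaHom (cs : CoxeterSystem M W) : W →* Function.End (W × ZMod 2) :=
  cs.lift ⟨fun i => etaGen (cs.simple i), etaGen_liftable cs⟩

/-- The reflection cocycle. -/
noncomputable def eta (cs : CoxeterSystem M W) (w t : W) : ZMod 2 := (etaHom cs w (t, 0)).2

theorem etaHom_simple (cs : CoxeterSystem M W) (i : B) :
    etaHom cs (cs.simple i) = etaGen (cs.simple i) := by
  unfold etaHom
  rw [cs.lift_apply_simple]

theorem etaHom_apply (cs : CoxeterSystem M W) (w : W) (p : W × ZMod 2) :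
    etaHom cs w p = (w * p.1 * w⁻¹, p.2 + eta cs w p.1) := by
  unfold eta
  revert p
  refine cs.simple_induction_left (p := fun w => ∀ p : W × ZMod 2, etaHom cs w p =
    (w * p.1 * w⁻¹, p.2 + (etaHom cs w (p.1, 0)).2)) w ?_ ?_
  · intro p
    rw [map_one]
    change p = (1 * p.1 * 1⁻¹, p.2 + 0)
    simp
  · intro w i ih p
    rw [map_mul]
    change etaHom cs (cs.simple i) (etaHom cs w p) =
      (_, p.2 + (etaHom cs (cs.simple i) (etaHom cs w (p.1, 0))).2)
    rw [ih p, ih (p.1, 0), etaHom_simple]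
    simp only [etaGen, mul_inv_rev, mul_assoc, zero_add, add_assoc]

theorem eta_mul (cs : CoxeterSystem M W) (v w t : W) :
    eta cs (v * w) t = eta cs w t + eta cs v (w * t * w⁻¹) := by
  have h : etaHom cs (v * w) (t, 0) = etaHom cs v (etaHom cs w (t, 0)) := by rw [map_mul]; rfl
  rw [etaHom_apply, etaHom_apply, etaHom_apply] at h
  simpa using congrArg Prod.snd h

open Classical in
theorem eta_simple (cs : CoxeterSystem M W) (i : B) (t : W) :
    eta cs (cs.simple i) t = if t = cs.simple i then 1 else 0 := by
  unfold eta
  rw [etaHom_simple]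
  simp [etaGen]

theorem eta_one (cs : CoxeterSystem M W) (t : W) : eta cs 1 t = 0 := by
  unfold eta
  rw [map_one]; rfl

theorem zmod2_cases (x : ZMod 2) : x = 0 ∨ x = 1 := by
  revert x; decide

theorem exchange_word (cs : CoxeterSystem M W) (t : W) (L : List B)
    (h : eta cs (cs.wordProd L) t ≠ 0) :
    ∃ L' : List B, L'.length < L.length ∧ cs.wordProd L' = cs.wordProd L * t := by
  classical
  induction L with
  | nil => simp [eta_one] at h
  | cons a L ih =>
    by_cases h0 : eta cs (cs.wordProd L) t = 0
    · rw [cs.wordProd_cons, eta_mul, h0, zero_add, eta_simple] at h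
      have h1 : cs.wordProd L * t * (cs.wordProd L)⁻¹ = cs.simple a := by
        by_contra hne
        simp [hne] at h
      refine ⟨L, by simp, ?_⟩
      rw [cs.wordProd_cons, mul_assoc, mul_inv_eq_iff_eq_mul.mp h1]
      simp
    · obtain ⟨L', hL, hp⟩ := ih h0
      exact ⟨a :: L', by simpa using hL, by rw [cs.wordProd_cons, cs.wordProd_cons, hp, mul_assoc]⟩

theorem length_lt_of_eta (cs : CoxeterSystem M W) (w t : W) (h : eta cs w t ≠ 0) :
    cs.length (w * t) < cs.length w := by
  obtain ⟨L, hL, rfl⟩ := cs.exists_isReduced w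
  obtain ⟨L', hl, hp⟩ := exchange_word cs t L h
  rw [← hp, hL.eq]
  exact (cs.length_wordProd_le L').trans_lt hl

theorem eta_mul_simple (cs : CoxeterSystem M W) (w : W) (b : B) :
    eta cs (w * cs.simple b) (cs.simple b) = eta cs w (cs.simple b) + 1 := by
  rw [eta_mul, eta_simple]
  simp [add_comm]

theorem eta_zero_iff (cs : CoxeterSystem M W) (w : W) (b : B) :
    eta cs w (cs.simple b) = 0 ↔ cs.length (w * cs.simple b) = cs.length w + 1 := by
  constructor
  · intro h
    have h1 := length_lt_of_eta cs (w * cs.simple b) (cs.simple b)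
      (by rw [eta_mul_simple, h]; decide)
    rw [cs.simple_mul_simple_cancel_right] at h1
    rcases cs.length_mul_simple w b with h2 | h2 <;> omega
  · intro h
    by_contra hne
    have := length_lt_of_eta cs w _ hne
    omega

theorem eta_ne_zero_iff (cs : CoxeterSystem M W) (w : W) (b : B) :
    eta cs w (cs.simple b) ≠ 0 ↔ cs.length (w * cs.simple b) + 1 = cs.length w := by
  rw [Ne, eta_zero_iff]
  rcases cs.length_mul_simple w b with h2 | h2 <;> omega

/-- Two roots with the same reflection: their signs change simultaneously. -/
theorem eta_compare (cs : CoxeterSystem M W) (x w w' : W) (b b' : B)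
    (h : w * cs.simple b * w⁻¹ = w' * cs.simple b' * w'⁻¹) :
    eta cs (x * w) (cs.simple b) + eta cs w (cs.simple b) =
      eta cs (x * w') (cs.simple b') + eta cs w' (cs.simple b') := by
  rw [eta_mul, eta_mul cs x w', h]
  have := CharTwo.add_self_eq_zero (eta cs w (cs.simple b))
  have h2 := CharTwo.add_self_eq_zero (eta cs w' (cs.simple b'))
  linear_combination this - h2

theorem eta_simple_mul_ne (cs : CoxeterSystem M W) (s b : B) (w : W)
    (h : w * cs.simple b * w⁻¹ ≠ cs.simple s) :
    eta cs (cs.simple s * w) (cs.simple b) = eta cs w (cs.simple b) := by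
  classical
  rw [eta_mul, eta_simple]; simp [h]

theorem eta_simple_mul_eq (cs : CoxeterSystem M W) (s b : B) (w : W)
    (h : w * cs.simple b * w⁻¹ = cs.simple s) :
    eta cs (cs.simple s * w) (cs.simple b) = eta cs w (cs.simple b) + 1 := by
  classical
  rw [eta_mul, eta_simple]; simp [h]

end Cocycle

section Subword

variable {B W : Type*} [Group W] {M : CoxeterMatrix B} (cs : CoxeterSystem M W)
variable {m : ℕ} (Q : Fin m → B)

/-- The prefix products of the complement of `I`. -/
def pre (I : Finset (Fin m)) : ℕ → W
  | 0 => 1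
  | n + 1 => if h : n < m then
      (if (⟨n, h⟩ : Fin m) ∈ I then pre I n else pre I n * cs.simple (Q ⟨n, h⟩)) else pre I n

theorem pre_succ_mem {I : Finset (Fin m)} {k : Fin m} (hk : k ∈ I) :
    pre cs Q I (k + 1) = pre cs Q I k := by
  simp [pre, hk]

theorem pre_succ_not_mem {I : Finset (Fin m)} {k : Fin m} (hk : k ∉ I) :
    pre cs Q I (k + 1) = pre cs Q I k * cs.simple (Q k) := by
  simp [pre, hk]

theorem subwordProd_filter (I : Finset (Fin m)) (n : ℕ) :
    subwordProd cs Q (Finset.univ.filter (fun p : Fin m => p.val < n ∧ p ∉ I)) = pre cs Q I n := by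
  induction n with
  | zero => simp [subwordProd, pre]
  | succ n ih =>
    by_cases h : n < m
    · by_cases hI : (⟨n, h⟩ : Fin m) ∈ I
      · have : (Finset.univ.filter (fun p : Fin m => p.val < n + 1 ∧ p ∉ I)) =
            (Finset.univ.filter (fun p : Fin m => p.val < n ∧ p ∉ I)) := by
          ext p
          simp only [Finset.mem_filter, Finset.mem_univ, true_and]
          constructor
          · rintro ⟨h1, h2⟩
            refine ⟨lt_of_le_of_ne (Nat.lt_succ_iff.mp h1) ?_, h2⟩
            rintro rfl
            exact h2 hI
          · rintro ⟨h1, h2⟩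
            exact ⟨by omega, h2⟩
        rw [this, ih]
        simp [pre, h, hI]
      · have : (Finset.univ.filter (fun p : Fin m => p.val < n + 1 ∧ p ∉ I)).sort (· ≤ ·) =
            (Finset.univ.filter (fun p : Fin m => p.val < n ∧ p ∉ I)).sort (· ≤ ·)
              ++ [⟨n, h⟩] := by
          refine List.Perm.eq_of_pairwise' (r := (· ≤ ·)) (Finset.pairwise_sort _ _) ?_ ?_
          · rw [List.pairwise_append]
            refine ⟨Finset.pairwise_sort _ _, by simp, ?_⟩
            intro a ha b hb
            simp only [Finset.mem_sort, Finset.mem_filter, List.mem_singleton] at ha hb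
            subst hb
            exact Fin.mk_le_mk.mpr ha.2.1.le
          · refine (List.perm_ext_iff_of_nodup (Finset.sort_nodup _ _) ?_).mpr ?_
            · rw [List.nodup_append]
              refine ⟨Finset.sort_nodup _ _, by simp, ?_⟩
              intro a ha b hb
              simp only [Finset.mem_sort, Finset.mem_filter, List.mem_singleton] at ha hb
              subst hb
              rintro rfl
              exact absurd ha.2.1 (lt_irrefl _)
            · intro p
              simp only [Finset.mem_sort, Finset.mem_filter, Finset.mem_univ, true_and,
                List.mem_append, List.mem_singleton]
              constructor
              · rintro ⟨h1, h2⟩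
                by_cases hp : p.val = n
                · right; exact Fin.ext hp
                · left; exact ⟨by omega, h2⟩
              · rintro (⟨h1, h2⟩ | rfl)
                · exact ⟨by omega, h2⟩
                · exact ⟨by simp, hI⟩
        unfold subwordProd at ih ⊢
        rw [this, List.map_append, cs.wordProd_append, ih]
        simp [pre, h, hI]
    · have : (Finset.univ.filter (fun p : Fin m => p.val < n + 1 ∧ p ∉ I)) =
            (Finset.univ.filter (fun p : Fin m => p.val < n ∧ p ∉ I)) := by
        ext p
        have := p.2
        simp only [Finset.mem_filter, Finset.mem_univ, true_and]
        constructor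
        · rintro ⟨h1, h2⟩
          exact ⟨by omega, h2⟩
        · rintro ⟨h1, h2⟩
          exact ⟨by omega, h2⟩
      rw [this, ih]
      simp [pre, h]

theorem subwordProd_compl (I : Finset (Fin m)) : subwordProd cs Q Iᶜ = pre cs Q I m := by
  rw [← subwordProd_filter]
  congr 1
  ext p
  simp

theorem isFacet_iff (ω : W) (I : Finset (Fin m)) :
    IsFacet cs Q ω I ↔ pre cs Q I m = ω ∧ Iᶜ.card = cs.length ω := by
  unfold IsFacet
  rw [subwordProd_compl]

theorem length_pre_le (I : Finset (Fin m)) : cs.length (pre cs Q I m) ≤ Iᶜ.card := by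
  rw [← subwordProd_compl]
  refine (cs.length_wordProd_le _).trans ?_
  simp

/-- The reflection at position `k`. -/
def refl (I : Finset (Fin m)) (k : Fin m) : W :=
  pre cs Q I k * cs.simple (Q k) * (pre cs Q I k)⁻¹

theorem refl_mul_pre (I : Finset (Fin m)) (k : Fin m) :
    refl cs Q I k * pre cs Q I k = pre cs Q I k * cs.simple (Q k) := by
  simp [refl]

theorem refl_mul_refl (I : Finset (Fin m)) (k : Fin m) :
    refl cs Q I k * refl cs Q I k = 1 := by
  simp [refl, mul_assoc]

theorem pre_toggle {I I' : Finset (Fin m)} {a b : Fin m} (hab : a < b)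
    (hT : refl cs Q I a = refl cs Q I b)
    (hI : ∀ i, i ≠ a → i ≠ b → (i ∈ I' ↔ i ∈ I)) (ha : a ∈ I' ↔ a ∉ I) (hb : b ∈ I' ↔ b ∉ I)
    (n : ℕ) :
    pre cs Q I' n = if a.val < n ∧ n ≤ b.val then refl cs Q I a * pre cs Q I n
      else pre cs Q I n := by
  have hab' : a.val < b.val := hab
  induction n with
  | zero => simp [pre]
  | succ n ih =>
    by_cases h : n < m
    swap
    · have := b.2
      rw [if_neg (by omega)] at ih
      rw [if_neg (by omega)]
      simp [pre, h, ih]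
    obtain ⟨k, rfl⟩ : ∃ k : Fin m, k.val = n := ⟨⟨n, h⟩, rfl⟩
    by_cases hka : k = a
    · subst hka
      rw [if_neg (by omega)] at ih
      rw [if_pos (by omega)]
      by_cases hk : k ∈ I
      · rw [pre_succ_mem cs Q hk, pre_succ_not_mem cs Q (fun h => ha.mp h hk), ih, refl_mul_pre]
      · rw [pre_succ_not_mem cs Q hk, pre_succ_mem cs Q (ha.mpr hk), ih, ← refl_mul_pre,
          ← mul_assoc, refl_mul_refl, one_mul]
    by_cases hkb : k = b
    · subst hkb
      rw [if_pos (by omega)] at ih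
      rw [if_neg (by omega)]
      rw [hT] at ih
      by_cases hk : k ∈ I
      · rw [pre_succ_mem cs Q hk, pre_succ_not_mem cs Q (fun h => hb.mp h hk), ih, refl_mul_pre]
        simp
      · rw [pre_succ_not_mem cs Q hk, pre_succ_mem cs Q (hb.mpr hk), ih, ← refl_mul_pre]
    have h1 : k.val ≠ a.val := fun h => hka (Fin.ext h)
    have h2 : k.val ≠ b.val := fun h => hkb (Fin.ext h)
    have hc : (a.val < k.val + 1 ∧ k.val + 1 ≤ b.val) ↔ (a.val < k.val ∧ k.val ≤ b.val) := by omega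
    simp only [hc]
    by_cases hk : k ∈ I
    · rw [pre_succ_mem cs Q hk, pre_succ_mem cs Q ((hI k hka hkb).mpr hk), ih]
    · rw [pre_succ_not_mem cs Q hk, pre_succ_not_mem cs Q (fun h => hk ((hI k hka hkb).mp h)), ih]
      split_ifs <;> simp [mul_assoc]

theorem sign_step {I : Finset (Fin m)} (w : W) (b : B) (n : ℕ)
    (h : eta cs ((pre cs Q I n)⁻¹ * w) (cs.simple b) ≠
      eta cs ((pre cs Q I (n + 1))⁻¹ * w) (cs.simple b)) :
    ∃ k : Fin m, k.val = n ∧ k ∉ I ∧ refl cs Q I k = w * cs.simple b * w⁻¹ := by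
  by_cases hn : n < m
  swap
  · simp [pre, hn] at h
  obtain ⟨k, rfl⟩ : ∃ k : Fin m, k.val = n := ⟨⟨n, hn⟩, rfl⟩
  by_cases hk : k ∈ I
  · rw [pre_succ_mem cs Q hk] at h
    exact absurd rfl h
  refine ⟨k, rfl, hk, ?_⟩
  by_contra hne
  apply h
  rw [pre_succ_not_mem cs Q hk, mul_inv_rev, cs.inv_simple, mul_assoc, eta_simple_mul_ne]
  intro heq
  apply hne
  rw [refl, ← heq]
  group

theorem exchange_down {I : Finset (Fin m)} (k : Fin m)
    (h : eta cs (pre cs Q I k) (cs.simple (Q k)) ≠ 0) :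
    ∃ j : Fin m, j < k ∧ j ∉ I ∧ refl cs Q I j = refl cs Q I k := by
  by_contra! hcon
  have key : ∀ n ≤ k.val, eta cs ((pre cs Q I n)⁻¹ * pre cs Q I k) (cs.simple (Q k)) ≠ 0 := by
    intro n
    induction n with
    | zero => intro _; simpa [pre] using h
    | succ n ih =>
      intro hn h0
      obtain ⟨j, hj, hjI, hr⟩ := sign_step cs Q (I := I) (pre cs Q I k) (Q k) n
        (by rw [h0]; exact ih (by omega))
      exact hcon j (by rw [Fin.lt_def]; omega) hjI hr
  have := key k le_rfl
  rw [inv_mul_cancel, eta_one] at this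
  exact this rfl

theorem exchange_up {I : Finset (Fin m)} (k : Fin m) (hk : k ∈ I)
    (h : eta cs ((pre cs Q I m)⁻¹ * pre cs Q I k) (cs.simple (Q k)) ≠ 0) :
    ∃ j : Fin m, k < j ∧ j ∉ I ∧ refl cs Q I j = refl cs Q I k := by
  by_contra! hcon
  apply h
  refine Nat.le_induction (m := k.val) (P := fun n _ =>
    eta cs ((pre cs Q I n)⁻¹ * pre cs Q I k) (cs.simple (Q k)) = 0) ?_ ?_ m k.2.le
  · rw [inv_mul_cancel, eta_one]
  · intro n hn ih
    by_contra h0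
    obtain ⟨j, hj, hjI, hr⟩ := sign_step cs Q (I := I) (pre cs Q I k) (Q k) n
        (by rw [ih]; exact fun h => h0 h.symm)
    have hne : j ≠ k := by rintro rfl; exact hjI hk
    have hne' : j.val ≠ k.val := fun h => hne (Fin.ext h)
    exact hcon j (by rw [Fin.lt_def]; omega) hjI hr

theorem facet_nodup {ω : W} {I : Finset (Fin m)} (hI : IsFacet cs Q ω I) {a b : Fin m}
    (ha : a ∉ I) (hb : b ∉ I) (hT : refl cs Q I a = refl cs Q I b) : a = b := by
  wlog hab : a < b generalizing a b
  · by_contra hne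
    exact hne (this hb ha hT.symm (lt_of_le_of_ne (not_lt.mp hab) (Ne.symm hne))).symm
  exfalso
  rw [isFacet_iff] at hI
  have hp := pre_toggle cs Q (I' := insert a (insert b I)) hab hT
    (by intro i h1 h2; simp [h1, h2]) (by simp [ha]) (by simp [hb]) m
  have hbm := b.2
  rw [if_neg (by omega), hI.1] at hp
  have hl := length_pre_le cs Q (insert a (insert b I))
  rw [hp, ← hI.2] at hl
  have hlt : (insert a (insert b I))ᶜ.card < Iᶜ.card := by
    apply Finset.card_lt_card
    rw [Finset.compl_ssubset_compl]
    refine ⟨fun x hx => by simp [hx], fun h => ha (h (by simp))⟩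
  omega

theorem facet_pos {ω : W} {I : Finset (Fin m)} (hI : IsFacet cs Q ω I) {k : Fin m} (hk : k ∉ I) :
    eta cs (pre cs Q I k) (cs.simple (Q k)) = 0 := by
  by_contra h
  obtain ⟨j, hj, hjI, hr⟩ := exchange_down cs Q k h
  exact hj.ne (facet_nodup cs Q hI hjI hk hr)

theorem facet_flip {ω : W} {I : Finset (Fin m)} (hI : IsFacet cs Q ω I) {j k : Fin m}
    (hj : j ∉ I) (hk : k ∈ I) (hT : refl cs Q I j = refl cs Q I k) :
    IsFacet cs Q ω (insert j (I.erase k)) := by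
  have hne : j ≠ k := by rintro rfl; exact hj hk
  rw [isFacet_iff] at hI ⊢
  have hjm := j.2
  have hkm := k.2
  constructor
  · rw [← hI.1]
    rcases lt_or_gt_of_ne hne with h | h
    · rw [pre_toggle cs Q (I := I) h hT (by intro i h1 h2; simp [h1, h2]) (by simp [hj])
        (by simp [hk, hne.symm]) m, if_neg (by omega)]
    · rw [pre_toggle cs Q (I := I) h hT.symm (by intro i h1 h2; simp [h1, h2])
        (by simp [hk, hne.symm]) (by simp [hj]) m, if_neg (by omega)]
  · rw [← hI.2, Finset.card_compl, Finset.card_compl, Finset.card_insert_of_notMem (by simp [hj]),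
      Finset.card_erase_add_one hk]

/-- Combinatorial version of linear extensions. -/
def LE' (I : Finset (Fin m)) (π : W) : Prop :=
  ∀ k ∈ I, eta cs (π⁻¹ * pre cs Q I k) (cs.simple (Q k)) = 0

/-- The top element of the interval is a linear extension. -/
theorem exists_top {ω : W} (h : ∃ I : Finset (Fin m), IsFacet cs Q ω I) :
    ∃ I : Finset (Fin m), IsFacet cs Q ω I ∧ LE' cs Q I ω := by
  classical
  obtain ⟨I, hI, hmax⟩ := Finset.exists_max_image
    (Finset.univ.filter (fun I : Finset (Fin m) => IsFacet cs Q ω I))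
    (fun I => ∑ i ∈ I, i.val) (by obtain ⟨I, hI⟩ := h; exact ⟨I, by simp [hI]⟩)
  simp only [Finset.mem_filter, Finset.mem_univ, true_and] at hI hmax
  refine ⟨I, hI, ?_⟩
  intro k hk
  by_contra hne
  rw [← ((isFacet_iff cs Q ω I).mp hI).1] at hne
  obtain ⟨j, hkj, hj, hr⟩ := exchange_up cs Q k hk hne
  have := hmax _ (facet_flip cs Q hI hj hk hr)
  rw [Finset.sum_insert (by simp [hj])] at this
  have h2 := Finset.add_sum_erase I (fun i => i.val) hk
  have h3 : k.val < j.val := hkj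
  omega

/-- The step from `π s` down to `π`. -/
theorem step_down {ω π : W} {s : B} (hπ : eta cs π (cs.simple s) = 0) {I : Finset (Fin m)}
    (hI : IsFacet cs Q ω I) (hL : LE' cs Q I (π * cs.simple s)) :
    ∃ I' : Finset (Fin m), IsFacet cs Q ω I' ∧ LE' cs Q I' π ∧
      ((I' = I ∧ ∀ i ∈ I', refl cs Q I' i ≠ π * cs.simple s * π⁻¹) ∨
       (∃ j k : Fin m, j ∈ I' ∧ k ∉ I' ∧ refl cs Q I' j = π * cs.simple s * π⁻¹ ∧
        refl cs Q I' k = π * cs.simple s * π⁻¹ ∧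
        (∀ i ∈ I', i < j → refl cs Q I' i ≠ π * cs.simple s * π⁻¹) ∧
        I = insert k (I'.erase j))) := by
  classical
  have hL' : ∀ k ∈ I, eta cs (cs.simple s * (π⁻¹ * pre cs Q I k)) (cs.simple (Q k)) = 0 := by
    intro k hk
    have := hL k hk
    rwa [mul_inv_rev, cs.inv_simple, mul_assoc] at this
  have hconj : ∀ w u : W, (π⁻¹ * w) * u * (π⁻¹ * w)⁻¹ = cs.simple s ↔
      w * u * w⁻¹ = π * cs.simple s * π⁻¹ := by
    intro w u
    constructor
    · intro h; rw [← h]; group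
    · intro h
      calc (π⁻¹ * w) * u * (π⁻¹ * w)⁻¹ = π⁻¹ * (w * u * w⁻¹) * π := by group
        _ = _ := by rw [h]; group
  have hsame : ∀ k ∈ I, refl cs Q I k ≠ π * cs.simple s * π⁻¹ →
      eta cs (π⁻¹ * pre cs Q I k) (cs.simple (Q k)) = 0 := by
    intro k hk hne
    rw [← hL' k hk, eta_simple_mul_ne]
    intro h
    exact hne ((hconj _ _).mp h)
  by_cases hK : ∀ k ∈ I, refl cs Q I k ≠ π * cs.simple s * π⁻¹
  · exact ⟨I, hI, fun k hk => hsame k hk (hK k hk), Or.inl ⟨rfl, hK⟩⟩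
  -- compare a root over `t` with the root `π α_s`
  have hcmp : ∀ k : Fin m, refl cs Q I k = π * cs.simple s * π⁻¹ →
      eta cs (π⁻¹ * pre cs Q I k) (cs.simple (Q k)) =
        eta cs (pre cs Q I k) (cs.simple (Q k)) := by
    intro k hk
    have := eta_compare cs π⁻¹ (pre cs Q I k) π (Q k) s hk
    rw [inv_mul_cancel, eta_one, hπ, add_zero] at this
    exact CharTwo.add_eq_zero.mp this
  have hneg : ∀ k ∈ I, refl cs Q I k = π * cs.simple s * π⁻¹ →
      eta cs (pre cs Q I k) (cs.simple (Q k)) ≠ 0 := by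
    intro k hk hr h0
    have h1 := hL' k hk
    rw [eta_simple_mul_eq _ _ _ _ ((hconj _ _).mpr hr), hcmp k hr, h0] at h1
    exact absurd h1 (by decide)
  push Not at hK
  obtain ⟨k0, hk0, hr0⟩ := hK
  obtain ⟨k, hk, hkmax⟩ := Finset.exists_max_image
    (I.filter (fun k => refl cs Q I k = π * cs.simple s * π⁻¹)) id ⟨k0, by simp [hk0, hr0]⟩
  simp only [Finset.mem_filter, id, and_imp] at hk hkmax
  obtain ⟨hkI, hkr⟩ := hk
  obtain ⟨j, hjk, hj, hjr'⟩ := exchange_down cs Q k (hneg k hkI hkr)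
  have hjr := hjr'.trans hkr
  have hfirst : ∀ i ∈ I, refl cs Q I i = π * cs.simple s * π⁻¹ → j < i := by
    intro i hi hr
    obtain ⟨j', hj'i, hj', hj'r⟩ := exchange_down cs Q i (hneg i hi hr)
    have := facet_nodup cs Q hI hj hj' (hjr.trans (hj'r.trans hr).symm)
    rw [this]; exact hj'i
  have hne : j ≠ k := hjk.ne
  have htog := pre_toggle cs Q (I := I) (I' := insert j (I.erase k)) hjk hjr'
    (by intro i h1 h2; simp [h1, h2]) (by simp [hj]) (by simp [hkI, hne.symm])
  have hjk' : j.val < k.val := hjk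
  have hprej : pre cs Q (insert j (I.erase k)) j = pre cs Q I j := by
    rw [htog, if_neg (by omega)]
  have hprek : pre cs Q (insert j (I.erase k)) k = refl cs Q I j * pre cs Q I k := by
    rw [htog, if_pos (by omega)]
  refine ⟨insert j (I.erase k), facet_flip cs Q hI hj hkI hjr', ?_, Or.inr ⟨j, k, ?_⟩⟩
  · intro i hi
    rw [Finset.mem_insert, Finset.mem_erase] at hi
    rcases hi with rfl | ⟨hik, hiI⟩
    · rw [hprej, hcmp i hjr]
      exact facet_pos cs Q hI hj
    · rw [htog]
      split_ifs with hc
      · rw [hjr]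
        have : π⁻¹ * (π * cs.simple s * π⁻¹ * pre cs Q I i) =
          cs.simple s * (π⁻¹ * pre cs Q I i) := by group
        rw [this]
        exact hL' i hiI
      · apply hsame i hiI
        intro hr
        have h1 : j.val < i.val := hfirst i hiI hr
        have h2 : i.val ≤ k.val := hkmax i hiI hr
        exact hc ⟨h1, h2⟩
  · refine ⟨by simp, by simp [hne.symm], ?_, ?_, ?_, ?_⟩
    · rw [refl, hprej]; exact hjr
    · rw [refl, hprek, ← hkr, ← hjr']
      calc refl cs Q I j * pre cs Q I k * cs.simple (Q k) * (refl cs Q I j * pre cs Q I k)⁻¹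
          = refl cs Q I j * (pre cs Q I k * cs.simple (Q k) * (pre cs Q I k)⁻¹) *
              (refl cs Q I j)⁻¹ := by group
        _ = refl cs Q I j * refl cs Q I j * (refl cs Q I j)⁻¹ := by
              rw [show pre cs Q I k * cs.simple (Q k) * (pre cs Q I k)⁻¹ = refl cs Q I j from
                hjr'.symm]
        _ = refl cs Q I j := by simp
    · intro i hi hij
      have hij' : i.val < j.val := hij
      rw [Finset.mem_insert, Finset.mem_erase] at hi
      have hiI : i ∈ I := by
        rcases hi with h | h
        · exact absurd h hij.ne
        · exact h.2
      rw [refl, htog, if_neg (by omega)]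
      intro hr
      exact absurd (hfirst i hiI hr) (not_lt.mpr hij.le)
    · rw [Finset.erase_insert (by simp [hj]), Finset.insert_erase hkI]

/-- Uniqueness for the identity. -/
theorem unique_one {ω : W} {I J : Finset (Fin m)} (hI : IsFacet cs Q ω I) (hJ : IsFacet cs Q ω J)
    (hLI : LE' cs Q I 1) (hLJ : LE' cs Q J 1) : I = J := by
  have char : ∀ I : Finset (Fin m), IsFacet cs Q ω I → LE' cs Q I 1 → ∀ k : Fin m,
      k ∈ I ↔ eta cs (pre cs Q I (k + 1)) (cs.simple (Q k)) = 0 := by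
    intro I hI hL k
    constructor
    · intro hk
      have := hL k hk
      rwa [inv_one, one_mul, ← pre_succ_mem cs Q hk] at this
    · intro h
      by_contra hk
      rw [pre_succ_not_mem cs Q hk, eta_mul_simple, facet_pos cs Q hI hk] at h
      exact absurd h (by decide)
  have hpre : ∀ d n : ℕ, n + d = m → pre cs Q I n = pre cs Q J n := by
    intro d
    induction d with
    | zero =>
      intro n hn
      have : n = m := by omega
      rw [this, ((isFacet_iff cs Q ω I).mp hI).1, ((isFacet_iff cs Q ω J).mp hJ).1]
    | succ d ih =>
      intro n hn
      obtain ⟨k, rfl⟩ : ∃ k : Fin m, k.val = n := ⟨⟨n, by omega⟩, rfl⟩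
      have h1 := ih (k.val + 1) (by omega)
      have hiff : k ∈ I ↔ k ∈ J := by rw [char I hI hLI, char J hJ hLJ, h1]
      by_cases hk : k ∈ I
      · rwa [pre_succ_mem cs Q hk, pre_succ_mem cs Q (hiff.mp hk)] at h1
      · rw [pre_succ_not_mem cs Q hk, pre_succ_not_mem cs Q (fun h => hk (hiff.mpr h))] at h1
        exact mul_right_cancel h1
  ext k
  rw [char I hI hLI, char J hJ hLJ, hpre (m - (k + 1)) (k + 1) (by have := k.2; omega)]

theorem exists_descent {w : W} (hw : w ≠ 1) : ∃ (v : W) (s : B), w = v * cs.simple s ∧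
    eta cs v (cs.simple s) = 0 ∧ cs.length w = cs.length v + 1 := by
  obtain ⟨s, hs⟩ := cs.exists_rightDescent_of_ne_one hw
  have hs' := (cs.isRightDescent_iff).mp hs
  refine ⟨w * cs.simple s, s, by simp, ?_, hs'.symm⟩
  rw [eta_zero_iff]
  simpa using hs'.symm

/-- Uniqueness in general. -/
theorem unique_all {ω : W} (n : ℕ) : ∀ (π : W), cs.length π = n → ∀ {I J : Finset (Fin m)},
    IsFacet cs Q ω I → IsFacet cs Q ω J → LE' cs Q I π → LE' cs Q J π → I = J := by
  induction n with
  | zero =>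
    intro π hπ I J hI hJ hLI hLJ
    rw [cs.length_eq_zero_iff] at hπ
    subst hπ
    exact unique_one cs Q hI hJ hLI hLJ
  | succ n ih =>
    intro π hπ I J hI hJ hLI hLJ
    obtain ⟨v, s, rfl, hv, hl⟩ := exists_descent cs (w := π)
      (by rintro rfl; simp at hπ)
    obtain ⟨I', hI', hLI', hcI⟩ := step_down cs Q hv hI hLI
    obtain ⟨J', hJ', hLJ', hcJ⟩ := step_down cs Q hv hJ hLJ
    have hIJ := ih v (by omega) hI' hJ' hLI' hLJ'
    subst hIJ
    rcases hcI with ⟨rfl, h1⟩ | ⟨j, k, hj, hk, hjr, hkr, hmin, rfl⟩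
    · rcases hcJ with ⟨rfl, h2⟩ | ⟨j2, k2, hj2, hk2, hjr2, hkr2, hmin2, h⟩
      · rfl
      · exact absurd hjr2 (h1 j2 hj2)
    · rcases hcJ with ⟨rfl, h2⟩ | ⟨j2, k2, hj2, hk2, hjr2, hkr2, hmin2, rfl⟩
      · exact absurd hjr (h2 j hj)
      · have e1 : k = k2 := facet_nodup cs Q hI' hk hk2 (hkr.trans hkr2.symm)
        have e2 : j = j2 := by
          rcases lt_trichotomy j j2 with h | h | h
          · exact absurd hjr (hmin2 j hj h)
          · exact h
          · exact absurd hjr2 (hmin j2 hj2 h)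
        rw [e1, e2]

/-- Combinatorial weak order. -/
def wle' (σ τ : W) : Prop := ∀ (w : W) (b : B), eta cs w (cs.simple b) = 0 →
  eta cs (σ⁻¹ * w) (cs.simple b) ≠ 0 → eta cs (τ⁻¹ * w) (cs.simple b) ≠ 0

theorem wle'_descent {σ τ : W} (h : wle' cs σ τ) (hne : σ ≠ τ) :
    ∃ (v : W) (s : B), τ = v * cs.simple s ∧ eta cs v (cs.simple s) = 0 ∧
      cs.length τ = cs.length v + 1 ∧ wle' cs σ v := by
  have ha : σ⁻¹ * τ ≠ 1 := by
    intro h1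
    exact hne (inv_mul_eq_one.mp h1)
  obtain ⟨u, s, hu, hus, -⟩ := exists_descent cs ha
  have hneg : eta cs (σ⁻¹ * τ) (cs.simple s) ≠ 0 := by
    rw [hu, eta_mul_simple, hus]; decide
  have hτ : eta cs τ (cs.simple s) ≠ 0 := by
    intro h0
    apply h τ s h0 hneg
    rw [inv_mul_cancel, eta_one]
  have hl := (eta_ne_zero_iff cs τ s).mp hτ
  have hv0 : eta cs (τ * cs.simple s) (cs.simple s) = 0 := by
    rw [eta_zero_iff]; simpa using hl.symm
  refine ⟨τ * cs.simple s, s, by simp, hv0, hl.symm, ?_⟩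
  intro w b hw hσ hcon
  have h1 := h w b hw hσ
  rw [mul_inv_rev, cs.inv_simple, mul_assoc] at hcon
  by_cases hr : (τ⁻¹ * w) * cs.simple b * (τ⁻¹ * w)⁻¹ = cs.simple s
  · have hr' : w * cs.simple b * w⁻¹ =
        (τ * cs.simple s) * cs.simple s * (τ * cs.simple s)⁻¹ := by
      have : w * cs.simple b * w⁻¹ = τ * ((τ⁻¹ * w) * cs.simple b * (τ⁻¹ * w)⁻¹) * τ⁻¹ := by group
      rw [this, hr]
      simp [mul_assoc]
    have := eta_compare cs σ⁻¹ w (τ * cs.simple s) b s hr'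
    rw [hw, hv0, ← mul_assoc, hu, cs.simple_mul_simple_cancel_right, hus, add_zero, add_zero] at this
    exact hσ this
  · rw [eta_simple_mul_ne _ _ _ _ hr] at hcon
    exact h1 hcon

theorem lower_all {ω : W} (n : ℕ) : ∀ (σ τ : W), cs.length τ = n → wle' cs σ τ →
    (∃ I : Finset (Fin m), IsFacet cs Q ω I ∧ LE' cs Q I τ) →
    (∃ I : Finset (Fin m), IsFacet cs Q ω I ∧ LE' cs Q I σ) := by
  induction n with
  | zero =>
    intro σ τ hτ hle hex
    by_cases hne : σ = τ
    · subst hne; exact hex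
    · obtain ⟨v, s, -, -, hl, -⟩ := wle'_descent cs hle hne
      omega
  | succ n ih =>
    intro σ τ hτ hle hex
    by_cases hne : σ = τ
    · subst hne; exact hex
    · obtain ⟨v, s, rfl, hv, hl, hle'⟩ := wle'_descent cs hle hne
      obtain ⟨I, hI, hL⟩ := hex
      obtain ⟨I', hI', hL', -⟩ := step_down cs Q hv hI hL
      exact ih σ v (by omega) hle' ⟨I', hI', hL'⟩

end Subword

section Translate

variable {B W : Type*} [Group W] {M : CoxeterMatrix B} (cs : CoxeterSystem M W)
variable {V : Type*} [AddCommGroup V] [Module ℝ V]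
variable (act : W →* (V ≃ₗ[ℝ] V)) (α : B → V) (Pos : Set V)

theorem mem_posImage_iff (w : W) (v : V) : v ∈ posImage act Pos w ↔ act w⁻¹ v ∈ Pos := by
  unfold posImage
  constructor
  · rintro ⟨u, hu, rfl⟩
    have : act w⁻¹ (act w u) = u := by
      rw [← LinearEquiv.mul_apply, ← map_mul, inv_mul_cancel, map_one]; rfl
    simpa [this] using hu
  · intro h
    refine ⟨_, h, ?_⟩
    change act w (act w⁻¹ v) = v
    rw [← LinearEquiv.mul_apply, ← map_mul, mul_inv_cancel, map_one]; rfl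

theorem mem_invSet_iff (w : W) (v : V) :
    v ∈ invSet act Pos w ↔ v ∈ Pos ∧ -(act w⁻¹ v) ∈ Pos := by
  have := mem_posImage_iff act {v : V | -v ∈ Pos} w v
  unfold posImage at this
  unfold invSet
  rw [Set.mem_inter_iff, this]
  rfl

theorem isLinExt_iff
    (hsign : ∀ (w : W) (b : B),
      act w (α b) ∈ Pos ↔ cs.length (w * cs.simple b) = cs.length w + 1)
    {m : ℕ} (Q : Fin m → B) (I : Finset (Fin m)) (π : W) :
    IsLinExt cs act α Pos Q I π ↔ LE' cs Q I π := by
  have hr : ∀ k : Fin m, rootF cs act α Q I k = act (pre cs Q I k) (α (Q k)) := by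
    intro k
    unfold rootF
    rw [← subwordProd_filter]
    rfl
  unfold IsLinExt rootConf LE'
  rw [Set.image_subset_iff]
  refine forall_congr' fun k => forall_congr' fun _ => ?_
  rw [Set.mem_preimage, mem_posImage_iff, hr, ← LinearEquiv.mul_apply, ← map_mul, hsign,
    eta_zero_iff]

theorem wle'_of_wle
    (hsign : ∀ (w : W) (b : B),
      act w (α b) ∈ Pos ↔ cs.length (w * cs.simple b) = cs.length w + 1)
    (hdichotomy : ∀ (w : W) (b : B), act w (α b) ∈ Pos ∨ -(act w (α b)) ∈ Pos)
    (hdisjoint : ∀ v ∈ Pos, -v ∉ Pos) {σ τ : W} (h : wle act Pos σ τ) : wle' cs σ τ := by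
  have hneg : ∀ (w : W) (b : B), -(act w (α b)) ∈ Pos ↔ eta cs w (cs.simple b) ≠ 0 := by
    intro w b
    rw [Ne, eta_zero_iff, ← hsign]
    constructor
    · intro h1 h2; exact hdisjoint _ h2 h1
    · intro h1; exact (hdichotomy w b).resolve_left h1
  have hinv : ∀ (π w : W) (b : B), act w (α b) ∈ invSet act Pos π ↔
      eta cs w (cs.simple b) = 0 ∧ eta cs (π⁻¹ * w) (cs.simple b) ≠ 0 := by
    intro π w b
    rw [mem_invSet_iff, ← LinearEquiv.mul_apply, ← map_mul, hneg, hsign, eta_zero_iff]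
  intro w b h1 h2
  exact ((hinv τ w b).mp (h ((hinv σ w b).mpr ⟨h1, h2⟩))).2

end Translate

end SubwordStatement


open SubwordStatement in
/-- Let `SC(Q, ω)` be a non-empty subword complex for a finite
Coxeter system `(W, S)` with root system `Φ`.  Then:
(1) for every facet `I` of `SC(Q, ω)`, the set `L(I)` of linear extensions of `I`
is order convex in the weak order on `W`;
(2) the union `L(Q, ω)` of the sets `L(I)` over all facets `I` is a lower set of
the weak order;
(3) the interval `[e, ω]` is contained in `L(Q, ω)`;
(4) for any two distinct facets `I₁ ≠ I₂` of `SC(Q, ω)`, `L(I₁) ∩ L(I₂) = ∅`. -/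
theorem subwordComplex_linExt_properties
    {B W : Type*} [Group W] [Finite W] {M : CoxeterMatrix B}
    (cs : CoxeterSystem M W)
    {V : Type*} [AddCommGroup V] [Module ℝ V]
    (act : W →* (V ≃ₗ[ℝ] V)) (α : B → V) (Pos : Set V)
    (hαpos : ∀ b : B, α b ∈ Pos)
    (hsign : ∀ (w : W) (b : B),
      act w (α b) ∈ Pos ↔ cs.length (w * cs.simple b) = cs.length w + 1)
    (hdichotomy : ∀ (w : W) (b : B), act w (α b) ∈ Pos ∨ -(act w (α b)) ∈ Pos)
    (hdisjoint : ∀ v ∈ Pos, -v ∉ Pos)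
    {m : ℕ} (Q : Fin m → B) (ω : W)
    (hnonempty : ∃ I : Finset (Fin m), IsFacet cs Q ω I) :
    (∀ I : Finset (Fin m), IsFacet cs Q ω I →
      ∀ σ τ ρ : W, wlt act Pos σ τ → wlt act Pos τ ρ →
        IsLinExt cs act α Pos Q I σ → IsLinExt cs act α Pos Q I ρ →
        IsLinExt cs act α Pos Q I τ) ∧
    (∀ σ τ : W, wlt act Pos σ τ →
      (∃ I : Finset (Fin m), IsFacet cs Q ω I ∧ IsLinExt cs act α Pos Q I τ) →
      (∃ I : Finset (Fin m), IsFacet cs Q ω I ∧ IsLinExt cs act α Pos Q I σ)) ∧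
    (∀ π : W, wle act Pos 1 π → wle act Pos π ω →
      ∃ I : Finset (Fin m), IsFacet cs Q ω I ∧ IsLinExt cs act α Pos Q I π) ∧
    (∀ I₁ I₂ : Finset (Fin m), IsFacet cs Q ω I₁ → IsFacet cs Q ω I₂ → I₁ ≠ I₂ →
      ∀ π : W, IsLinExt cs act α Pos Q I₁ π → IsLinExt cs act α Pos Q I₂ π →
        False) := by
  have hw := fun {σ τ : W} (h : wle act Pos σ τ) =>
    wle'_of_wle cs act α Pos hsign hdichotomy hdisjoint h
  simp only [isLinExt_iff cs act α Pos hsign]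
  refine ⟨?_, ?_, ?_, ?_⟩
  · intro I _ σ τ ρ h1 h2 hσ hρ k hk
    by_contra hne
    rcases zmod2_cases (eta cs (pre cs Q I k) (cs.simple (Q k))) with h0 | h0
    · exact hw h2.1 _ _ h0 hne (hρ k hk)
    · -- the negative root: use the representative `pre * s`
      have e := fun x : W => eta_mul_simple cs (x * pre cs Q I k) (Q k)
      refine hw h1.1 (pre cs Q I k * cs.simple (Q k)) (Q k) ?_ ?_ ?_
      · rw [eta_mul_simple, h0]; decide
      · rw [← mul_assoc, e, hσ k hk]; decide
      · rw [← mul_assoc, e, (zmod2_cases _).resolve_left hne]; decide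
  · intro σ τ h hex
    exact lower_all cs Q _ σ τ rfl (hw h.1) hex
  · intro π _ h
    exact lower_all cs Q _ π ω rfl (hw h) (exists_top cs Q hnonempty)
  · intro I₁ I₂ h1 h2 hne π hL1 hL2
    exact hne (unique_all cs Q _ π rfl h1 h2 hL1 hL2)
end
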